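/- Let X be a connected n-dimensional complex manifold, Y a connected m-dimensional complex manifold, f(x, y) = (f_1, ..., f_n) a system of n holomorphic functions on X × Y, and let X' denote the common zero set of f_1, ..., f_n in X × Y. If x* is an isolated solution of f(x, y*) = 0 for some y* ∈ Y, then the local dimension of X' at the point (x*, y*) equals m; consequently the union of the irreducible components of X' passing through (x*, y*) has pure dimension m. -/

import Mathlib

set_option synthInstance.maxHeartbeats 1000000
set_option maxHeartbeats 1000000
open Filter Topology

noncomputable instance germAlgebra {α : Type*} (l : Filter α) : Algebra ℂ (Filter.Germ l ℂ) :=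
  ((Filter.Germ.coeRingHom l).comp (Pi.constRingHom α ℂ)).toAlgebra

variable {E : Type*} [NormedAddCommGroup E] [NormedSpace ℂ E]

/-- The local ring of germs at `p` of complex-analytic (holomorphic) functions,
    i.e. the ring of convergent power series centered at `p`. -/
noncomputable def analyticGermsAt (p : E) : Subalgebra ℂ (Filter.Germ (𝓝 p) ℂ) where
  carrier := {g | ∃ f : E → ℂ, AnalyticAt ℂ f p ∧ (f : Filter.Germ (𝓝 p) ℂ) = g}
  mul_mem' := by
    rintro a b ⟨f, hf, rfl⟩ ⟨g, hg, rfl⟩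
    exact ⟨f * g, hf.mul hg, rfl⟩
  add_mem' := by
    rintro a b ⟨f, hf, rfl⟩ ⟨g, hg, rfl⟩
    exact ⟨f + g, hf.add hg, rfl⟩
  algebraMap_mem' := fun r => ⟨fun _ => r, analyticAt_const, rfl⟩

/-- The multiplicity of a point `p` as a solution of the system `F k = 0`:
    the complex dimension of the quotient of the local ring of convergent power
    series at `p` by the ideal generated by the germs of the `F k`. -/
noncomputable def solMultiplicity {ι : Type*} (p : E) (F : ι → E → ℂ) : ℕ :=
  Module.finrank ℂ
    ((analyticGermsAt p) ⧸ Ideal.span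
      {g : analyticGermsAt p | ∃ k, (g : Filter.Germ (𝓝 p) ℂ) = ((F k : E → ℂ) : Filter.Germ (𝓝 p) ℂ)})


/-- The ideal, in the local ring of convergent power series at `p`, of germs of
    holomorphic functions vanishing on `Z` near `p`. -/
noncomputable def vanishingGermIdeal (Z : Set E) (p : E) : Ideal (analyticGermsAt p) where
  carrier := {g | ∃ f : E → ℂ, AnalyticAt ℂ f p ∧
    (f : Filter.Germ (𝓝 p) ℂ) = (g : Filter.Germ (𝓝 p) ℂ) ∧ ∀ᶠ x in 𝓝[Z] p, f x = 0}
  zero_mem' := ⟨fun _ => 0, analyticAt_const, rfl, Filter.Eventually.of_forall fun _ => rfl⟩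
  add_mem' := by
    rintro a b ⟨f, hf, hfe, hfz⟩ ⟨g, hg, hge, hgz⟩
    refine ⟨f + g, hf.add hg, ?_, ?_⟩
    · show (f : Filter.Germ (𝓝 p) ℂ) + g = _
      rw [hfe, hge]; rfl
    · filter_upwards [hfz, hgz] with x h1 h2
      simp [Pi.add_apply, h1, h2]
  smul_mem' := by
    rintro c g ⟨f, hf, hfe, hfz⟩
    obtain ⟨h, hh, hhe⟩ := c.2
    refine ⟨h * f, hh.mul hf, ?_, ?_⟩
    · show (h : Filter.Germ (𝓝 p) ℂ) * f = _
      rw [hfe, hhe]; rfl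
    · filter_upwards [hfz] with x h1
      simp [Pi.mul_apply, h1]

/-- The local dimension of a set `Z` at a point `p`: the Krull dimension of the
    quotient of the local ring of convergent power series at `p` by the ideal of
    germs vanishing on `Z`. -/
noncomputable def localDim (Z : Set E) (p : E) : WithBot (WithTop ℕ) :=
  ringKrullDim ((analyticGermsAt p) ⧸ vanishingGermIdeal Z p)

/-- `Z` is an analytic subset of the open set `Ω`: locally (at every point of `Ω`)
    it is the common zero set of finitely many holomorphic functions. -/
def IsAnalyticIn (Ω Z : Set E) : Prop :=
  Z ⊆ Ω ∧ ∀ p ∈ Ω, ∃ (U : Set E) (k : ℕ) (g : Fin k → E → ℂ),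
    IsOpen U ∧ p ∈ U ∧ U ⊆ Ω ∧ (∀ j, ∀ x ∈ U, AnalyticAt ℂ (g j) x) ∧
    Z ∩ U = {x ∈ U | ∀ j, g j x = 0}

/-- An irreducible analytic subset of `Ω`. -/
def IsIrreducibleAnalyticIn (Ω C : Set E) : Prop :=
  IsAnalyticIn Ω C ∧ C.Nonempty ∧
    ∀ C₁ C₂ : Set E, IsAnalyticIn Ω C₁ → IsAnalyticIn Ω C₂ →
      C ⊆ C₁ ∪ C₂ → C ⊆ C₁ ∨ C ⊆ C₂

/-- `C` is an irreducible component of the analytic set `Z` in `Ω`. -/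
def IsIrreducibleComponentOfAnalytic (Ω Z C : Set E) : Prop :=
  IsIrreducibleAnalyticIn Ω C ∧ C ⊆ Z ∧
    ∀ C' : Set E, IsIrreducibleAnalyticIn Ω C' → C ⊆ C' → C' ⊆ Z → C' = C

/-- A point `p` is an isolated point of the set `S`. -/
def IsIsolatedIn {α : Type*} [TopologicalSpace α] (S : Set α) (p : α) : Prop :=
  p ∈ S ∧ ∃ U : Set α, IsOpen U ∧ p ∈ U ∧ S ∩ U = {p}

open scoped NNReal ENNReal in
theorem exists_analytic_functionalCalculus {F 𝒜 : Type*} [NormedAddCommGroup F] [NormedSpace ℂ F]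
    [NormedRing 𝒜] [NormedAlgebra ℂ 𝒜] [CompleteSpace 𝒜] (T : 𝒜) (hT : ∀ k : ℕ, ‖T ^ k‖ ≤ 1)
    (f : F × ℂ → ℂ) (hf : AnalyticAt ℂ f 0) :
    ∃ ρ₀ : ℝ, 0 < ρ₀ ∧ ∀ ρ : ℝ, 0 < ρ → ρ < ρ₀ → ∃ (c : ℕ → F → ℂ) (M : F → 𝒜),
      AnalyticAt ℂ M 0 ∧ ∀ᶠ z in 𝓝 (0 : F), HasSum (fun k => c k z • T ^ k) (M z) ∧
        ∀ x : ℂ, ‖x‖ ≤ 1 → HasSum (fun k => c k z * x ^ k) (f (z, ρ * x)) := by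
  obtain ⟨p, R, hp⟩ := hf
  obtain ⟨r, hr0, hrR⟩ := ENNReal.lt_iff_exists_nnreal_btwn.1 (ENNReal.half_pos hp.r_pos.ne')
  have hr0' : 0 < r := by exact_mod_cast hr0
  have hrr : ((r : ℝ≥0∞) + r) < R := by
    calc (r : ℝ≥0∞) + r < R / 2 + R / 2 := ENNReal.add_lt_add hrR hrR
      _ = R := ENNReal.add_halves R
  have hrp : ((r : ℝ≥0∞) + r) < p.radius := hrr.trans_le hp.r_le
  refine ⟨r, hr0', fun ρ hρ hρr => ?_⟩
  set e : F × ℂ := (0, (ρ : ℂ)) with he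
  have hen : ‖e‖ ≤ r := by
    simp only [he, Prod.norm_def, norm_zero, Complex.norm_real, Real.norm_eq_abs, abs_of_pos hρ]
    exact max_le r.2 hρr.le
  obtain ⟨D, hD⟩ : ∃ D : ∀ k : ℕ, ((F × ℂ) [×k]→L[ℂ] ℂ) →L[ℂ] 𝒜,
      ∀ k φ, D k φ = φ (fun _ => e) • T ^ k :=
    ⟨fun k => (ContinuousLinearMap.toSpanSingleton ℂ (T ^ k)).comp
      (ContinuousMultilinearMap.apply ℂ (fun _ : Fin k => F × ℂ) ℂ (fun _ => e)), fun k φ => rfl⟩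
  obtain ⟨Q, hQD⟩ : ∃ Q : ∀ k l : ℕ, F [×l]→L[ℂ] 𝒜,
      ∀ k l v, Q k l v = D k (p.changeOriginSeries k l (fun i => (v i, 0))) :=
    ⟨fun k l => ((D k).compContinuousMultilinearMap
      (p.changeOriginSeries k l)).compContinuousLinearMap
        (fun _ => ContinuousLinearMap.inl ℂ F ℂ), fun k l v => rfl⟩
  have hQ : ∀ k l v, Q k l v =
      (p.changeOriginSeries k l (fun i => (v i, 0)) (fun _ => e)) • T ^ k :=
    fun k l v => by rw [hQD, hD]
  have hιn : ∀ v : F, ‖((v, 0) : F × ℂ)‖ = ‖v‖ := fun v => by simp [Prod.norm_def]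
  have hQn : ∀ k l, ‖Q k l‖ ≤ ‖p.changeOriginSeries k l‖ * r ^ k := fun k l => by
    refine ContinuousMultilinearMap.opNorm_le_bound (by positivity) fun v => ?_
    rw [hQ, norm_smul]
    calc _ ≤ (‖p.changeOriginSeries k l‖ * ∏ i, ‖v i‖) * (r : ℝ) ^ k * 1 := by
          gcongr
          · refine (ContinuousMultilinearMap.le_opNorm _ _).trans ?_
            gcongr
            · refine (ContinuousMultilinearMap.le_opNorm _ _).trans ?_
              simp [hιn]
            · simp only [Finset.prod_const, Finset.card_univ, Fintype.card_fin]
              gcongr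
          · exact hT k
      _ = _ := by ring
  have hsum : Summable fun s : Σ _ : ℕ, ℕ =>
      ‖p.changeOriginSeries s.1 s.2‖₊ * r ^ s.2 * r ^ s.1 := by
    have h1 := p.changeOriginSeries_summable_aux₁ hrp
    have h2 := (Equiv.sigmaAssoc
      (fun (k l : ℕ) => { s : Finset (Fin (k + l)) // s.card = l})).summable_iff.2 h1
    have h3 := (NNReal.summable_sigma.1 h2).2
    refine NNReal.summable_of_le (fun s => ?_) h3
    simp only [Function.comp_def, Equiv.sigmaAssoc, Equiv.coe_fn_mk, NNReal.tsum_mul_right]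
    gcongr
    apply p.nnnorm_changeOriginSeries_le_tsum
  have hsum' : Summable fun s : ℕ × ℕ => ‖Q s.1 s.2‖ * (r : ℝ) ^ s.2 := by
    have h1 := (Equiv.sigmaEquivProd ℕ ℕ).symm.summable_iff.2 hsum
    have h2 : Summable fun s : ℕ × ℕ => ‖p.changeOriginSeries s.1 s.2‖ * (r:ℝ) ^ s.2 * r ^ s.1 := by
      have := NNReal.summable_coe.2 h1
      exact this
    refine Summable.of_nonneg_of_le (fun s => by positivity) (fun s => ?_) h2
    calc _ ≤ (‖p.changeOriginSeries s.1 s.2‖ * r ^ s.1) * (r : ℝ) ^ s.2 := by gcongr; exact hQn _ _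
      _ = _ := by ring
  have hsw := (Equiv.prodComm ℕ ℕ).summable_iff.2 hsum'
  have hQs : ∀ l, Summable fun k => ‖Q k l‖ := fun l => by
    have h := hsw.prod_factor l
    simp only [Function.comp_def, Equiv.prodComm_apply, Prod.swap] at h
    exact (summable_mul_right_iff (by positivity)).1 h
  let q : FormalMultilinearSeries ℂ F 𝒜 := fun l => ∑' k, Q k l
  have hqs : ∀ l, HasSum (fun k => Q k l) (q l) := fun l => (Summable.of_norm (hQs l)).hasSum
  have hqr : (r : ℝ≥0∞) ≤ q.radius := by
    refine q.le_radius_of_summable ?_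
    refine Summable.of_nonneg_of_le (fun s => by positivity) (fun l => ?_) hsw.prod
    simp only [Function.comp_def, Equiv.prodComm_apply, Prod.swap]
    rw [tsum_mul_right]
    gcongr
    exact norm_tsum_le_tsum_norm (hQs l)
  have hq := (q.hasFPowerSeriesOnBall (hr0.trans_le hqr)).mono hr0 hqr
  refine ⟨fun k z => p.changeOrigin (z, 0) k (fun _ => e), q.sum, hq.analyticAt, ?_⟩
  have hball : Metric.eball (0 : F) r ∈ 𝓝 (0 : F) := Metric.eball_mem_nhds _ hr0
  filter_upwards [hball] with z hz
  have hzr : ‖z‖ ≤ r := by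
    have := mem_eball_zero_iff.1 hz
    exact_mod_cast this.le
  have hzr' : (‖((z, 0) : F × ℂ)‖₊ : ℝ≥0∞) ≤ r := by
    rw [ENNReal.coe_le_coe, ← NNReal.coe_le_coe]; simpa [hιn] using hzr
  have hz' : ((z, 0) : F × ℂ) ∈ Metric.eball (0 : F × ℂ) p.radius := by
    rw [mem_eball_zero_iff]
    exact lt_of_le_of_lt hzr' (lt_of_le_of_lt le_self_add hrp)
  constructor
  · have hdbl : Summable fun s : ℕ × ℕ => Q s.1 s.2 (fun _ => z) := by
      refine Summable.of_norm_bounded hsum' fun s => ?_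
      refine (ContinuousMultilinearMap.le_opNorm _ _).trans ?_
      simp only [Finset.prod_const, Finset.card_univ, Fintype.card_fin]
      gcongr
    have h1 : HasSum (fun s : ℕ × ℕ => Q s.2 s.1 (fun _ => z)) (q.sum z) := by
      have hs := (Equiv.prodComm ℕ ℕ).summable_iff.2 hdbl
      have h2 := hs.hasSum.prod_fiberwise (g := fun l => q l (fun _ => z))
        (fun l => ContinuousMultilinearMap.hasSum_eval (hqs l) _)
      have h3 := hq.hasSum hz
      rw [zero_add] at h3
      rw [← h2.unique h3]
      exact hs.hasSum
    have h2 := (Equiv.prodComm ℕ ℕ).hasSum_iff.2 h1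
    refine h2.prod_fiberwise fun k => ?_
    have h3 := (p.hasFPowerSeriesOnBall_changeOrigin k (bot_le.trans_lt hrp)).hasSum hz'
    rw [zero_add] at h3
    have h4 := (D k).hasSum h3
    simp only [hD] at h4
    simp only [Function.comp_def, hQ, Equiv.prodComm_apply, Prod.swap]
    exact h4
  · intro x hx
    have hxe : ‖x • e‖ ≤ r := by
      rw [norm_smul]
      calc _ ≤ 1 * (r : ℝ) := by gcongr
        _ = r := one_mul _
    have hxr : (‖x • e‖₊ : ℝ≥0∞) ≤ r := by
      rw [ENNReal.coe_le_coe, ← NNReal.coe_le_coe]; simpa using hxe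
    have hlt : (‖((z, 0) : F × ℂ)‖₊ + ‖x • e‖₊ : ℝ≥0∞) < R :=
      lt_of_le_of_lt (add_le_add hzr' hxr) hrr
    have h1 := p.changeOrigin_eval (hlt.trans_le hp.r_le)
    have h2 : ((z, 0) : F × ℂ) + x • e = (z, ρ * x) := by
      simp [he, mul_comm]
    have hmem : ((z, 0) : F × ℂ) + x • e ∈ Metric.eball (0 : F × ℂ) R := by
      rw [mem_eball_zero_iff]
      exact lt_of_le_of_lt (by exact_mod_cast nnnorm_add_le _ _) hlt
    have h3 : f (z, ρ * x) = p.sum ((z, 0) + x • e) := by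
      have := hp.sum hmem
      rw [← h2]; simpa using this
    have hmem2 : x • e ∈ Metric.eball (0 : F × ℂ) (p.changeOrigin (z, 0)).radius := by
      refine mem_eball_zero_iff.2 (lt_of_lt_of_le ?_ p.changeOrigin_radius)
      rw [lt_tsub_iff_right, add_comm]
      exact hlt.trans_le hp.r_le
    rw [h3, ← h1]
    have h4 : HasSum (fun k => p.changeOrigin (z, 0) k (fun _ => x • e))
        ((p.changeOrigin (z, 0)).sum (x • e)) := ((p.changeOrigin (z, 0)).summable hmem2).hasSum
    have h5 : ∀ k, p.changeOrigin (z, 0) k (fun _ => x • e)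
        = p.changeOrigin (z, 0) k (fun _ => e) * x ^ k := fun k => by
      have := (p.changeOrigin (z, 0) k).map_smul_univ (fun _ => x) (fun _ => e)
      simp only [Finset.prod_const, Finset.card_univ, Fintype.card_fin] at this
      rw [this, smul_eq_mul, mul_comm]
    rwa [funext h5] at h4

theorem eq_ite_of_hasSum_monomial {c : ℕ → ℂ} {b : ℕ} {s : ℂ} {g : ℂ → ℂ}
    (hc : ∀ᶠ x in 𝓝 (0 : ℂ), HasSum (fun k => c k * x ^ k) (g x))
    (hg : ∀ᶠ x in 𝓝 (0 : ℂ), g x = s * x ^ b) (k : ℕ) : c k = if k = b then s else 0 := by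
  have h1 : HasFPowerSeriesAt g (FormalMultilinearSeries.ofScalars ℂ c) 0 := by
    rw [hasFPowerSeriesAt_iff]
    filter_upwards [hc] with x hx
    simpa [FormalMultilinearSeries.coeff_ofScalars, mul_comm] using hx
  have h2 : HasFPowerSeriesAt g
      (FormalMultilinearSeries.ofScalars ℂ (fun k => if k = b then s else 0)) 0 := by
    rw [hasFPowerSeriesAt_iff]
    filter_upwards [hg] with x hx
    rw [zero_add, hx]
    have := hasSum_single (f := fun n : ℕ => x ^ n • (if n = b then s else 0)) b
      (fun n hn => by simp [hn])
    simpa [FormalMultilinearSeries.coeff_ofScalars, mul_comm] using this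
  have h3 := congrArg (fun q => q.coeff k) (h1.eq_formalMultilinearSeries h2)
  simpa [FormalMultilinearSeries.coeff_ofScalars] using h3

section Shift
variable {F B : Type*} [NormedAddCommGroup F] [NormedSpace ℂ F]
  [NormedAddCommGroup B] [NormedSpace ℂ B] [CompleteSpace B]

theorem AnalyticAt.clm_apply' {G A C : Type*} [NormedAddCommGroup G] [NormedSpace ℂ G]
    [NormedAddCommGroup A] [NormedSpace ℂ A] [NormedAddCommGroup C] [NormedSpace ℂ C]
    {T : G → A →L[ℂ] C} {u : G → A} {z : G} (hT : AnalyticAt ℂ T z) (hu : AnalyticAt ℂ u z) :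
    AnalyticAt ℂ (fun x => T x (u x)) z :=
  AnalyticAt.comp_of_eq (g := fun w : (A →L[ℂ] C) × A => w.1 w.2) (f := fun x => (T x, u x))
    ((ContinuousLinearMap.id ℂ (A →L[ℂ] C)).analyticAt_bilinear _) (hT.prod hu) rfl

theorem weierstrass_division_of_shift (R L : B →L[ℂ] B) (δ : B →L[ℂ] ℂ) (e : B)
    (hL : ‖L‖ ≤ 1) (hR : ∀ k, ‖R ^ k‖ ≤ 1) (hLR : L * R = 1)
    (hdec : ∀ a, R (L a) + δ a • e = a) (hδR : ∀ a, δ (R a) = 0) (hδe : δ e = 1)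
    (b : ℕ) (f g : F × ℂ → ℂ) (hf : AnalyticAt ℂ f 0) (hg : AnalyticAt ℂ g 0)
    (hfb : ∀ᶠ x in 𝓝 (0 : ℂ), f (0, x) = x ^ b) :
    ∃ (q : F × ℂ → ℂ) (r : ℕ → F → ℂ), AnalyticAt ℂ q 0 ∧ (∀ j, AnalyticAt ℂ (r j) 0) ∧
      ∀ᶠ w in 𝓝 (0 : F × ℂ), g w = q w * f w + ∑ j ∈ Finset.range b, r j w.1 * w.2 ^ j := by
  obtain ⟨ρ₁, hρ₁, H₁⟩ := exists_analytic_functionalCalculus R hR f hf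
  obtain ⟨ρ₂, hρ₂, H₂⟩ := exists_analytic_functionalCalculus R hR g hg
  obtain ⟨ρ, hρ, hρlt⟩ := exists_between (lt_min hρ₁ hρ₂)
  obtain ⟨c, M, hM, hcM⟩ := H₁ ρ hρ (hρlt.trans_le (min_le_left _ _))
  obtain ⟨d, N, hN, hdN⟩ := H₂ ρ hρ (hρlt.trans_le (min_le_right _ _))
  have hρ0 : (ρ : ℂ) ≠ 0 := by exact_mod_cast hρ.ne'
  -- evaluation functionals
  let ev : ℂ → B →L[ℂ] ℂ := fun x => δ.comp (Ring.inverse (1 - x • L))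
  have hunit : ∀ x : ℂ, ‖x‖ < 1 → IsUnit (1 - x • L) := fun x hx => by
    apply isUnit_one_sub_of_norm_lt_one
    rw [norm_smul]
    calc _ ≤ ‖x‖ * 1 := by gcongr
      _ < 1 := by simpa using hx
  have hReq : ∀ x : ℂ, ‖x‖ < 1 → Ring.inverse (1 - x • L) * R
      = R + x • Ring.inverse (1 - x • L) := fun x hx => by
    have h1 : R = (1 - x • L) * R + x • 1 := by
      rw [sub_mul, smul_mul_assoc, hLR]; simp
    calc _ = Ring.inverse (1 - x • L) * ((1 - x • L) * R + x • 1) := by rw [← h1]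
      _ = _ := by
        rw [mul_add, ← mul_assoc, Ring.inverse_mul_cancel _ (hunit x hx)]; simp
  have hevR : ∀ x : ℂ, ‖x‖ < 1 → ∀ a, ev x (R a) = x * ev x a := fun x hx a => by
    have := congrArg (fun T : B →L[ℂ] B => δ (T a)) (hReq x hx)
    simpa [ev, hδR] using this
  have hevRk : ∀ x : ℂ, ‖x‖ < 1 → ∀ (k : ℕ) a, ev x ((R ^ k) a) = x ^ k * ev x a := by
    intro x hx k a
    induction k with
    | zero => simp
    | succ k ih => rw [pow_succ', mul_apply_eq_comp, hevR x hx, ih]; ring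
  have hLe : L e = 0 := by
    have h := congrArg L (hdec e)
    have h2 : ∀ a, L (R a) = a := fun a => DFunLike.congr_fun hLR a
    rw [hδe, one_smul, map_add, h2] at h
    simpa using h
  have heve : ∀ x : ℂ, ‖x‖ < 1 → ev x e = 1 := fun x hx => by
    have h1 : (1 - x • L) e = e := by simp [hLe]
    have h2 := DFunLike.congr_fun (Ring.inverse_mul_cancel _ (hunit x hx)) e
    rw [mul_apply_eq_comp, h1] at h2
    simp [ev, h2, hδe]
  have hevM : ∀ {c : ℕ → F → ℂ} {M : F → B →L[ℂ] B} {f : F × ℂ → ℂ} {z : F},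
      HasSum (fun k => c k z • R ^ k) (M z) →
      (∀ x : ℂ, ‖x‖ ≤ 1 → HasSum (fun k => c k z * x ^ k) (f (z, ρ * x))) →
      ∀ x : ℂ, ‖x‖ < 1 → ∀ a, ev x (M z a) = f (z, ρ * x) * ev x a := by
    intro c M f z h1 h2 x hx a
    have h3 := ((ev x).comp (ContinuousLinearMap.apply ℂ B a)).hasSum h1
    have h4 := (h2 x hx.le).mul_right (ev x a)
    refine h3.unique ?_
    convert! h4 using 2 with k
    change ev x ((c k z • R ^ k) a) = _
    rw [smul_apply, map_smul, hevRk x hx, smul_eq_mul, mul_assoc]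
  have hLRk : ∀ k : ℕ, L ^ k * R ^ k = 1 := by
    intro k
    induction k with
    | zero => simp
    | succ k ih => rw [pow_succ, pow_succ', mul_assoc, ← mul_assoc L, hLR, one_mul, ih]
  have hdeck : ∀ (k : ℕ) (v : B), v = (R ^ k) ((L ^ k) v)
      + ∑ j ∈ Finset.range k, δ ((L ^ j) v) • (R ^ j) e := by
    intro k v
    induction k with
    | zero => simp
    | succ k ih =>
      have h1 := hdec ((L ^ k) v)
      rw [Finset.sum_range_succ, pow_succ R, pow_succ' L, mul_apply_eq_comp, mul_apply_eq_comp]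
      conv_lhs => rw [ih, ← h1]
      simp only [map_add, map_smul]
      have h2 : (L ^ k) v = R (L ((L ^ k) v)) + δ ((L ^ k) v) • e := h1.symm
      abel
  -- the operator to be inverted
  let P : B →L[ℂ] B := R ^ b * L ^ b
  let K : F → B →L[ℂ] B := fun z => M z * L ^ b + (1 - P)
  have hK : AnalyticAt ℂ K 0 := (hM.mul analyticAt_const).add analyticAt_const
  have hM0 : M 0 = (ρ : ℂ) ^ b • R ^ b := by
    have h1 := hcM.self_of_nhds
    have h2 : ∀ k, c k 0 = if k = b then (ρ : ℂ) ^ b else 0 := by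
      refine eq_ite_of_hasSum_monomial (g := fun x => f (0, ρ * x)) ?_ ?_
      · filter_upwards [Metric.closedBall_mem_nhds (0 : ℂ) one_pos] with x hx
        exact h1.2 x (by simpa using hx)
      · have : Tendsto (fun x : ℂ => (ρ : ℂ) * x) (𝓝 0) (𝓝 0) :=
          (continuous_const.mul continuous_id).tendsto' _ _ (by simp)
        filter_upwards [this.eventually hfb] with x hx
        rw [hx, mul_pow]
    refine h1.1.unique ?_
    convert! hasSum_single (f := fun k => c k 0 • R ^ k) b (fun k hk => by simp [h2, hk]) using 2
    simp [h2]
  have hPP : P * P = P := by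
    simp only [P]
    rw [mul_assoc, ← mul_assoc (L ^ b), hLRk, one_mul]
  have hK0 : IsUnit (K 0) := by
    have hKP : K 0 = (ρ : ℂ) ^ b • P + (1 - P) := by
      simp only [K, hM0, P, smul_mul_assoc]
    have hc : (ρ : ℂ) ^ b ≠ 0 := pow_ne_zero _ hρ0
    have key : ∀ s t : ℂ, s * t = 1 → (s • P + (1 - P)) * (t • P + (1 - P)) = 1 := by
      intro s t hst
      have h1 : (s • P) * (t • P) = P := by rw [smul_mul_smul_comm, hst, hPP, one_smul]
      have h2 : (s • P) * (1 - P) = 0 := by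
        rw [smul_mul_assoc, mul_sub, mul_one, hPP, sub_self, smul_zero]
      have h3 : (1 - P) * (t • P) = 0 := by
        rw [mul_smul_comm, sub_mul, one_mul, hPP, sub_self, smul_zero]
      have h4 : (1 - P) * (1 - P) = 1 - P := by
        rw [mul_sub, mul_one, sub_mul, one_mul, hPP, sub_self, sub_zero]
      rw [add_mul, mul_add, mul_add, h1, h2, h3, h4]
      abel
    rw [hKP]
    exact ⟨⟨_, ((ρ : ℂ) ^ b)⁻¹ • P + (1 - P), key _ _ (mul_inv_cancel₀ hc),
      key _ _ (inv_mul_cancel₀ hc)⟩, rfl⟩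
  have hKu : ∀ᶠ z in 𝓝 (0 : F), IsUnit (K z) :=
    hK.continuousAt.eventually (Units.isOpen.mem_nhds hK0)
  have hinv : ∀ {A : B →L[ℂ] B}, IsUnit A → AnalyticAt ℂ Ring.inverse A := by
    rintro A ⟨u, rfl⟩
    exact analyticAt_inverse u
  let v : F → B := fun z => Ring.inverse (K z) (N z e)
  have hv : AnalyticAt ℂ v 0 :=
    AnalyticAt.clm_apply' (AnalyticAt.comp_of_eq (hinv hK0) hK rfl)
      (hN.clm_apply' analyticAt_const)
  have hr : ∀ j, AnalyticAt ℂ (fun z => δ ((L ^ j) (v z)) / (ρ : ℂ) ^ j) 0 := fun j =>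
    AnalyticAt.div ((δ.analyticAt _).comp (((L ^ j).analyticAt _).comp hv)) analyticAt_const
      (pow_ne_zero _ hρ0)
  have hev : AnalyticAt ℂ (fun w : F × ℂ => Ring.inverse (1 - (w.2 / (ρ : ℂ)) • L)) 0 := by
    have h1 : AnalyticAt ℂ (fun w : F × ℂ => 1 - (w.2 / (ρ : ℂ)) • L) 0 :=
      analyticAt_const.sub ((analyticAt_snd.div analyticAt_const hρ0).smul analyticAt_const)
    refine AnalyticAt.comp_of_eq (g := Ring.inverse) (hinv ?_) h1 rfl
    exact hunit _ (by simp)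
  refine ⟨fun w => ev (w.2 / ρ) ((L ^ b) (v w.1)), fun j z => δ ((L ^ j) (v z)) / (ρ : ℂ) ^ j,
    ?_, hr, ?_⟩
  · have h1 : AnalyticAt ℂ (fun w : F × ℂ => v w.1) 0 :=
      AnalyticAt.comp_of_eq (g := v) (f := Prod.fst) hv analyticAt_fst rfl
    exact (δ.analyticAt _).comp (AnalyticAt.clm_apply' hev (((L ^ b).analyticAt _).comp h1))
  · have hfst : Tendsto (Prod.fst : F × ℂ → F) (𝓝 0) (𝓝 0) := continuous_fst.tendsto' _ _ rfl
    have hsnd : Tendsto (fun w : F × ℂ => w.2 / (ρ : ℂ)) (𝓝 0) (𝓝 0) :=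
      (continuous_snd.div_const _).tendsto' _ _ (by simp)
    filter_upwards [hfst.eventually hcM, hfst.eventually hdN, hfst.eventually hKu,
      hsnd.eventually (Metric.ball_mem_nhds (0 : ℂ) one_pos)] with w hw1 hw2 hw3 hw4
    have hx : ‖w.2 / (ρ : ℂ)‖ < 1 := by simpa using hw4
    have hwx : (w.1, (ρ : ℂ) * (w.2 / ρ)) = w := by
      rw [mul_div_cancel₀ _ hρ0]
    have e1 := hevM hw2.1 hw2.2 _ hx e
    rw [heve _ hx, mul_one, hwx] at e1
    have e2 : N w.1 e = K w.1 (v w.1) := by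
      have := DFunLike.congr_fun (Ring.mul_inverse_cancel _ hw3) (N w.1 e)
      exact this.symm
    have e3 : K w.1 (v w.1) = M w.1 ((L ^ b) (v w.1))
        + ∑ j ∈ Finset.range b, δ ((L ^ j) (v w.1)) • (R ^ j) e := by
      have h1 : K w.1 (v w.1) = M w.1 ((L ^ b) (v w.1)) + (v w.1 - (R ^ b) ((L ^ b) (v w.1))) := rfl
      rw [h1, sub_eq_of_eq_add' (hdeck b (v w.1))]
    rw [← e1, e2, e3, map_add, hevM hw1.1 hw1.2 _ hx, hwx, map_sum, mul_comm]
    congr 1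
    refine Finset.sum_congr rfl fun j _ => ?_
    rw [map_smul, hevRk _ hx, heve _ hx, smul_eq_mul, mul_one, div_pow]
    ring
end Shift

open BoundedContinuousFunction in
/-- **Weierstrass division** (existence) by a function which restricts to `x ^ b` on the axis. -/
theorem weierstrass_division_monomial {F : Type*} [NormedAddCommGroup F] [NormedSpace ℂ F]
    (b : ℕ) (f g : F × ℂ → ℂ) (hf : AnalyticAt ℂ f 0) (hg : AnalyticAt ℂ g 0)
    (hfb : ∀ᶠ x in 𝓝 (0 : ℂ), f (0, x) = x ^ b) :
    ∃ (q : F × ℂ → ℂ) (r : ℕ → F → ℂ), AnalyticAt ℂ q 0 ∧ (∀ j, AnalyticAt ℂ (r j) 0) ∧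
      ∀ᶠ w in 𝓝 (0 : F × ℂ), g w = q w * f w + ∑ j ∈ Finset.range b, r j w.1 * w.2 ^ j := by
  let sh : (ℕ →ᵇ ℂ) → (ℕ →ᵇ ℂ) := fun a =>
    ofNormedAddCommGroupDiscrete (fun n => n.casesOn 0 a) ‖a‖
      (fun n => by cases n <;> simp [a.norm_coe_le_norm])
  let R : (ℕ →ᵇ ℂ) →L[ℂ] (ℕ →ᵇ ℂ) := LinearMap.mkContinuous
    { toFun := sh
      map_add' := fun a c => by ext n; cases n <;> simp [sh]
      map_smul' := fun s a => by ext n; cases n <;> simp [sh] } 1 (fun a => by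
        rw [one_mul]
        exact (BoundedContinuousFunction.norm_le (norm_nonneg a)).2
          (fun n => by cases n <;> simp [sh, a.norm_coe_le_norm]))
  let L : (ℕ →ᵇ ℂ) →L[ℂ] (ℕ →ᵇ ℂ) := LinearMap.mkContinuous
    { toFun := fun a => a.compContinuous ⟨Nat.succ, continuous_of_discreteTopology⟩
      map_add' := fun a c => by ext n; simp
      map_smul' := fun s a => by ext n; simp } 1 (fun a => by
        rw [one_mul]
        exact (BoundedContinuousFunction.norm_le (norm_nonneg a)).2
          (fun n => a.norm_coe_le_norm _))
  have hR : ‖R‖ ≤ 1 := LinearMap.mkContinuous_norm_le _ zero_le_one _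
  refine weierstrass_division_of_shift R L (BoundedContinuousFunction.evalCLM ℂ 0)
    (ofNormedAddCommGroupDiscrete (fun n => n.casesOn 1 0) 1 (fun n => by cases n <;> simp))
    (LinearMap.mkContinuous_norm_le _ zero_le_one _) (fun k => ?_) ?_ (fun a => ?_) (fun a => rfl)
    rfl b f g hf hg hfb
  · rcases k.eq_zero_or_pos with rfl | hk
    · exact ContinuousLinearMap.norm_id_le
    · exact (norm_pow_le' R hk).trans (pow_le_one₀ (norm_nonneg _) hR)
  · ext a n; rfl
  · ext n; cases n <;> simp [R, L, sh]

/-- **Weierstrass division** (existence) at an arbitrary base point. -/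
theorem weierstrass_division {E F : Type*} [NormedAddCommGroup E] [NormedSpace ℂ E]
    [NormedAddCommGroup F] [NormedSpace ℂ F] (e : E ≃L[ℂ] F × ℂ) (p : E) {f g : E → ℂ}
    (hf : AnalyticAt ℂ f p) (hg : AnalyticAt ℂ g p) {b : ℕ} {u : ℂ → ℂ} (hu : AnalyticAt ℂ u 0)
    (hu0 : u 0 ≠ 0) (hfu : ∀ᶠ t in 𝓝 (0 : ℂ), f (e.symm (e p + (0, t))) = t ^ b * u t) :
    ∃ (q : E → ℂ) (r : ℕ → F → ℂ), AnalyticAt ℂ q p ∧ (∀ j, AnalyticAt ℂ (r j) (e p).1) ∧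
      ∀ᶠ w in 𝓝 p, g w = q w * f w
        + ∑ j ∈ Finset.range b, r j (e w).1 * ((e w).2 - (e p).2) ^ j := by
  let T : F × ℂ → E := fun w => e.symm (e p + w)
  have hT0 : T 0 = p := by simp [T]
  have hT : AnalyticAt ℂ T 0 :=
    ((e.symm : F × ℂ →L[ℂ] E).analyticAt _).comp (analyticAt_const.add analyticAt_id)
  let S : E → F × ℂ := fun w => e w - e p
  have hS : AnalyticAt ℂ S p := ((e : E →L[ℂ] F × ℂ).analyticAt _).sub analyticAt_const
  have hS0 : S p = 0 := by simp [S]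
  have hTS : ∀ w, T (S w) = w := fun w => by simp [T, S]
  have husnd : AnalyticAt ℂ (fun w : F × ℂ => u w.2) 0 :=
    AnalyticAt.comp_of_eq (g := u) (f := Prod.snd) hu analyticAt_snd rfl
  obtain ⟨q, r, hq, hr, h⟩ := weierstrass_division_monomial b (fun w => f (T w) / u w.2)
    (fun w => g (T w)) ((AnalyticAt.comp_of_eq hf hT hT0).div husnd hu0)
    (AnalyticAt.comp_of_eq hg hT hT0) (by
      filter_upwards [hfu, hu.continuousAt.eventually_ne hu0] with t ht hut
      simp only [T, ht, mul_div_assoc, div_self hut, mul_one])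
  refine ⟨fun w => q (S w) / u (S w).2, fun j z => r j (z - (e p).1), ?_, fun j => ?_, ?_⟩
  · refine (AnalyticAt.comp_of_eq hq hS hS0).div
      (AnalyticAt.comp_of_eq (g := fun w : F × ℂ => u w.2) husnd hS hS0) ?_
    simpa [hS0] using hu0
  · exact AnalyticAt.comp_of_eq (hr j) (analyticAt_id.sub analyticAt_const) (by simp)
  · have hSt : Tendsto S (𝓝 p) (𝓝 0) := by
      have := hS.continuousAt.tendsto
      rwa [hS0] at this
    filter_upwards [hSt.eventually h] with w hw
    rw [hTS] at hw
    rw [hw]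
    simp only [S, Prod.fst_sub, Prod.snd_sub]
    ring

/-- The local ring `analyticGermsAt p`, as a type with its own ring structure. -/
def Hol (p : E) : Type _ := analyticGermsAt p

namespace Hol

variable {F : Type*} [NormedAddCommGroup F] [NormedSpace ℂ F] {p : E} {q : F}

noncomputable instance : CommRing (Hol p) := inferInstanceAs (CommRing (analyticGermsAt p))

noncomputable instance : Algebra ℂ (Hol p) := inferInstanceAs (Algebra ℂ (analyticGermsAt p))

/-- The underlying germ. -/
noncomputable def toGerm (p : E) : Hol p →+* Germ (𝓝 p) ℂ := (analyticGermsAt p).val.toRingHom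

theorem toGerm_injective : Function.Injective (toGerm p) := Subtype.val_injective

/-- The germ of an analytic function. -/
def mk (f : E → ℂ) (hf : AnalyticAt ℂ f p) : Hol p := ⟨(f : Germ (𝓝 p) ℂ), f, hf, rfl⟩

@[simp]
theorem toGerm_mk (f : E → ℂ) (hf : AnalyticAt ℂ f p) : toGerm p (mk f hf) = (f : Germ (𝓝 p) ℂ) :=
  rfl

theorem exists_rep (a : Hol p) : ∃ (f : E → ℂ) (hf : AnalyticAt ℂ f p), mk f hf = a := by
  obtain ⟨a, f, hf, rfl⟩ := a
  exact ⟨f, hf, rfl⟩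

theorem mk_eq_mk {f g : E → ℂ} {hf : AnalyticAt ℂ f p} {hg : AnalyticAt ℂ g p} :
    mk f hf = mk g hg ↔ f =ᶠ[𝓝 p] g :=
  toGerm_injective.eq_iff.symm.trans Germ.coe_eq

theorem mk_add {f g : E → ℂ} (hf : AnalyticAt ℂ f p) (hg : AnalyticAt ℂ g p) :
    mk f hf + mk g hg = mk (f + g) (hf.add hg) := rfl

theorem mk_mul {f g : E → ℂ} (hf : AnalyticAt ℂ f p) (hg : AnalyticAt ℂ g p) :
    mk f hf * mk g hg = mk (f * g) (hf.mul hg) := rfl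

theorem mk_const (c : ℂ) : mk (fun _ : E => c) analyticAt_const = algebraMap ℂ (Hol p) c := rfl

theorem mk_eq_zero {f : E → ℂ} {hf : AnalyticAt ℂ f p} : mk f hf = 0 ↔ ∀ᶠ x in 𝓝 p, f x = 0 :=
  mk_eq_mk (hg := analyticAt_const)

/-- Evaluation of germs along a map converging to `p`. -/
noncomputable def ev {γ : Type*} (l : Filter γ) (t : γ → E) (ht : Tendsto t l (𝓝 p)) :
    Hol p →+* Germ l ℂ where
  toFun a := (toGerm p a).compTendsto t ht
  map_one' := rfl
  map_zero' := rfl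
  map_add' a b := by
    obtain ⟨f, hf, rfl⟩ := exists_rep a
    obtain ⟨g, hg, rfl⟩ := exists_rep b
    rfl
  map_mul' a b := by
    obtain ⟨f, hf, rfl⟩ := exists_rep a
    obtain ⟨g, hg, rfl⟩ := exists_rep b
    rfl

theorem ev_mk {γ : Type*} {l : Filter γ} {t : γ → E} (ht : Tendsto t l (𝓝 p)) (f : E → ℂ)
    (hf : AnalyticAt ℂ f p) : ev l t ht (mk f hf) = ((fun x => f (t x) : γ → ℂ) : Germ l ℂ) := rfl

/-- Pullback of germs along an analytic map. -/
noncomputable def pull (φ : E → F) (hφ : AnalyticAt ℂ φ p) (hq : φ p = q) : Hol q →+* Hol p where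
  toFun a := ⟨ev (𝓝 p) φ (hq ▸ hφ.continuousAt) a, by
    obtain ⟨f, hf, rfl⟩ := exists_rep a
    exact ⟨f ∘ φ, AnalyticAt.comp_of_eq hf hφ hq, rfl⟩⟩
  map_one' := rfl
  map_zero' := rfl
  map_add' a b := toGerm_injective ((ev (𝓝 p) φ (hq ▸ hφ.continuousAt)).map_add a b)
  map_mul' a b := toGerm_injective ((ev (𝓝 p) φ (hq ▸ hφ.continuousAt)).map_mul a b)

theorem pull_mk (φ : E → F) (hφ : AnalyticAt ℂ φ p) (hq : φ p = q) (f : F → ℂ)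
    (hf : AnalyticAt ℂ f q) :
    pull φ hφ hq (mk f hf) = mk (fun x => f (φ x)) (AnalyticAt.comp_of_eq hf hφ hq) := rfl

theorem pull_injective_of_open {φ : E → F} (hφ : AnalyticAt ℂ φ p) (hq : φ p = q)
    (h : 𝓝 q ≤ map φ (𝓝 p)) : Function.Injective (pull φ hφ hq) := by
  rw [injective_iff_map_eq_zero]
  intro a ha
  obtain ⟨f, hf, rfl⟩ := exists_rep a
  rw [pull_mk, mk_eq_zero] at ha
  exact mk_eq_zero.2 (h ha)

/-- The value of a germ at the base point. -/
noncomputable def val (p : E) : Hol p →+* ℂ := Germ.valueRingHom.comp (toGerm p)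

@[simp]
theorem val_mk (f : E → ℂ) (hf : AnalyticAt ℂ f p) : val p (mk f hf) = f p := rfl

theorem val_pull (φ : E → F) (hφ : AnalyticAt ℂ φ p) (hq : φ p = q) (a : Hol q) :
    val p (pull φ hφ hq a) = val q a := by
  obtain ⟨f, hf, rfl⟩ := exists_rep a
  rw [pull_mk, val_mk, val_mk, hq]

instance : Nontrivial (Hol p) := (val p).domain_nontrivial

instance : IsLocalHom (val p) := ⟨fun a ha => by
  obtain ⟨f, hf, rfl⟩ := exists_rep a
  have h0 : f p ≠ 0 := ha.ne_zero
  refine IsUnit.of_mul_eq_one (mk _ (hf.inv h0)) ?_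
  rw [mk_mul, ← map_one (algebraMap ℂ (Hol p)), ← mk_const, mk_eq_mk]
  filter_upwards [hf.continuousAt.eventually_ne h0] with x hx
  exact mul_inv_cancel₀ hx⟩

instance : IsLocalRing (Hol p) := (val p).domain_isLocalRing

theorem isUnit_iff {a : Hol p} : IsUnit a ↔ val p a ≠ 0 := by
  rw [← isUnit_iff_ne_zero, isUnit_map_iff]

theorem mem_maximalIdeal {a : Hol p} : a ∈ IsLocalRing.maximalIdeal (Hol p) ↔ val p a = 0 := by
  rw [IsLocalRing.mem_maximalIdeal, mem_nonunits_iff, isUnit_iff, not_not]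

instance : IsDomain (Hol p) := by
  have : NoZeroDivisors (Hol p) := ⟨fun {a b} hab => by
    obtain ⟨f, hf, rfl⟩ := exists_rep a
    obtain ⟨g, hg, rfl⟩ := exists_rep b
    rw [mk_mul, mk_eq_zero] at hab
    rw [mk_eq_zero, mk_eq_zero]
    obtain ⟨r, hr, hfr⟩ := hf.exists_ball_analyticOnNhd
    obtain ⟨r', hr', hgr⟩ := hg.exists_ball_analyticOnNhd
    obtain ⟨r'', hr'', hz⟩ := Metric.eventually_nhds_iff_ball.1 hab
    let s := min r (min r' r'')
    have hs : 0 < s := lt_min hr (lt_min hr' hr'')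
    have h1 : s ≤ r := min_le_left _ _
    have h2 : s ≤ r' := (min_le_right _ _).trans (min_le_left _ _)
    have h3 : s ≤ r'' := (min_le_right _ _).trans (min_le_right _ _)
    have hgs := hgr.mono (Metric.ball_subset_ball h2)
    by_cases hx : ∃ x ∈ Metric.ball p s, f x ≠ 0
    · obtain ⟨x, hxs, hfx⟩ := hx
      right
      have hgx : ∀ᶠ y in 𝓝 x, g y = 0 := by
        filter_upwards [(hfr x (Metric.ball_subset_ball h1 hxs)).continuousAt.eventually_ne hfx,
          Metric.isOpen_ball.mem_nhds hxs] with y hy hys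
        exact (mul_eq_zero.1 (hz y (Metric.ball_subset_ball h3 hys))).resolve_left hy
      filter_upwards [Metric.ball_mem_nhds p hs] with y hy
      exact hgs.eqOn_zero_of_preconnected_of_eventuallyEq_zero
        (convex_ball p s).isPreconnected hxs hgx hy
    · push Not at hx
      left
      filter_upwards [Metric.ball_mem_nhds p hs] with y hy using hx y hy⟩
  exact NoZeroDivisors.to_isDomain _

end Hol

theorem exists_splitting [FiniteDimensional ℂ E] {v : E} (hv : v ≠ 0) :
    ∃ (F : Submodule ℂ E) (e : E ≃L[ℂ] F × ℂ), e.symm (0, 1) = v ∧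
      (∀ w, ((e w).1 : E) = w - (e w).2 • v) ∧ Module.finrank ℂ E = Module.finrank ℂ F + 1 := by
  obtain ⟨x, hx⟩ := SeparatingDual.exists_eq_one (R := ℂ) hv
  have hr : Function.RightInverse ((ContinuousLinearMap.id ℂ ℂ).smulRight v) x := fun c => by
    simp [hx]
  let e := (ContinuousLinearEquiv.equivOfRightInverse x _ hr).trans
    (ContinuousLinearEquiv.prodComm ℂ _ _)
  refine ⟨x.ker, e, ?_, fun w => ?_, ?_⟩
  · rw [ContinuousLinearEquiv.symm_apply_eq]
    ext
    · simp [e, hx]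
    · simp [e, hx]
  · simp [e]
  · rw [e.toLinearEquiv.finrank_eq, Module.finrank_prod, Module.finrank_self]

namespace Hol

variable {F : Type*} [NormedAddCommGroup F] [NormedSpace ℂ F] {p : E}

/-- Restriction of germs to the line through `p` with direction `v`. -/
noncomputable def line (p v : E) : Hol p →+* Hol (0 : ℂ) :=
  pull (fun t : ℂ => p + t • v) (by fun_prop) (by simp)

theorem exists_line_ne_zero {a : Hol p} (ha : a ≠ 0) : ∃ v : E, line p v a ≠ 0 := by
  obtain ⟨f, hf, rfl⟩ := exists_rep a
  contrapose! ha
  rw [mk_eq_zero]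
  obtain ⟨r, hr, hfr⟩ := hf.exists_ball_analyticOnNhd
  filter_upwards [Metric.ball_mem_nhds p hr] with y hy
  have h0 := ha (y - p)
  rw [line, pull_mk, mk_eq_zero] at h0
  have hpre : IsPreconnected ((fun t : ℝ => ((t : ℂ))) '' Set.Icc 0 1) :=
    (isPreconnected_Icc).image _ (by fun_prop)
  have han : AnalyticOnNhd ℂ (fun t : ℂ => f (p + t • (y - p)))
      ((fun t : ℝ => ((t : ℂ))) '' Set.Icc 0 1) := by
    rintro _ ⟨t, ht, rfl⟩
    refine AnalyticAt.fun_comp (hfr _ ?_) (by fun_prop)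
    rw [mem_ball_iff_norm] at hy ⊢
    rw [add_sub_cancel_left, norm_smul]
    refine lt_of_le_of_lt ?_ hy
    refine mul_le_of_le_one_left (norm_nonneg _) ?_
    simpa [abs_of_nonneg ht.1] using ht.2
  have := han.eqOn_zero_of_preconnected_of_eventuallyEq_zero hpre
    (z₀ := 0) ⟨0, by simp, by simp⟩ h0 (x := 1) ⟨1, by simp, by simp⟩
  simpa using this

/-- The germ at `0` of the identity function of `ℂ`. -/
noncomputable def var : Hol (0 : ℂ) := mk (fun t => t) (by fun_prop)

theorem val_var : val 0 var = 0 := rfl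

theorem var_ne_zero : var ≠ 0 := by
  rw [var, Ne, mk_eq_zero]
  intro h
  have : ∀ᶠ x : ℂ in 𝓝[≠] 0, False := by
    filter_upwards [h.filter_mono nhdsWithin_le_nhds, self_mem_nhdsWithin] with x h1 h2 using h2 h1
  exact this.exists.elim fun _ => id

theorem exists_eq_var_pow_mul {a : Hol (0 : ℂ)} (ha : a ≠ 0) :
    ∃ (b : ℕ) (u : Hol (0 : ℂ)), IsUnit u ∧ a = var ^ b * u := by
  obtain ⟨f, hf, rfl⟩ := exists_rep a
  rw [Ne, mk_eq_zero] at ha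
  obtain ⟨b, u, hu, hu0, hfu⟩ := (AnalyticAt.exists_eventuallyEq_pow_smul_nonzero_iff hf).2 ha
  refine ⟨b, mk u hu, isUnit_iff.2 hu0, toGerm_injective ?_⟩
  rw [map_mul, map_pow]
  refine Germ.coe_eq.2 ?_
  filter_upwards [hfu] with t ht
  simpa using ht

theorem coeff_eq_zero_of_var_pow_dvd {b : ℕ} {c : ℕ → ℂ}
    (h : var ^ b ∣ ∑ j ∈ Finset.range b, algebraMap ℂ (Hol (0 : ℂ)) (c j) * var ^ j) :
    ∀ j < b, c j = 0 := by
  induction b generalizing c with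
  | zero => simp
  | succ b ih =>
    obtain ⟨d, hd⟩ := h
    rw [Finset.sum_range_succ'] at hd
    have h0 : c 0 = 0 := by
      have := congrArg (val 0) hd
      simp only [map_add, map_sum, map_mul, map_pow, val_var, pow_succ, mul_zero, zero_mul,
        Finset.sum_const_zero, zero_add, pow_zero, mul_one] at this
      exact this
    rw [h0, map_zero, zero_mul, add_zero] at hd
    have hd' : ∑ j ∈ Finset.range b, algebraMap ℂ (Hol (0 : ℂ)) (c (j + 1)) * var ^ j =
        var ^ b * d := by
      apply mul_right_cancel₀ var_ne_zero
      rw [Finset.sum_mul]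
      simp only [mul_assoc, ← pow_succ]
      rw [hd]
      ring
    intro j hj
    rcases j with _ | j
    · exact h0
    · exact ih (c := fun j => c (j + 1)) ⟨d, hd'⟩ j (by lia)

section Splitting

variable (e : E ≃L[ℂ] F × ℂ) (p)

theorem analyticAt_splitting_fst : AnalyticAt ℂ (fun w => (e w).1) p :=
  (ContinuousLinearMap.fst ℂ F ℂ ∘L (e : E →L[ℂ] F × ℂ)).analyticAt p

theorem analyticAt_splitting_snd : AnalyticAt ℂ (fun w => (e w).2) p :=
  (ContinuousLinearMap.snd ℂ F ℂ ∘L (e : E →L[ℂ] F × ℂ)).analyticAt p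

theorem analyticAt_splitting_symm :
    AnalyticAt ℂ (fun z => e.symm (z, (e p).2)) (e p).1 :=
  ((e.symm : F × ℂ →L[ℂ] E).analyticAt _).fun_comp (analyticAt_id.prod analyticAt_const)

/-- Pullback along the first component of a splitting. -/
noncomputable abbrev base : Hol (e p).1 →+* Hol p :=
  pull (fun w => (e w).1) (analyticAt_splitting_fst p e) rfl

/-- The second coordinate of a splitting, centred at `p`. -/
noncomputable def coord : Hol p := mk (fun w => (e w).2 - (e p).2)
  (show AnalyticAt ℂ (fun w => (e w).2 - (e p).2) p from
    (analyticAt_splitting_snd p e).sub analyticAt_const)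

variable {p} in
theorem exists_division {f : Hol p} (hf : line p (e.symm (0, 1)) f ≠ 0) :
    ∃ (b : ℕ) (u : Hol (0 : ℂ)), IsUnit u ∧ line p (e.symm (0, 1)) f = var ^ b * u ∧
      ∀ g : Hol p, ∃ (q : Hol p) (r : ℕ → Hol (e p).1),
        g = q * f + ∑ j ∈ Finset.range b, base p e (r j) * coord p e ^ j := by
  obtain ⟨b, u', hu', hb⟩ := exists_eq_var_pow_mul hf
  refine ⟨b, u', hu', hb, fun g => ?_⟩
  obtain ⟨f, hf', rfl⟩ := exists_rep f
  obtain ⟨u, hu, rfl⟩ := exists_rep u'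
  have hu0 := isUnit_iff.1 hu'
  have hfu : (fun t : ℂ => f (p + t • e.symm (0, 1))) =ᶠ[𝓝 0] fun t => t ^ b * u t :=
    Germ.coe_eq.1 (congrArg (toGerm 0) hb)
  obtain ⟨g, hg, rfl⟩ := exists_rep g
  obtain ⟨q, r, hq, hr, h⟩ := weierstrass_division e p hf' hg hu hu0 (b := b) (by
    filter_upwards [hfu] with t ht
    rw [← ht, map_add, e.symm_apply_apply, ← map_smul]
    simp)
  refine ⟨mk q hq, fun j => mk (r j) (hr j), ?_⟩
  apply toGerm_injective
  rw [map_add, map_mul, map_sum, toGerm_mk, toGerm_mk, toGerm_mk, ← Germ.coe_mul]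
  have : ∀ j ∈ Finset.range b, toGerm p (base p e (mk (r j) (hr j)) * coord p e ^ j) =
      ((fun w => r j (e w).1 * ((e w).2 - (e p).2) ^ j : E → ℂ) : Germ (𝓝 p) ℂ) := by
    intro j _
    rw [map_mul, map_pow]
    rfl
  rw [Finset.sum_congr rfl this]
  have h2 : ∑ j ∈ Finset.range b,
      ((fun w => r j (e w).1 * ((e w).2 - (e p).2) ^ j : E → ℂ) : Germ (𝓝 p) ℂ) =
      ((∑ j ∈ Finset.range b, fun w => r j (e w).1 * ((e w).2 - (e p).2) ^ j : E → ℂ) :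
        Germ (𝓝 p) ℂ) := (map_sum (Germ.coeRingHom (𝓝 p)) _ _).symm
  rw [h2, ← Germ.coe_add, Germ.coe_eq]
  filter_upwards [h] with w hw
  simp [hw]

theorem line_coord : line p (e.symm (0, 1)) (coord p e) = var := by
  rw [line, coord, pull_mk, var, mk_eq_mk]
  filter_upwards with t
  simp

theorem line_base (r : Hol (e p).1) :
    line p (e.symm (0, 1)) (base p e r) = algebraMap ℂ _ (val _ r) := by
  obtain ⟨r, hr, rfl⟩ := exists_rep r
  rw [line, base, pull_mk, pull_mk, ← mk_const, mk_eq_mk]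
  filter_upwards with t
  simp

theorem line_coord_ne_zero : line p (e.symm (0, 1)) (coord p e) ≠ 0 := by
  rw [line_coord]
  exact var_ne_zero

/-- Restriction of germs to the slice through `p`. -/
noncomputable def slice : Hol p →+* Hol (e p).1 :=
  pull (fun z => e.symm (z, (e p).2)) (analyticAt_splitting_symm p e) (by simp)

theorem slice_base (r : Hol (e p).1) : slice p e (base p e r) = r := by
  obtain ⟨r, hr, rfl⟩ := exists_rep r
  rw [slice, base, pull_mk, pull_mk, mk_eq_mk]
  filter_upwards with t
  simp

theorem slice_coord : slice p e (coord p e) = 0 := by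
  rw [slice, coord, pull_mk, mk_eq_zero]
  filter_upwards with t
  simp

theorem exists_division_coord (g : Hol p) :
    ∃ q : Hol p, g = q * coord p e + base p e (slice p e g) := by
  obtain ⟨b, -, -, -, hb⟩ := exists_division e (line_coord_ne_zero p e)
  obtain ⟨q, r, hq⟩ := hb g
  have hs : g = (q + ∑ j ∈ Finset.range (b - 1), base p e (r (j + 1)) * coord p e ^ j) *
      coord p e + base p e (if b = 0 then 0 else r 0) := by
    rcases b with _ | b
    · simpa using hq
    · rw [Finset.sum_range_succ'] at hq
      rw [hq]
      simp only [Nat.add_sub_cancel, add_mul, Finset.sum_mul, pow_succ, pow_zero, mul_one,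
        Nat.add_eq_zero_iff, one_ne_zero, and_false, if_false, mul_assoc, add_assoc]
  generalize (q + ∑ j ∈ Finset.range (b - 1), base p e (r (j + 1)) * coord p e ^ j) = q' at hs
  generalize (if b = 0 then 0 else r 0) = r' at hs
  refine ⟨q', ?_⟩
  have : slice p e g = r' := by
    rw [hs, map_add, map_mul, slice_coord, mul_zero, zero_add, slice_base]
  rw [this]
  exact hs

theorem ker_slice : RingHom.ker (slice p e) = Ideal.span {coord p e} := by
  ext g
  rw [RingHom.mem_ker, Ideal.mem_span_singleton']
  constructor
  · intro h
    obtain ⟨q, hq⟩ := exists_division_coord p e g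
    rw [h, map_zero, add_zero] at hq
    exact ⟨q, hq.symm⟩
  · rintro ⟨q, rfl⟩
    rw [map_mul, slice_coord, mul_zero]

theorem slice_surjective : Function.Surjective (slice p e) := fun r => ⟨_, slice_base p e r⟩

theorem val_coord : val p (coord p e) = 0 := by
  rw [coord, val_mk, sub_self]

theorem coord_ne_zero : coord p e ≠ 0 := fun h => line_coord_ne_zero p e (by rw [h, map_zero])

variable {p} in
theorem finite_quotient_span {f : Hol p} (hf : line p (e.symm (0, 1)) f ≠ 0) :
    ((Ideal.Quotient.mk (Ideal.span {f})).comp (base p e)).Finite := by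
  classical
  obtain ⟨b, -, -, -, hb⟩ := exists_division e hf
  let := ((Ideal.Quotient.mk (Ideal.span {f})).comp (base p e)).toAlgebra
  refine ⟨⟨(Finset.range b).image fun j => Ideal.Quotient.mk _ (coord p e ^ j), ?_⟩⟩
  rw [eq_top_iff]
  rintro g -
  obtain ⟨g, rfl⟩ := Ideal.Quotient.mk_surjective g
  obtain ⟨q, r, hq⟩ := hb g
  rw [hq, map_add, map_mul, Ideal.Quotient.eq_zero_iff_mem.2 (Ideal.mem_span_singleton_self f),
    mul_zero, zero_add, map_sum]
  refine Submodule.sum_mem _ fun j hj => ?_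
  rw [map_mul]
  refine Submodule.smul_mem _ (r j) (Submodule.subset_span ?_)
  exact Finset.mem_coe.2 (Finset.mem_image_of_mem _ hj)

end Splitting

theorem bijective_val_of_subsingleton [Subsingleton E] (p : E) : Function.Bijective (val p) := by
  refine ⟨(injective_iff_map_eq_zero _).2 fun a ha => ?_,
    fun c => ⟨algebraMap ℂ _ c, by rw [← mk_const, val_mk]⟩⟩
  obtain ⟨f, hf, rfl⟩ := exists_rep a
  rw [mk_eq_zero]
  filter_upwards with x
  rw [Subsingleton.elim x p]
  exact ha

theorem isNoetherianRing_aux (d : ℕ) : ∀ {E : Type*} [NormedAddCommGroup E] [NormedSpace ℂ E]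
    [FiniteDimensional ℂ E] (p : E), Module.finrank ℂ E = d →
    IsNoetherianRing (Hol p) ∧ ringKrullDim (Hol p) = d := by
  induction d with
  | zero =>
    intro E _ _ _ p hd
    have := Module.finrank_zero_iff.1 hd
    let φ := RingEquiv.ofBijective _ (bijective_val_of_subsingleton p)
    exact ⟨isNoetherianRing_of_ringEquiv ℂ φ.symm, by
      rw [ringKrullDim_eq_of_ringEquiv φ, ringKrullDim_eq_zero_of_field, Nat.cast_zero]⟩
  | succ d ih =>
    intro E _ _ _ p hd
    have hN : IsNoetherianRing (Hol p) := by
      rw [isNoetherianRing_iff_ideal_fg]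
      intro I
      rcases eq_or_ne I ⊥ with rfl | hI
      · exact Submodule.fg_bot
      obtain ⟨f, hfI, hf⟩ := Submodule.exists_mem_ne_zero_of_ne_bot hI
      obtain ⟨v, hv⟩ := exists_line_ne_zero hf
      rcases eq_or_ne v 0 with rfl | hv0
      · have hu : IsUnit f := by
          rw [isUnit_iff]
          intro h0
          apply hv
          obtain ⟨f, hf', rfl⟩ := exists_rep f
          rw [line, pull_mk, mk_eq_zero]
          filter_upwards with t
          simpa using h0
        rw [Ideal.eq_top_of_isUnit_mem I hfI hu]
        exact (Ideal.fg_top _)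
      obtain ⟨F, e, rfl, -, hF⟩ := exists_splitting hv0
      have hNF : IsNoetherianRing (Hol (e p).1) := (ih (e p).1 (by lia)).1
      have hfin := finite_quotient_span e hv
      let := (base p e).toAlgebra
      have : Module.Finite (Hol (e p).1) (Hol p ⧸ Ideal.span {f}) := hfin
      refine Submodule.fg_of_fg_map_of_fg_inf_ker (Submodule.mkQ (Ideal.span {f})) ?_ ?_
      · have : IsNoetherian (Hol p) (Hol p ⧸ Ideal.span {f}) :=
          isNoetherian_of_tower (Hol (e p).1)
            (isNoetherian_of_isNoetherianRing_of_finite (Hol (e p).1) _)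
        exact IsNoetherian.noetherian _
      · rw [Submodule.ker_mkQ, inf_eq_right.2 ((Ideal.span_singleton_le_iff_mem I).2 hfI)]
        exact ⟨{f}, by simp [Ideal.span]⟩
    refine ⟨hN, ?_⟩
    have : Nontrivial E := Module.nontrivial_of_finrank_pos (R := ℂ) (by lia)
    obtain ⟨v, hv⟩ := exists_ne (0 : E)
    obtain ⟨F, e, rfl, -, hF⟩ := exists_splitting hv
    have hdim := (ih (e p).1 (by lia)).2
    have h1 := ringKrullDim_quotient_span_singleton_succ_eq_ringKrullDim_of_mem_nonZeroDivisors
      (mem_nonZeroDivisors_of_ne_zero (coord_ne_zero p e))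
      (mem_maximalIdeal.2 (val_coord p e))
    rw [← h1, ← ker_slice,
      ringKrullDim_eq_of_ringEquiv (RingHom.quotientKerEquivOfSurjective (slice_surjective p e)),
      hdim]
    simp

instance [FiniteDimensional ℂ E] (p : E) : IsNoetherianRing (Hol p) :=
  (isNoetherianRing_aux _ p rfl).1

theorem ringKrullDim_eq [FiniteDimensional ℂ E] (p : E) :
    ringKrullDim (Hol p) = Module.finrank ℂ E := (isNoetherianRing_aux _ p rfl).2

end Hol

instance Filter.Germ.isAlgClosed {γ K : Type*} [Field K] [IsAlgClosed K] (𝒰 : Ultrafilter γ) :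
    IsAlgClosed (Germ (𝒰 : Filter γ) K) := by
  refine IsAlgClosed.of_exists_root _ fun P hP hirr => ?_
  have hd : P.natDegree ≠ 0 := hirr.natDegree_pos.ne'
  choose c hc using fun i => Quotient.exists_rep (P.coeff i)
  have hroot : ∀ z, ∃ x : K,
      x ^ P.natDegree + ∑ i ∈ Finset.range P.natDegree, c i z * x ^ i = 0 := by
    intro z
    let Q : Polynomial K := Polynomial.X ^ P.natDegree +
      ∑ i ∈ Finset.range P.natDegree, Polynomial.C (c i z) * Polynomial.X ^ i
    have hQ : Q.degree ≠ 0 := by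
      have : Q.degree = P.natDegree := by
        rw [Polynomial.degree_add_eq_left_of_degree_lt, Polynomial.degree_X_pow]
        rw [Polynomial.degree_X_pow]
        refine (Polynomial.degree_sum_le _ _).trans_lt ?_
        rw [Finset.sup_lt_iff (WithBot.bot_lt_coe _)]
        intro i hi
        exact (Polynomial.degree_C_mul_X_pow_le _ _).trans_lt
          (by exact_mod_cast Finset.mem_range.1 hi)
      rw [this]
      exact_mod_cast hd
    obtain ⟨x, hx⟩ := IsAlgClosed.exists_root Q hQ
    refine ⟨x, ?_⟩
    simpa [Q, Polynomial.IsRoot, Polynomial.eval_finsetSum] using hx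
  choose τ hτ using hroot
  refine ⟨(τ : Germ (𝒰 : Filter γ) K), ?_⟩
  rw [Polynomial.eval_eq_sum_range, Finset.sum_range_succ, Polynomial.Monic.coeff_natDegree hP,
    one_mul, add_comm]
  have h2 : ∀ i ∈ Finset.range P.natDegree, P.coeff i * (τ : Germ (𝒰 : Filter γ) K) ^ i =
      Germ.coeRingHom (𝒰 : Filter γ) (fun z => c i z * τ z ^ i) := by
    intro i _
    rw [← hc i]
    rfl
  rw [Finset.sum_congr rfl h2, ← map_sum]
  have : (τ : Germ (𝒰 : Filter γ) K) ^ P.natDegree =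
      Germ.coeRingHom (𝒰 : Filter γ) (fun z => τ z ^ P.natDegree) := rfl
  rw [this, ← map_add, ← map_zero (Germ.coeRingHom (𝒰 : Filter γ))]
  congr 1
  funext z
  simpa using hτ z

theorem tendsto_zero_of_pow_eq_sum {γ : Type*} {l : Filter γ} {b : ℕ} {r : ℕ → γ → ℂ} {τ : γ → ℂ}
    (hr : ∀ j < b, Tendsto (r j) l (𝓝 0))
    (h : ∀ᶠ z in l, τ z ^ b = ∑ j ∈ Finset.range b, r j z * τ z ^ j) : Tendsto τ l (𝓝 0) := by
  rw [Metric.tendsto_nhds]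
  intro ε hε
  wlog hε1 : ε ≤ 1 generalizing ε
  · exact (this 1 one_pos le_rfl).mono fun z hz => hz.trans_le (le_of_not_ge hε1)
  have hev : ∀ᶠ z in l, ∑ j ∈ Finset.range b, ‖r j z‖ < ε ^ b := by
    have : Tendsto (fun z => ∑ j ∈ Finset.range b, ‖r j z‖) l
        (𝓝 (∑ j ∈ Finset.range b, 0)) :=
      tendsto_finsetSum _ fun j hj => tendsto_zero_iff_norm_tendsto_zero.1
        (hr j (Finset.mem_range.1 hj))
    rw [Finset.sum_const_zero] at this
    exact this.eventually_lt_const (by positivity)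
  filter_upwards [h, hev] with z hz hez
  rw [dist_zero_right]
  by_contra! hcon
  have hb : ∀ j ∈ Finset.range b, ‖r j z‖ * ‖τ z‖ ^ j * ε ^ b ≤ ‖r j z‖ * ‖τ z‖ ^ b := by
    intro j hj
    rw [mul_assoc]
    refine mul_le_mul_of_nonneg_left ?_ (norm_nonneg _)
    obtain ⟨k, rfl⟩ := Nat.exists_eq_add_of_le (Finset.mem_range.1 hj).le
    rw [pow_add ‖τ z‖]
    gcongr
    rw [add_comm, pow_add]
    exact (mul_le_of_le_one_right (by positivity) (pow_le_one₀ hε.le hε1)).trans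
      (pow_le_pow_left₀ hε.le hcon k)
  have hpos : 0 < ‖τ z‖ ^ b := pow_pos (hε.trans_le hcon) b
  have h1 : ‖τ z‖ ^ b * ε ^ b ≤ (∑ j ∈ Finset.range b, ‖r j z‖) * ‖τ z‖ ^ b := by
    rw [← norm_pow, hz, Finset.sum_mul]
    refine (mul_le_mul_of_nonneg_right (norm_sum_le _ _) (by positivity)).trans ?_
    rw [Finset.sum_mul]
    refine Finset.sum_le_sum fun j hj => ?_
    rw [norm_mul, norm_pow, ← hz, norm_pow]
    exact hb j hj
  nlinarith

namespace Hol

variable {F : Type*} [NormedAddCommGroup F] [NormedSpace ℂ F] {p : E}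

variable (e : E ≃L[ℂ] F × ℂ)

/-- Weierstrass preparation. -/
theorem exists_preparation {f : Hol p} (hf : line p (e.symm (0, 1)) f ≠ 0) :
    ∃ (b : ℕ) (r : ℕ → Hol (e p).1), (∀ j < b, val _ (r j) = 0) ∧
      Associated f (coord p e ^ b - ∑ j ∈ Finset.range b, base p e (r j) * coord p e ^ j) ∧
      ∀ g : Hol p, ∃ (q : Hol p) (r' : ℕ → Hol (e p).1),
        g = q * f + ∑ j ∈ Finset.range b, base p e (r' j) * coord p e ^ j := by
  obtain ⟨b, u, hu, hb, hdiv⟩ := exists_division e hf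
  obtain ⟨q, r, hq⟩ := hdiv (coord p e ^ b)
  have hl := congrArg (line p (e.symm (0, 1))) hq
  simp only [map_add, map_mul, map_pow, map_sum, line_base, hb] at hl
  rw [line_coord] at hl
  have hr : ∀ j < b, val _ (r j) = 0 := by
    refine coeff_eq_zero_of_var_pow_dvd ⟨1 - line p (e.symm (0, 1)) q * u, ?_⟩
    linear_combination -hl
  refine ⟨b, r, hr, ?_, hdiv⟩
  have h0 : ∑ j ∈ Finset.range b, algebraMap ℂ (Hol (0 : ℂ)) (val _ (r j)) * var ^ j = 0 :=
    Finset.sum_eq_zero fun j hj => by rw [hr j (Finset.mem_range.1 hj), map_zero, zero_mul]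
  rw [h0, add_zero] at hl
  have hqu : IsUnit q := by
    have h1 : line p (e.symm (0, 1)) q * u = 1 := by
      apply mul_left_cancel₀ (pow_ne_zero b var_ne_zero)
      linear_combination -hl
    rw [isUnit_iff]
    have h2 : val 0 (line p (e.symm (0, 1)) q) = val p q := val_pull _ _ _ _
    rw [← h2]
    exact isUnit_iff.1 (IsUnit.of_mul_eq_one _ h1)
  refine ⟨hqu.unit, ?_⟩
  rw [hqu.unit_spec, mul_comm]
  linear_combination -hq

/-- A ring homomorphism to a nonstandard field killing a regular germ is evaluation at a
nonstandard point, provided that this holds on the base. -/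
theorem exists_ev_eq_of_base {f : Hol p} (hf : line p (e.symm (0, 1)) f ≠ 0) {γ : Type*}
    {𝒰 : Ultrafilter γ} (φ : Hol p →+* Germ (𝒰 : Filter γ) ℂ) (hφ : φ f = 0) {s : γ → F}
    (hs : Tendsto s 𝒰 (𝓝 (e p).1)) (hφs : φ.comp (base p e) = ev 𝒰 s hs) :
    ∃ (t : γ → E) (ht : Tendsto t 𝒰 (𝓝 p)), φ = ev 𝒰 t ht ∧ ∀ z, (e (t z)).1 = s z := by
  obtain ⟨b, r, hr, hass, hdiv⟩ := exists_preparation e hf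
  obtain ⟨τ, hτ⟩ := Quotient.exists_rep (φ (coord p e))
  replace hτ : (τ : Germ (𝒰 : Filter γ) ℂ) = φ (coord p e) := hτ
  choose R hR hRr using fun j => exists_rep (r j)
  have hφr : ∀ a, φ (base p e a) = ev 𝒰 s hs a := fun a => by rw [← hφs]; rfl
  have hsum : φ (coord p e ^ b - ∑ j ∈ Finset.range b, base p e (r j) * coord p e ^ j) = 0 := by
    obtain ⟨c, hc⟩ := hass
    rw [← hc, map_mul, hφ, zero_mul]
  have hτ0 : Tendsto τ 𝒰 (𝓝 0) := by
    refine tendsto_zero_of_pow_eq_sum (b := b) (r := fun j z => R j (s z)) (fun j hj => ?_) ?_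
    · have := (hR j).continuousAt.tendsto.comp hs
      have h0 : R j (e p).1 = 0 := by
        have := hr j hj
        rwa [← hRr j, val_mk] at this
      rwa [h0] at this
    · rw [map_sub, map_pow, map_sum, sub_eq_zero, ← hτ] at hsum
      have h2 : ∀ j ∈ Finset.range b, φ (base p e (r j) * coord p e ^ j) =
          Germ.coeRingHom (𝒰 : Filter γ) (fun z => R j (s z) * τ z ^ j) := by
        intro j _
        rw [map_mul, hφr, map_pow, ← hτ, ← hRr j]
        rfl
      rw [Finset.sum_congr rfl h2, ← map_sum] at hsum
      have := Germ.coe_eq.1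
          (show ((fun z => τ z ^ b : γ → ℂ) : Germ (𝒰 : Filter γ) ℂ) = _ from hsum)
      filter_upwards [this] with z hz
      rw [hz, Finset.sum_apply]
  have ht : Tendsto (fun z => e.symm (s z, (e p).2 + τ z)) 𝒰 (𝓝 p) := by
    have h1 : Tendsto (fun z => (s z, (e p).2 + τ z)) 𝒰 (𝓝 (e p)) := by
      have := hs.prodMk_nhds (hτ0.const_add (e p).2)
      rwa [add_zero] at this
    have := e.symm.continuous.continuousAt.tendsto.comp h1
    rwa [e.symm_apply_apply] at this
  refine ⟨_, ht, ?_, fun z => by simp⟩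
  have hbase : ∀ a, ev (𝒰 : Filter γ) _ ht (base p e a) = φ (base p e a) := fun a => by
    rw [hφr]
    obtain ⟨a, ha, rfl⟩ := exists_rep a
    rw [base, pull_mk, ev_mk, ev_mk]
    simp
  have hcoord : ev (𝒰 : Filter γ) _ ht (coord p e) = φ (coord p e) := by
    rw [← hτ, coord, ev_mk]
    simp
  have hpoly : ∀ r' : ℕ → Hol (e p).1,
      ev (𝒰 : Filter γ) _ ht (∑ j ∈ Finset.range b, base p e (r' j) * coord p e ^ j) =
        φ (∑ j ∈ Finset.range b, base p e (r' j) * coord p e ^ j) := fun r' => by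
    simp only [map_sum, map_mul, map_pow, hbase, hcoord]
  have hf0 : ev (𝒰 : Filter γ) _ ht f = 0 := by
    obtain ⟨c, hc⟩ := hass.symm
    rw [← hc, map_mul, map_sub, hpoly, map_pow, hcoord, ← map_pow, ← map_sub, hsum, zero_mul]
  ext g
  obtain ⟨q, r', hg⟩ := hdiv g
  rw [hg, map_add, map_add, map_mul, map_mul, hφ, hf0, mul_zero, mul_zero, hpoly]

end Hol

section CommutativeAlgebra

variable {R S T : Type*} [CommRing R] [CommRing S] [CommRing T]

theorem RingHom.IsIntegral.quotientMk_of_le {φ : R →+* S} {J Q : Ideal S} (hJQ : J ≤ Q)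
    (h : ((Ideal.Quotient.mk J).comp φ).IsIntegral) :
    ((Ideal.Quotient.mk Q).comp φ).IsIntegral := by
  intro x
  obtain ⟨x, rfl⟩ := Ideal.Quotient.mk_surjective x
  obtain ⟨P, hP, hx⟩ := h (Ideal.Quotient.mk J x)
  refine ⟨P, hP, ?_⟩
  have := congrArg (Ideal.Quotient.factor hJQ) hx
  rwa [Polynomial.hom_eval₂, map_zero, ← RingHom.comp_assoc, Ideal.Quotient.factor_comp_mk,
    Ideal.Quotient.factor_mk] at this

theorem RingHom.Finite.quotientMk_of_le {φ : R →+* S} {J Q : Ideal S} (hJQ : J ≤ Q)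
    (h : ((Ideal.Quotient.mk J).comp φ).Finite) :
    ((Ideal.Quotient.mk Q).comp φ).Finite := by
  rw [← Ideal.Quotient.factor_comp_mk hJQ, RingHom.comp_assoc]
  exact (RingHom.Finite.of_surjective _ (Ideal.Quotient.factor_surjective hJQ)).comp h

theorem exists_prime_comap_eq_of_isIntegral {φ : R →+* S} {J : Ideal S}
    (h : ((Ideal.Quotient.mk J).comp φ).IsIntegral) (P : Ideal R) [P.IsPrime]
    (hP : J.comap φ ≤ P) : ∃ Q : Ideal S, J ≤ Q ∧ Q.IsPrime ∧ Q.comap φ = P := by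
  let := ((Ideal.Quotient.mk J).comp φ).toAlgebra
  have : Algebra.IsIntegral R (S ⧸ J) := ⟨h⟩
  obtain ⟨Q, -, hQ, hQP⟩ := Ideal.exists_ideal_over_prime_of_isIntegral (S := S ⧸ J) P ⊥ (by
    intro x hx
    exact hP (show φ x ∈ J from Ideal.Quotient.eq_zero_iff_mem.1 hx))
  refine ⟨Q.comap (Ideal.Quotient.mk J), fun x hx => ?_, inferInstance, ?_⟩
  · rw [Ideal.mem_comap, Ideal.Quotient.eq_zero_iff_mem.2 hx]
    exact zero_mem Q
  · rw [Ideal.comap_comap]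
    exact hQP

theorem RingHom.Finite.quotientMk_comap [IsNoetherianRing R] {ψ : R →+* S} {φ : S →+* T}
    {J : Ideal T} (h : ((Ideal.Quotient.mk J).comp (φ.comp ψ)).Finite) :
    ((Ideal.Quotient.mk (J.comap φ)).comp ψ).Finite := by
  let := ((Ideal.Quotient.mk J).comp (φ.comp ψ)).toAlgebra
  let := ((Ideal.Quotient.mk (J.comap φ)).comp ψ).toAlgebra
  have : Module.Finite R (T ⧸ J) := h
  have : IsNoetherian R (T ⧸ J) := isNoetherian_of_isNoetherianRing_of_finite R _
  let f : (S ⧸ J.comap φ) →ₐ[R] (T ⧸ J) :=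
    { Ideal.quotientMap J φ le_rfl with
      commutes' := fun r => rfl }
  exact Module.Finite.of_injective f.toLinearMap Ideal.quotientMap_injective

theorem RingHom.Finite.quotientMk_comp {ψ : R →+* S} {φ : S →+* T} {J : Ideal T}
    (h : ((Ideal.Quotient.mk J).comp φ).Finite)
    (h' : ((Ideal.Quotient.mk (J.comap φ)).comp ψ).Finite) :
    ((Ideal.Quotient.mk J).comp (φ.comp ψ)).Finite := by
  have h1 : (Ideal.Quotient.mk J).comp φ =
      (Ideal.quotientMap J φ le_rfl).comp (Ideal.Quotient.mk (J.comap φ)) :=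
    (Ideal.quotientMap_comp_mk le_rfl).symm
  rw [← RingHom.comp_assoc, h1, RingHom.comp_assoc]
  rw [h1] at h
  exact h.of_comp_finite.comp h'

theorem exists_ringHom_ker_eq {K : Type*} [Field K] [IsAlgClosed K] {φ : R →+* S} {Q : Ideal S}
    [Q.IsPrime] (h : ((Ideal.Quotient.mk Q).comp φ).IsIntegral) (ψ : R →+* K)
    (hψ : RingHom.ker ψ = Q.comap φ) :
    ∃ Ψ : S →+* K, Ψ.comp φ = ψ ∧ RingHom.ker Ψ = Q := by
  let A := R ⧸ Q.comap φ
  let j : A →+* S ⧸ Q := Ideal.quotientMap Q φ le_rfl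
  let := j.toAlgebra
  have hj : Function.Injective (algebraMap A (S ⧸ Q)) := Ideal.quotientMap_injective
  let k : A →+* K := Ideal.Quotient.lift _ ψ fun a ha => by
    rwa [← hψ, RingHom.mem_ker] at ha
  let := k.toAlgebra
  have hk : Function.Injective (algebraMap A K) := by
    rw [injective_iff_map_eq_zero]
    intro a ha
    obtain ⟨a, rfl⟩ := Ideal.Quotient.mk_surjective a
    rw [Ideal.Quotient.eq_zero_iff_mem, ← hψ]
    exact ha
  have : FaithfulSMul A (S ⧸ Q) := (faithfulSMul_iff_algebraMap_injective _ _).2 hj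
  have : FaithfulSMul A K := (faithfulSMul_iff_algebraMap_injective _ _).2 hk
  have : Module.IsTorsionFree A (S ⧸ Q) := inferInstance
  have : Module.IsTorsionFree A K := inferInstance
  have : Algebra.IsIntegral A (S ⧸ Q) := ⟨by
    have h1 : (Ideal.Quotient.mk Q).comp φ = j.comp (Ideal.Quotient.mk (Q.comap φ)) :=
      (Ideal.quotientMap_comp_mk le_rfl).symm
    rw [h1] at h
    exact RingHom.IsIntegral.tower_top _ _ h⟩
  let l : (S ⧸ Q) →ₐ[A] K := IsAlgClosed.lift
  refine ⟨l.toRingHom.comp (Ideal.Quotient.mk Q), ?_, ?_⟩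
  · ext r
    exact l.commutes (Ideal.Quotient.mk _ r)
  · have h0 : RingHom.ker l.toRingHom = ⊥ := by
      refine Ideal.eq_bot_of_comap_eq_bot (R := A) ?_
      rw [eq_bot_iff]
      intro a ha
      have : l (algebraMap A _ a) = 0 := ha
      rw [l.commutes] at this
      exact (injective_iff_map_eq_zero _).1 hk a this
    rw [← RingHom.comap_ker, h0, ← RingHom.ker_eq_comap_bot, Ideal.mk_ker]

end CommutativeAlgebra

namespace Hol

variable {F L : Type*} [NormedAddCommGroup F] [NormedSpace ℂ F] [NormedAddCommGroup L]
  [NormedSpace ℂ L] {p : E} {q : L}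

/-- Pullback along a continuous linear map, with a flexible target base point. -/
noncomputable abbrev lpull (π : E →L[ℂ] L) (h : π p = q) : Hol q →+* Hol p :=
  pull π (π.analyticAt p) h

theorem exists_line_ne_zero_of_isolated (π : E →L[ℂ] L) (hq : π p = q) {J : Ideal (Hol p)}
    (H : ∀ Q : Ideal (Hol p), Q.IsPrime → J ≤ Q →
      (IsLocalRing.maximalIdeal (Hol q)).map (lpull π hq) ≤ Q →
      IsLocalRing.maximalIdeal (Hol p) ≤ Q) (e : E ≃L[ℂ] F × ℂ) (hv : π (e.symm (0, 1)) = 0) :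
    ∃ f ∈ J, line p (e.symm (0, 1)) f ≠ 0 := by
  by_contra! hcon
  have h1 := H (RingHom.ker (line p (e.symm (0, 1)))) (RingHom.ker_isPrime _)
    (fun f hf => hcon f hf) (by
      rw [Ideal.map_le_iff_le_comap]
      intro a ha
      rw [mem_maximalIdeal] at ha
      obtain ⟨a, ha', rfl⟩ := exists_rep a
      rw [Ideal.mem_comap, RingHom.mem_ker, lpull, pull_mk, line, pull_mk, mk_eq_zero]
      filter_upwards with t
      rw [map_add, map_smul, hv, smul_zero, add_zero, hq]
      exact ha)
  have h2 : coord p e ∈ RingHom.ker (line p (e.symm (0, 1))) :=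
    h1 (mem_maximalIdeal.2 (val_coord p e))
  exact line_coord_ne_zero p e h2

theorem lpull_eq_base_comp (π : E →L[ℂ] L) (hq : π p = q) {F : Submodule ℂ E}
    (e : E ≃L[ℂ] F × ℂ) (hF : ∀ w, π (e w).1 = π w) (hq' : (π ∘L F.subtypeL) (e p).1 = q) :
    lpull π hq = (base p e).comp (lpull (π ∘L F.subtypeL) hq') := by
  ext a
  obtain ⟨a, ha, rfl⟩ := exists_rep a
  rw [RingHom.comp_apply, pull_mk, pull_mk, base, pull_mk, mk_eq_mk]
  filter_upwards with w
  simp [hF]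

theorem pull_surjective_of_injective [FiniteDimensional ℂ E] [FiniteDimensional ℂ L]
    (π : E →L[ℂ] L) (hπ : Function.Injective π) (hq : π p = q) :
    Function.Surjective (lpull π hq) := by
  obtain ⟨g, hg⟩ := (π : E →ₗ[ℂ] L).exists_leftInverse_of_injective (LinearMap.ker_eq_bot.2 hπ)
  have hg' : ∀ x, g.toContinuousLinearMap (π x) = x := fun x => LinearMap.congr_fun hg x
  intro a
  obtain ⟨a, ha, rfl⟩ := exists_rep a
  refine ⟨mk (fun y => a (g.toContinuousLinearMap y)) (AnalyticAt.comp_of_eq ha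
    (g.toContinuousLinearMap.analyticAt q) (by rw [← hq, hg'])), ?_⟩
  rw [pull_mk, mk_eq_mk]
  filter_upwards with w
  rw [hg']

theorem isolated_of_finite (π : E →L[ℂ] L) (hq : π p = q) {J : Ideal (Hol p)}
    (h : ((Ideal.Quotient.mk J).comp (lpull π hq)).IsIntegral) (Q : Ideal (Hol p))
    (hQ : Q.IsPrime) (hJQ : J ≤ Q)
    (hm : (IsLocalRing.maximalIdeal (Hol q)).map (lpull π hq) ≤ Q) :
    IsLocalRing.maximalIdeal (Hol p) ≤ Q := by
  have h1 := h.quotientMk_of_le hJQ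
  rw [Ideal.map_le_iff_le_comap] at hm
  have hc : Q.comap (lpull π hq) = IsLocalRing.maximalIdeal (Hol q) :=
    ((IsLocalRing.maximalIdeal.isMaximal _).eq_of_le (Ideal.IsPrime.ne_top inferInstance) hm).symm
  have hbot : (⊥ : Ideal (Hol p ⧸ Q)).IsMaximal := by
    refine Ideal.isMaximal_of_isIntegral_of_isMaximal_comap' _ h1 ⊥ ?_
    rw [← Ideal.comap_comap, ← RingHom.ker_eq_comap_bot, Ideal.mk_ker, hc]
    exact IsLocalRing.maximalIdeal.isMaximal _
  have : Q.IsMaximal := by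
    have := Ideal.comap_isMaximal_of_surjective (Ideal.Quotient.mk Q)
      Ideal.Quotient.mk_surjective (K := ⊥)
    rwa [← RingHom.ker_eq_comap_bot, Ideal.mk_ker] at this
  exact (IsLocalRing.eq_maximalIdeal this).ge

theorem finite_of_isolated_aux [FiniteDimensional ℂ L] (d : ℕ) :
    ∀ {E : Type*} [NormedAddCommGroup E] [NormedSpace ℂ E]
    [FiniteDimensional ℂ E] (π : E →L[ℂ] L) {p : E} {q : L} (hq : π p = q) {J : Ideal (Hol p)},
    Module.finrank ℂ E = d →
    (∀ Q : Ideal (Hol p), Q.IsPrime → J ≤ Q →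
      (IsLocalRing.maximalIdeal (Hol q)).map (lpull π hq) ≤ Q →
      IsLocalRing.maximalIdeal (Hol p) ≤ Q) →
    ((Ideal.Quotient.mk J).comp (lpull π hq)).Finite := by
  induction d with
  | zero =>
    intro E _ _ _ π p q hq J hd _
    have := Module.finrank_zero_iff.1 hd
    exact RingHom.Finite.of_surjective _ (Ideal.Quotient.mk_surjective.comp
      (pull_surjective_of_injective π (Function.injective_of_subsingleton _) hq))
  | succ d ih =>
    intro E _ _ _ π p q hq J hd H
    by_cases hπ : Function.Injective π
    · exact RingHom.Finite.of_surjective _ (Ideal.Quotient.mk_surjective.comp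
        (pull_surjective_of_injective π hπ hq))
    obtain ⟨v, hv, hv0⟩ : ∃ v, π v = 0 ∧ v ≠ 0 := by
      by_contra! hcon
      exact hπ ((injective_iff_map_eq_zero π).2 hcon)
    obtain ⟨F, e, rfl, heF, hF⟩ := exists_splitting hv0
    have heF' : ∀ w, π (e w).1 = π w := fun w => by
      rw [heF, map_sub, map_smul, hv, smul_zero, sub_zero]
    have hq' : (π ∘L F.subtypeL) (e p).1 = q := (heF' p).trans hq
    obtain ⟨f, hfJ, hf⟩ := exists_line_ne_zero_of_isolated π hq H e hv
    have h1 : ((Ideal.Quotient.mk J).comp (base p e)).Finite :=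
      (finite_quotient_span e hf).quotientMk_of_le
        ((Ideal.span_singleton_le_iff_mem J).2 hfJ)
    rw [lpull_eq_base_comp π hq e heF' hq']
    refine h1.quotientMk_comp (ih _ hq' (by lia) fun Q1 hQ1 hJ1 hm1 => ?_)
    obtain ⟨Q, hJQ, hQ, rfl⟩ := exists_prime_comap_eq_of_isIntegral h1.to_isIntegral Q1 hJ1
    have := H Q hQ hJQ (by
      rw [lpull_eq_base_comp π hq e heF' hq', ← Ideal.map_map, Ideal.map_le_iff_le_comap]
      exact hm1)
    intro a ha
    refine this (mem_maximalIdeal.2 ?_)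
    rw [val_pull]
    exact mem_maximalIdeal.1 ha

theorem finite_of_isolated [FiniteDimensional ℂ E] [FiniteDimensional ℂ L] (π : E →L[ℂ] L)
    (hq : π p = q) {J : Ideal (Hol p)}
    (H : ∀ Q : Ideal (Hol p), Q.IsPrime → J ≤ Q →
      (IsLocalRing.maximalIdeal (Hol q)).map (lpull π hq) ≤ Q →
      IsLocalRing.maximalIdeal (Hol p) ≤ Q) :
    ((Ideal.Quotient.mk J).comp (lpull π hq)).Finite :=
  finite_of_isolated_aux _ π hq rfl H

theorem exists_ev_eq_aux [FiniteDimensional ℂ L] {γ : Type*} {𝒰 : Ultrafilter γ} (d : ℕ) :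
    ∀ {E : Type*} [NormedAddCommGroup E] [NormedSpace ℂ E]
    [FiniteDimensional ℂ E] (π : E →L[ℂ] L) {p : E} {q : L} (hq : π p = q) {J : Ideal (Hol p)},
    Module.finrank ℂ E = d → Function.Surjective π →
    ((Ideal.Quotient.mk J).comp (lpull π hq)).Finite →
    ∀ (φ : Hol p →+* Germ (𝒰 : Filter γ) ℂ) {s : γ → L} (hs : Tendsto s 𝒰 (𝓝 q)),
    J ≤ RingHom.ker φ → φ.comp (lpull π hq) = ev (𝒰 : Filter γ) s hs →
    ∃ (t : γ → E) (ht : Tendsto t 𝒰 (𝓝 p)), φ = ev (𝒰 : Filter γ) t ht ∧ ∀ z, π (t z) = s z := by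
  have main : ∀ {E : Type _} [NormedAddCommGroup E] [NormedSpace ℂ E]
    [FiniteDimensional ℂ E] (π : E →L[ℂ] L) {p : E} {q : L} (hq : π p = q),
    Function.Bijective π → ∀ (φ : Hol p →+* Germ (𝒰 : Filter γ) ℂ) {s : γ → L}
    (hs : Tendsto s 𝒰 (𝓝 q)), φ.comp (lpull π hq) = ev (𝒰 : Filter γ) s hs →
    ∃ (t : γ → E) (ht : Tendsto t 𝒰 (𝓝 p)), φ = ev (𝒰 : Filter γ) t ht ∧ ∀ z, π (t z) = s z := by
    intro E _ _ _ π p q hq hπ φ s hs hφ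
    let e : E ≃L[ℂ] L := (LinearEquiv.ofBijective (π : E →ₗ[ℂ] L) hπ).toContinuousLinearEquiv
    have he : ∀ x, π (e.symm x) = x := fun x => e.apply_symm_apply x
    have ht : Tendsto (fun z => e.symm (s z)) 𝒰 (𝓝 p) := by
      have := e.symm.continuous.continuousAt.tendsto.comp hs
      rwa [← hq, show e.symm (π p) = p from e.symm_apply_apply p] at this
    refine ⟨_, ht, ?_, fun z => he _⟩
    ext a
    obtain ⟨a, rfl⟩ := pull_surjective_of_injective π hπ.1 hq a
    rw [← RingHom.comp_apply, hφ]
    obtain ⟨a, ha, rfl⟩ := exists_rep a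
    rw [pull_mk, ev_mk, ev_mk]
    simp only [he]
  induction d with
  | zero =>
    intro E _ _ _ π p q hq J hd hsurj _ φ s hs _ hφ
    have := Module.finrank_zero_iff.1 hd
    exact main π hq ⟨Function.injective_of_subsingleton _, hsurj⟩ φ hs hφ
  | succ d ih =>
    intro E _ _ _ π p q hq J hd hsurj hfin φ s hs hJφ hφ
    by_cases hπ : Function.Injective π
    · exact main π hq ⟨hπ, hsurj⟩ φ hs hφ
    obtain ⟨v, hv, hv0⟩ : ∃ v, π v = 0 ∧ v ≠ 0 := by
      by_contra! hcon
      exact hπ ((injective_iff_map_eq_zero π).2 hcon)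
    obtain ⟨F, e, rfl, heF, hF⟩ := exists_splitting hv0
    have heF' : ∀ w, π (e w).1 = π w := fun w => by
      rw [heF, map_sub, map_smul, hv, smul_zero, sub_zero]
    have hq' : (π ∘L F.subtypeL) (e p).1 = q := (heF' p).trans hq
    obtain ⟨f, hfJ, hf⟩ := exists_line_ne_zero_of_isolated π hq
      (fun Q => isolated_of_finite π hq hfin.to_isIntegral Q) e hv
    have hcomp := lpull_eq_base_comp π hq e heF' hq'
    rw [hcomp] at hfin hφ
    obtain ⟨t1, ht1, hφ1, ht1s⟩ := ih (π ∘L F.subtypeL) hq' (by lia)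
      (fun y => by
        obtain ⟨x, rfl⟩ := hsurj y
        exact ⟨(e x).1, heF' x⟩) hfin.quotientMk_comap (φ.comp (base p e)) hs
      (fun a ha => hJφ ha) hφ
    obtain ⟨t, ht, hφt, htt⟩ := exists_ev_eq_of_base e hf φ (hJφ hfJ) ht1 hφ1
    refine ⟨t, ht, hφt, fun z => ?_⟩
    rw [← heF', htt, ← ht1s z]
    rfl

/-- A homomorphism to a nonstandard field is evaluation at a nonstandard point, provided that it
factors through a ring finite over a base where this holds. -/
theorem exists_ev_eq [FiniteDimensional ℂ E] [FiniteDimensional ℂ L] {γ : Type*}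
    {𝒰 : Ultrafilter γ} (π : E →L[ℂ] L) (hπ : Function.Surjective π) (hq : π p = q)
    {J : Ideal (Hol p)} (hfin : ((Ideal.Quotient.mk J).comp (lpull π hq)).Finite)
    (φ : Hol p →+* Germ (𝒰 : Filter γ) ℂ) {s : γ → L} (hs : Tendsto s 𝒰 (𝓝 q))
    (hJ : J ≤ RingHom.ker φ) (hφ : φ.comp (lpull π hq) = ev (𝒰 : Filter γ) s hs) :
    ∃ (t : γ → E) (ht : Tendsto t 𝒰 (𝓝 p)), φ = ev (𝒰 : Filter γ) t ht ∧ ∀ z, π (t z) = s z :=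
  exists_ev_eq_aux _ π hq rfl hπ hfin φ hs hJ hφ

end Hol

namespace Hol

variable {F L : Type*} [NormedAddCommGroup F] [NormedSpace ℂ F] [NormedAddCommGroup L]
  [NormedSpace ℂ L] {p : E} {q : L}

/-- Noether normalization. -/
theorem exists_noether_normalization_aux (d : ℕ) : ∀ {E : Type*} [NormedAddCommGroup E]
    [NormedSpace ℂ E] [FiniteDimensional ℂ E] {p : E} (P : Ideal (Hol p)), P.IsPrime →
    Module.finrank ℂ E = d → ∃ (k : ℕ) (π : E →L[ℂ] (Fin k → ℂ)), Function.Surjective π ∧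
      P.comap (lpull π (rfl : π p = π p)) = ⊥ ∧
      ((Ideal.Quotient.mk P).comp (lpull π (rfl : π p = π p))).Finite := by
  have main : ∀ {E : Type _} [NormedAddCommGroup E] [NormedSpace ℂ E] [FiniteDimensional ℂ E]
      {p : E}, ∃ (k : ℕ) (π : E →L[ℂ] (Fin k → ℂ)), Function.Surjective π ∧
      (⊥ : Ideal (Hol p)).comap (lpull π (rfl : π p = π p)) = ⊥ ∧
      ((Ideal.Quotient.mk ⊥).comp (lpull π (rfl : π p = π p))).Finite := by
    intro E _ _ _ p
    let e : E ≃L[ℂ] (Fin (Module.finrank ℂ E) → ℂ) :=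
      ContinuousLinearEquiv.ofFinrankEq (by simp)
    refine ⟨_, e.toContinuousLinearMap, e.surjective, ?_, ?_⟩
    · rw [← RingHom.ker_eq_comap_bot, ← RingHom.injective_iff_ker_eq_bot]
      exact pull_injective_of_open _ _ (e.toHomeomorph.isOpenMap.nhds_le p)
    · exact RingHom.Finite.of_surjective _ (Ideal.Quotient.mk_surjective.comp
        (pull_surjective_of_injective e.toContinuousLinearMap e.injective rfl))
  induction d with
  | zero =>
    intro E _ _ _ p P hP hd
    have := Module.finrank_zero_iff.1 hd
    have h0 : P = ⊥ := by
      rw [eq_bot_iff]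
      intro a ha
      by_contra h
      refine hP.ne_top (P.eq_top_of_isUnit_mem ha (isUnit_iff.2 fun h' => h ?_))
      exact (injective_iff_map_eq_zero _).1 (bijective_val_of_subsingleton p).1 a h'
    rw [h0]
    exact main
  | succ d ih =>
    intro E _ _ _ p P hP hd
    rcases eq_or_ne P ⊥ with rfl | hP0
    · exact main
    obtain ⟨f, hfP, hf⟩ := Submodule.exists_mem_ne_zero_of_ne_bot hP0
    obtain ⟨v, hv⟩ := exists_line_ne_zero hf
    rcases eq_or_ne v 0 with rfl | hv0
    · refine (hP.ne_top (P.eq_top_of_isUnit_mem hfP (isUnit_iff.2 fun h0 => hv ?_))).elim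
      obtain ⟨f, hf', rfl⟩ := exists_rep f
      rw [line, pull_mk, mk_eq_zero]
      filter_upwards with t
      simpa using h0
    obtain ⟨F, e, rfl, -, hF⟩ := exists_splitting hv0
    have hfin : ((Ideal.Quotient.mk P).comp (base p e)).Finite :=
      (finite_quotient_span e hv).quotientMk_of_le ((Ideal.span_singleton_le_iff_mem P).2 hfP)
    obtain ⟨k, π, hπ, hbot, hπf⟩ := ih (P.comap (base p e)) inferInstance (by lia)
    let π' : E →L[ℂ] (Fin k → ℂ) := π ∘L (ContinuousLinearMap.fst ℂ F ℂ ∘L (e : E →L[ℂ] F × ℂ))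
    have hcomp : lpull π' (rfl : π' p = π' p) =
        (base p e).comp (lpull π (rfl : π (e p).1 = π (e p).1)) := by
      ext a
      obtain ⟨a, ha, rfl⟩ := exists_rep a
      rfl
    refine ⟨k, π', ?_, ?_, ?_⟩
    · exact hπ.comp (Prod.fst_surjective.comp e.surjective)
    · have h0 : P.comap (lpull π' (rfl : π' p = π' p)) =
          (P.comap (base p e)).comap (lpull π (rfl : π (e p).1 = π (e p).1)) :=
        Ideal.ext fun a => by rw [Ideal.mem_comap, hcomp]; rfl
      rw [h0]
      exact hbot
    · rw [hcomp]
      exact hfin.quotientMk_comp hπf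

theorem exists_noether_normalization [FiniteDimensional ℂ E] (P : Ideal (Hol p)) [P.IsPrime] :
    ∃ (k : ℕ) (π : E →L[ℂ] (Fin k → ℂ)), Function.Surjective π ∧
      P.comap (lpull π (rfl : π p = π p)) = ⊥ ∧
      ((Ideal.Quotient.mk P).comp (lpull π (rfl : π p = π p))).Finite :=
  exists_noether_normalization_aux _ P inferInstance rfl

/-- A nonstandard point at which no nonzero germ vanishes. -/
theorem exists_generic_ultrafilter (p : E) :
    ∃ (𝒰 : Ultrafilter E) (h : Tendsto id (𝒰 : Filter E) (𝓝 p)),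
    Function.Injective (ev (𝒰 : Filter E) id h) := by
  let 𝒢 : Filter E :=
    { sets := {s | ∃ (f : E → ℂ) (hf : AnalyticAt ℂ f p), mk f hf ≠ 0 ∧
        ∀ᶠ x in 𝓝 p, f x ≠ 0 → x ∈ s}
      univ_sets := ⟨fun _ => 1, analyticAt_const, by rw [mk_const, map_one]; exact one_ne_zero,
        by simp⟩
      sets_of_superset := by
        rintro s t ⟨f, hf, h0, h⟩ hst
        exact ⟨f, hf, h0, h.mono fun x hx h1 => hst (hx h1)⟩
      inter_sets := by
        rintro s t ⟨f, hf, hf0, hs⟩ ⟨g, hg, hg0, ht⟩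
        refine ⟨f * g, hf.mul hg, ?_, ?_⟩
        · rw [← mk_mul hf hg]
          exact mul_ne_zero hf0 hg0
        · filter_upwards [hs, ht] with x h1 h2 h
          exact ⟨h1 (left_ne_zero_of_mul h), h2 (right_ne_zero_of_mul h)⟩ }
  have hne : 𝒢.NeBot := ⟨fun h => by
    obtain ⟨f, hf, hf0, hs⟩ : ∅ ∈ 𝒢 := h ▸ mem_bot
    exact hf0 (mk_eq_zero.2 (hs.mono fun x hx => by simpa using hx))⟩
  have hle : 𝒢 ≤ 𝓝 p := fun s hs => ⟨fun _ => 1, analyticAt_const, by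
    rw [mk_const, map_one]; exact one_ne_zero, by filter_upwards [hs] with x hx _ using hx⟩
  refine ⟨Ultrafilter.of 𝒢, (Ultrafilter.of_le 𝒢).trans hle, ?_⟩
  rw [injective_iff_map_eq_zero]
  intro a ha
  by_contra h0
  obtain ⟨f, hf, rfl⟩ := exists_rep a
  have h1 : ∀ᶠ x in (Ultrafilter.of 𝒢 : Filter E), f x = 0 := Germ.coe_eq.1 ha
  have h2 : ∀ᶠ x in (Ultrafilter.of 𝒢 : Filter E), f x ≠ 0 :=
    Ultrafilter.of_le 𝒢 ⟨f, hf, h0, Eventually.of_forall fun x hx => hx⟩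
  exact (h1.and h2).exists.elim fun x hx => hx.2 hx.1

theorem mem_ker_ev {γ : Type*} {l : Filter γ} {t : γ → E} (ht : Tendsto t l (𝓝 p)) {f : E → ℂ}
    {hf : AnalyticAt ℂ f p} : mk f hf ∈ RingHom.ker (ev l t ht) ↔ ∀ᶠ z in l, f (t z) = 0 := by
  rw [RingHom.mem_ker, ev_mk]
  exact Germ.coe_eq

/-- Every prime ideal is the ideal of a nonstandard point. -/
theorem exists_ultrafilter [FiniteDimensional ℂ E] (P : Ideal (Hol p)) [P.IsPrime] :
    ∃ 𝒰 : Ultrafilter E, (𝒰 : Filter E) ≤ 𝓝 p ∧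
      ∀ (f : E → ℂ) (hf : AnalyticAt ℂ f p), mk f hf ∈ P ↔ ∀ᶠ x in (𝒰 : Filter E), f x = 0 := by
  obtain ⟨k, π, hπ, hbot, hfin⟩ := exists_noether_normalization P
  obtain ⟨𝒱, h𝒱, hinj⟩ := exists_generic_ultrafilter (π p)
  let ψ : Hol (π p) →+* Germ (𝒱 : Filter (Fin k → ℂ)) ℂ := ev (𝒱 : Filter (Fin k → ℂ)) id h𝒱
  have hψ : RingHom.ker ψ = P.comap (lpull π (rfl : π p = π p)) := by
    rw [hbot]
    exact (RingHom.injective_iff_ker_eq_bot _).1 hinj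
  obtain ⟨Ψ, hΨ, hker⟩ := exists_ringHom_ker_eq hfin.to_isIntegral ψ hψ
  obtain ⟨t, ht, rfl, -⟩ := exists_ev_eq π hπ rfl hfin Ψ h𝒱 hker.ge hΨ
  refine ⟨𝒱.map t, ht, fun f hf => ?_⟩
  rw [← hker, mem_ker_ev]
  rfl

end Hol

/-- `V` is, near `p`, the common zero set of finitely many analytic functions. -/
def IsAnalyticNear (V : Set E) (p : E) : Prop :=
  ∃ S : Finset (E → ℂ), (∀ g ∈ S, AnalyticAt ℂ g p) ∧ ∀ᶠ x in 𝓝 p, x ∈ V ↔ ∀ g ∈ S, g x = 0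

/-- The ideal of germs vanishing on `V`. -/
noncomputable def germIdeal (V : Set E) (p : E) : Ideal (Hol p) := vanishingGermIdeal V p

namespace IsAnalyticNear

variable {V W : Set E} {p : E}

theorem congr (h : IsAnalyticNear V p) (hVW : ∀ᶠ x in 𝓝 p, x ∈ V ↔ x ∈ W) :
    IsAnalyticNear W p := by
  obtain ⟨S, hS, hV⟩ := h
  refine ⟨S, hS, ?_⟩
  filter_upwards [hV, hVW] with x h1 h2
  rw [← h2, h1]

theorem eventually (h : IsAnalyticNear V p) : ∀ᶠ x in 𝓝 p, IsAnalyticNear V x := by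
  obtain ⟨S, hS, hV⟩ := h
  have h1 : ∀ᶠ x in 𝓝 p, ∀ g ∈ S, AnalyticAt ℂ g x :=
    (Finset.eventually_all S).2 fun g hg => (hS g hg).eventually_analyticAt
  filter_upwards [h1, hV.eventually_nhds] with x hx hx' using ⟨S, hx, hx'⟩

theorem union (hV : IsAnalyticNear V p) (hW : IsAnalyticNear W p) : IsAnalyticNear (V ∪ W) p := by
  classical
  obtain ⟨S, hS, hV⟩ := hV
  obtain ⟨T, hT, hW⟩ := hW
  refine ⟨Finset.image₂ (· * ·) S T, fun g hg => ?_, ?_⟩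
  · obtain ⟨a, ha, b, hb, rfl⟩ := Finset.mem_image₂.1 hg
    exact (hS a ha).mul (hT b hb)
  · filter_upwards [hV, hW] with x h1 h2
    rw [Set.mem_union, h1, h2]
    constructor
    · intro h g hg
      obtain ⟨a, ha, b, hb, rfl⟩ := Finset.mem_image₂.1 hg
      rcases h with h | h
      · simp [h a ha]
      · simp [h b hb]
    · intro h
      by_contra! hcon
      obtain ⟨⟨a, ha, ha0⟩, b, hb, hb0⟩ := hcon
      exact mul_ne_zero ha0 hb0 (h _ (Finset.mem_image₂_of_mem ha hb))

theorem inter (hV : IsAnalyticNear V p) (hW : IsAnalyticNear W p) : IsAnalyticNear (V ∩ W) p := by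
  classical
  obtain ⟨S, hS, hV⟩ := hV
  obtain ⟨T, hT, hW⟩ := hW
  refine ⟨S ∪ T, fun g hg => (Finset.mem_union.1 hg).elim (hS g) (hT g), ?_⟩
  filter_upwards [hV, hW] with x h1 h2
  rw [Set.mem_inter_iff, h1, h2]
  simp only [Finset.mem_union, or_imp, forall_and]

theorem empty (p : E) : IsAnalyticNear (∅ : Set E) p :=
  ⟨{fun _ => 1}, by simpa using analyticAt_const, by simp⟩

theorem univ (p : E) : IsAnalyticNear (Set.univ : Set E) p := ⟨∅, by simp, by simp⟩

theorem biUnion {ι : Type*} (s : Finset ι) {V : ι → Set E} (h : ∀ i ∈ s, IsAnalyticNear (V i) p) :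
    IsAnalyticNear (⋃ i ∈ s, V i) p := by
  classical
  induction s using Finset.induction_on with
  | empty => simpa using empty p
  | insert a s ha ih =>
    rw [Finset.set_biUnion_insert]
    exact (h a (Finset.mem_insert_self a s)).union
      (ih fun i hi => h i (Finset.mem_insert_of_mem hi))

theorem biInter {ι : Type*} (s : Finset ι) {V : ι → Set E} (h : ∀ i ∈ s, IsAnalyticNear (V i) p) :
    IsAnalyticNear (⋂ i ∈ s, V i) p := by
  classical
  induction s using Finset.induction_on with
  | empty => simpa using univ p
  | insert a s ha ih =>
    rw [Finset.set_biInter_insert]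
    exact (h a (Finset.mem_insert_self a s)).inter
      (ih fun i hi => h i (Finset.mem_insert_of_mem hi))

theorem isClosed_near (h : IsAnalyticNear V p) (hp : p ∉ V) : ∀ᶠ x in 𝓝 p, x ∉ V := by
  obtain ⟨S, hS, hV⟩ := h
  have := hV.self_of_nhds
  rw [this] at hp
  push Not at hp
  obtain ⟨g, hg, hgp⟩ := hp
  filter_upwards [hV, (hS g hg).continuousAt.eventually_ne hgp] with x h1 h2
  rw [h1]
  exact fun h => h2 (h g hg)

end IsAnalyticNear

namespace IsAnalyticIn

variable {Ω Z : Set E}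

theorem isAnalyticNear (h : IsAnalyticIn Ω Z) {p : E} (hp : p ∈ Ω) : IsAnalyticNear Z p := by
  classical
  obtain ⟨U, k, g, hU, hpU, -, hg, hZ⟩ := h.2 p hp
  refine ⟨Finset.univ.image g, fun a ha => ?_, ?_⟩
  · obtain ⟨j, -, rfl⟩ := Finset.mem_image.1 ha
    exact hg j p hpU
  · filter_upwards [hU.mem_nhds hpU] with x hx
    have : x ∈ Z ∩ U ↔ x ∈ {x ∈ U | ∀ j, g j x = 0} := by rw [hZ]
    simpa [hx] using this

theorem of_isAnalyticNear (hΩ : IsOpen Ω) (hZ : Z ⊆ Ω) (h : ∀ p ∈ Ω, IsAnalyticNear Z p) :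
    IsAnalyticIn Ω Z := by
  refine ⟨hZ, fun p hp => ?_⟩
  obtain ⟨S, hS, hV⟩ := h p hp
  have h1 : ∀ᶠ x in 𝓝 p, ∀ g ∈ S, AnalyticAt ℂ g x :=
    (Finset.eventually_all S).2 fun g hg => (hS g hg).eventually_analyticAt
  obtain ⟨U, hU, hUo, hpU⟩ := eventually_nhds_iff.1 (h1.and (hV.and (hΩ.mem_nhds hp)))
  refine ⟨U, S.card, fun j => S.equivFin.symm j, hUo, hpU, fun x hx => (hU x hx).2.2,
    fun j x hx => (hU x hx).1 _ (S.equivFin.symm j).2, ?_⟩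
  ext x
  simp only [Set.mem_inter_iff, Set.mem_ofPred_eq]
  rw [and_comm, and_congr_right_iff]
  intro hx
  rw [(hU x hx).2.1]
  constructor
  · intro h j
    exact h _ (S.equivFin.symm j).2
  · intro h g hg
    have := h (S.equivFin ⟨g, hg⟩)
    rwa [Equiv.symm_apply_apply] at this

end IsAnalyticIn

section GermIdeal

open Hol

variable {V W : Set E} {p : E}

theorem mk_mem_germIdeal {f : E → ℂ} {hf : AnalyticAt ℂ f p} :
    Hol.mk f hf ∈ germIdeal V p ↔ ∀ᶠ x in 𝓝 p, x ∈ V → f x = 0 := by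
  rw [← eventually_nhdsWithin_iff]
  constructor
  · rintro ⟨g, hg, hgf, h⟩
    filter_upwards [h, (Germ.coe_eq.1 hgf).filter_mono nhdsWithin_le_nhds] with x h1 h2
    rw [← h2, h1]
  · intro h
    exact ⟨f, hf, rfl, h⟩

theorem germIdeal_anti (h : ∀ᶠ x in 𝓝 p, x ∈ V → x ∈ W) : germIdeal W p ≤ germIdeal V p := by
  intro a ha
  obtain ⟨f, hf, rfl⟩ := exists_rep a
  rw [mk_mem_germIdeal] at ha ⊢
  filter_upwards [h, ha] with x h1 h2 hx using h2 (h1 hx)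

theorem germIdeal_isRadical (V : Set E) (p : E) : (germIdeal V p).IsRadical := by
  rintro a ⟨n, ha⟩
  obtain ⟨f, hf, rfl⟩ := exists_rep a
  have h1 : mk f hf ^ n = mk (f ^ n) (hf.pow n) := toGerm_injective (map_pow (toGerm p) _ _)
  rw [h1, mk_mem_germIdeal] at ha
  rw [mk_mem_germIdeal]
  filter_upwards [ha] with x hx hxV using eq_zero_of_pow_eq_zero (hx hxV)

theorem IsAnalyticNear.eventually_subset (hW : IsAnalyticNear W p)
    (h : germIdeal W p ≤ germIdeal V p) : ∀ᶠ x in 𝓝 p, x ∈ V → x ∈ W := by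
  obtain ⟨S, hS, hW⟩ := hW
  have h1 : ∀ᶠ x in 𝓝 p, ∀ g ∈ S, x ∈ V → g x = 0 :=
    (Finset.eventually_all S).2 fun g hg => (mk_mem_germIdeal (hf := hS g hg)).1 (h
      (mk_mem_germIdeal.2 (hW.mono fun x hx hxW => hx.1 hxW g hg)))
  filter_upwards [h1, hW] with x hx hx' hxV
  exact hx'.2 fun g hg => hx g hg hxV

theorem germIdeal_eq_top (hV : ∀ᶠ x in 𝓝 p, x ∉ V) : germIdeal V p = ⊤ := by
  rw [Ideal.eq_top_iff_one]
  exact (mk_mem_germIdeal (hf := analyticAt_const)).2 (hV.mono fun x hx h => (hx h).elim)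

theorem germIdeal_ne_top (hp : p ∈ V) : germIdeal V p ≠ ⊤ := by
  rw [Ne, Ideal.eq_top_iff_one]
  intro h
  exact one_ne_zero ((mk_mem_germIdeal (hf := analyticAt_const)).1 h |>.self_of_nhds hp)

/-- The nonstandard point of a prime ideal lies on every analytic set whose ideal it contains. -/
theorem IsAnalyticNear.mem_ultrafilter (hV : IsAnalyticNear V p) {P : Ideal (Hol p)}
    (hP : germIdeal V p ≤ P) {𝒰 : Ultrafilter E} (h𝒰 : (𝒰 : Filter E) ≤ 𝓝 p)
    (h : ∀ (f : E → ℂ) (hf : AnalyticAt ℂ f p), mk f hf ∈ P → ∀ᶠ x in (𝒰 : Filter E), f x = 0) :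
    ∀ᶠ x in (𝒰 : Filter E), x ∈ V := by
  obtain ⟨S, hS, hV⟩ := hV
  have h1 : ∀ᶠ x in (𝒰 : Filter E), ∀ g ∈ S, g x = 0 :=
    (Finset.eventually_all S).2 fun g hg => h g (hS g hg) (hP
      (mk_mem_germIdeal.2 (hV.mono fun x hx hxW => hx.1 hxW g hg)))
  filter_upwards [h1, h𝒰 hV] with x hx hx'
  exact hx'.2 hx

/-- The Nullstellensatz. -/
theorem germIdeal_eq_radical [FiniteDimensional ℂ E] {I : Ideal (Hol p)} {S : Finset (E → ℂ)}
    (hS : ∀ g ∈ S, ∃ hg : AnalyticAt ℂ g p, mk g hg ∈ I)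
    (hV : ∀ᶠ x in 𝓝 p, (∀ g ∈ S, g x = 0) → x ∈ V) (hI : I ≤ germIdeal V p) :
    germIdeal V p = I.radical := by
  refine le_antisymm ?_ ((germIdeal_isRadical V p).radical_le_iff.2 hI)
  rw [Ideal.radical_eq_sInf]
  refine le_sInf ?_
  rintro P ⟨hIP, hP⟩ a ha
  obtain ⟨f, hf, rfl⟩ := exists_rep a
  obtain ⟨𝒰, h𝒰, hU⟩ := exists_ultrafilter P
  rw [hU]
  have h1 : ∀ᶠ x in (𝒰 : Filter E), ∀ g ∈ S, g x = 0 :=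
    (Finset.eventually_all S).2 fun g hg => by
      obtain ⟨hg', hgI⟩ := hS g hg
      exact (hU g hg').1 (hIP hgI)
  rw [mk_mem_germIdeal] at ha
  filter_upwards [h𝒰 ha, h𝒰 hV, h1] with x hx hx' h2 using hx (hx' h2)

theorem exists_isAnalyticNear [FiniteDimensional ℂ E] (I : Ideal (Hol p)) :
    ∃ V : Set E, IsAnalyticNear V p ∧ germIdeal V p = I.radical := by
  classical
  obtain ⟨T, rfl⟩ := (isNoetherianRing_iff_ideal_fg (Hol p)).1 inferInstance I
  choose r hr hr' using fun a : Hol p => exists_rep a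
  have hr0 : ∀ g ∈ T.image r, ∃ hg : AnalyticAt ℂ g p, mk g hg ∈ Ideal.span (T : Set (Hol p)) := by
    intro g hg
    obtain ⟨a, ha, rfl⟩ := Finset.mem_image.1 hg
    exact ⟨hr a, by rw [hr']; exact Ideal.subset_span ha⟩
  refine ⟨{x | ∀ g ∈ T.image r, g x = 0}, ⟨T.image r, fun g hg => (hr0 g hg).1, by simp⟩,
    germIdeal_eq_radical hr0 (by simp) (Ideal.span_le.2 fun a ha => ?_)⟩
  rw [SetLike.mem_coe, ← hr' a, mk_mem_germIdeal]
  exact Eventually.of_forall fun x hx => hx _ (Finset.mem_image_of_mem r ha)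

end GermIdeal

section CommutativeAlgebra

variable {R S : Type*} [CommRing R] [CommRing S]

theorem RingHom.IsIntegral.ringKrullDim_le {φ : R →+* S} (h : φ.IsIntegral) :
    ringKrullDim S ≤ ringKrullDim R := by
  let := φ.toAlgebra
  have : Algebra.IsIntegral R S := ⟨h⟩
  exact Order.krullDim_le_of_strictMono (PrimeSpectrum.comap φ) fun I J hIJ =>
    Ideal.IsIntegral.comap_lt_comap (R := R) (I := I.asIdeal) (J := J.asIdeal) hIJ

theorem RingHom.IsIntegral.ringKrullDim_eq {φ : R →+* S} (h : φ.IsIntegral)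
    (hφ : Function.Injective φ) : ringKrullDim S = ringKrullDim R := by
  refine le_antisymm h.ringKrullDim_le (iSup_le fun l => ?_)
  let := φ.toAlgebra
  have : Algebra.IsIntegral R S := ⟨h⟩
  obtain ⟨Q, -, hQ, hQl⟩ := Ideal.exists_ideal_over_prime_of_isIntegral (S := S)
    (RelSeries.head l).asIdeal ⊥ (by
      change RingHom.ker φ ≤ _
      rw [(RingHom.injective_iff_ker_eq_bot _).1 hφ]
      exact bot_le)
  have : Q.LiesOver (RelSeries.head l).asIdeal := ⟨hQl.symm⟩
  obtain ⟨l', hl', -⟩ := Ideal.exists_ltSeries_of_hasGoingUp l Q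
  rw [← hl']
  exact le_iSup (fun p : LTSeries (PrimeSpectrum S) => (p.length : WithBot ℕ∞)) l'

open Polynomial in
theorem exists_C_mem_span_pair {A : Type*} [CommRing A] [IsDomain A] [UniqueFactorizationMonoid A]
    {p g : A[X]} (hp : Prime p) (hd : p.natDegree ≠ 0) (hpg : ¬ p ∣ g) :
    ∃ a ≠ 0, C a ∈ Ideal.span {p, g} := by
  let _ : NormalizedGCDMonoid A := Classical.choice inferInstance
  let K := FractionRing A
  have hprim : p.IsPrimitive := hp.irreducible.isPrimitive hd
  have hirr : Irreducible (p.map (algebraMap A K)) :=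
    (hprim.irreducible_iff_irreducible_map_fraction_map (K := K)).1 hp.irreducible
  have hcop : IsCoprime (p.map (algebraMap A K)) (g.map (algebraMap A K)) :=
    (hirr.coprime_iff_not_dvd).2 fun h => hpg (hprim.dvd_of_fraction_map_dvd_fraction_map h)
  obtain ⟨u, v, huv⟩ := hcop
  obtain ⟨b, hb0, hb⟩ := IsLocalization.integerNormalization_spec (nonZeroDivisors A) u
  obtain ⟨c, hc0, hc⟩ := IsLocalization.integerNormalization_spec (nonZeroDivisors A) v
  refine ⟨b * c, nonZeroDivisors.ne_zero (mul_mem hb0 hc0), Ideal.mem_span_pair.2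
    ⟨C c * IsLocalization.integerNormalization (nonZeroDivisors A) u,
      C b * IsLocalization.integerNormalization (nonZeroDivisors A) v, ?_⟩⟩
  apply Polynomial.map_injective (algebraMap A K) (IsFractionRing.injective A K)
  have hs : ∀ (a : A) (w : K[X]), a • w = C (algebraMap A K a) * w := fun a w => by
    rw [← algebraMap_smul K a w, smul_eq_C_mul]
  rw [hs] at hb hc
  simp only [Polynomial.map_add, Polynomial.map_mul, map_C, hb, hc, map_mul]
  linear_combination C (algebraMap A K b) * C (algebraMap A K c) * huv

end CommutativeAlgebra

namespace Hol

open Polynomial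

variable {p : E}

theorem uniqueFactorizationMonoid_aux (d : ℕ) : ∀ {E : Type*} [NormedAddCommGroup E]
    [NormedSpace ℂ E] [FiniteDimensional ℂ E] (p : E), Module.finrank ℂ E = d →
    UniqueFactorizationMonoid (Hol p) := by
  induction d with
  | zero =>
    intro E _ _ _ p hd
    have := Module.finrank_zero_iff.1 hd
    let e := RingEquiv.ofBijective (val p) (bijective_val_of_subsingleton p)
    exact e.symm.toMulEquiv.uniqueFactorizationMonoid inferInstance
  | succ d ih =>
    intro E _ _ _ p hd
    suffices h : ∀ f : Hol p, Irreducible f → Prime f from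
      { (inferInstance : WfDvdMonoid (Hol p)) with
        irreducible_iff_prime := fun {f} => ⟨h f, Prime.irreducible⟩ }
    intro f hf
    obtain ⟨v, hv⟩ := exists_line_ne_zero hf.ne_zero
    rcases eq_or_ne v 0 with rfl | hv0
    · refine (hf.not_isUnit (isUnit_iff.2 fun h0 => hv ?_)).elim
      obtain ⟨f, hf', rfl⟩ := exists_rep f
      rw [line, pull_mk, mk_eq_zero]
      filter_upwards with t
      simpa using h0
    obtain ⟨F, e, rfl, -, hF⟩ := exists_splitting hv0
    let A := Hol (e p).1
    have : UniqueFactorizationMonoid A := ih (e p).1 (by lia)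
    obtain ⟨b, r, hr, hass, -⟩ := exists_preparation e hv
    let Φ : A[X] →+* Hol p := Polynomial.eval₂RingHom (base p e) (coord p e)
    let ω : A[X] := X ^ b - ∑ j ∈ Finset.range b, C (r j) * X ^ j
    have hω : ω.Monic := by
      refine (monic_X_pow b).sub_of_left ?_
      rw [degree_X_pow]
      refine (degree_sum_le _ _).trans_lt ((Finset.sup_lt_iff (WithBot.bot_lt_coe b)).2 ?_)
      intro j hj
      exact (degree_C_mul_X_pow_le _ _).trans_lt (WithBot.coe_lt_coe.2 (Finset.mem_range.1 hj))
    have hΦω : Associated f (Φ ω) := by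
      convert hass
      simp [Φ, ω, eval₂_finsetSum]
    obtain ⟨s, hs, hsω⟩ := UniqueFactorizationMonoid.exists_prime_factors ω hω.ne_zero
    obtain ⟨P, hPs, hPu⟩ : ∃ P ∈ s, ¬ IsUnit (Φ P) := by
      by_contra! hcon
      have h1 : IsUnit (Φ s.prod) := by
        rw [map_multiset_prod]
        refine Multiset.prod_induction IsUnit _ (fun _ _ => IsUnit.mul) isUnit_one fun x hx => ?_
        obtain ⟨P, hP, rfl⟩ := Multiset.mem_map.1 hx
        exact hcon P hP
      exact hf.not_isUnit ((hΦω.trans (hsω.map Φ).symm).isUnit_iff.2 h1)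
    have hP := hs P hPs
    obtain ⟨g, hg⟩ : P ∣ ω := (Multiset.dvd_prod hPs).trans hsω.dvd
    have hfP : Associated f (Φ P) := by
      have h1 : Irreducible (Φ P * Φ g) := by
        rw [← map_mul, ← hg]
        exact hΦω.irreducible hf
      have h2 := (h1.isUnit_or_isUnit rfl).resolve_left hPu
      refine hΦω.trans ?_
      rw [hg, map_mul]
      exact associated_mul_unit_left _ _ h2
    refine hfP.prime_iff.2 ?_
    have hPl : line p (e.symm (0, 1)) (Φ P) ≠ 0 := by
      obtain ⟨u, hu⟩ := hfP.symm
      intro h0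
      rw [← hu, map_mul, h0, zero_mul] at hv
      exact hv rfl
    have hfin := finite_quotient_span e hPl
    have hlead : IsUnit P.leadingCoeff := by
      have : P.leadingCoeff * g.leadingCoeff = 1 := by
        rw [← leadingCoeff_mul, ← hg, hω]
      exact IsUnit.of_mul_eq_one _ this
    have hdeg : P.natDegree ≠ 0 := by
      intro h0
      rw [eq_C_of_natDegree_eq_zero h0, ← h0] at hP
      exact hP.not_isUnit (hlead.map C)
    have hbase : ∀ a ≠ 0, base p e a ∉ Ideal.span {Φ P} := by
      intro a ha h0
      have h1 : ringKrullDim (Hol p ⧸ Ideal.span {Φ P}) ≤ ringKrullDim (A ⧸ Ideal.span {a}) := by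
        let j : A ⧸ Ideal.span {a} →+* Hol p ⧸ Ideal.span {Φ P} :=
          Ideal.quotientMap _ (base p e) ((Ideal.span_singleton_le_iff_mem _).2 h0)
        have hj : j.comp (Ideal.Quotient.mk _) = (Ideal.Quotient.mk _).comp (base p e) :=
          Ideal.quotientMap_comp_mk _
        exact (RingHom.Finite.of_comp_finite (f := Ideal.Quotient.mk _)
          (by rw [hj]; exact hfin)).to_isIntegral.ringKrullDim_le
      have h2 := ringKrullDim_quotient_succ_le_of_nonZeroDivisor (mem_nonZeroDivisors_of_ne_zero ha)
      have h3 := ringKrullDim_le_ringKrullDim_quotient_add_card (R := Hol p) {Φ P} (by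
        rw [Finset.coe_singleton, Set.singleton_subset_iff,
          IsLocalRing.ringJacobson_eq_maximalIdeal]
        exact hPu)
      rw [Finset.coe_singleton, Finset.card_singleton] at h3
      have h4 := h3.trans ((add_le_add_left h1 _).trans h2)
      rw [ringKrullDim_eq, ringKrullDim_eq, hF] at h4
      have h5 : Module.finrank ℂ F + 1 ≤ Module.finrank ℂ F := by exact_mod_cast h4
      lia
    have hcomap : ∀ g : A[X], Φ g ∈ Ideal.span {Φ P} → P ∣ g := by
      intro g hg
      by_contra hPg
      obtain ⟨a, ha, haC⟩ := exists_C_mem_span_pair hP hdeg hPg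
      refine hbase a ha ?_
      obtain ⟨u, v, huv⟩ := Ideal.mem_span_pair.1 haC
      have h1 : base p e a = Φ u * Φ P + Φ v * Φ g := by
        rw [← map_mul, ← map_mul, ← map_add, huv]
        simp [Φ]
      rw [h1]
      exact add_mem (Ideal.mul_mem_left _ _ (Ideal.mem_span_singleton_self _))
        (Ideal.mul_mem_left _ _ hg)
    have hsurj : ∀ x : Hol p, ∃ g : A[X], Φ P ∣ x - Φ g := by
      intro x
      obtain ⟨b, -, -, -, hb⟩ := exists_division e hPl
      obtain ⟨q, r, rfl⟩ := hb x
      have h1 : Φ (∑ j ∈ Finset.range b, C (r j) * X ^ j) =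
          ∑ j ∈ Finset.range b, base p e (r j) * coord p e ^ j := by simp [Φ]
      exact ⟨∑ j ∈ Finset.range b, C (r j) * X ^ j, q, by rw [h1]; ring⟩
    have hP0 : Φ P ≠ 0 := fun h => hPl (by rw [h, map_zero])
    refine ⟨hP0, hPu, fun x y hxy => ?_⟩
    obtain ⟨g, c, hg⟩ := hsurj x
    obtain ⟨h, d, hh⟩ := hsurj y
    have h1 : Φ P ∣ Φ (g * h) := by
      obtain ⟨w, hw⟩ := hxy
      rw [map_mul]
      refine ⟨w - c * y - Φ g * d, ?_⟩
      linear_combination hw - y * hg - Φ g * hh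
    rcases hP.dvd_or_dvd (hcomap _ (Ideal.mem_span_singleton.2 h1)) with h2 | h2
    · left
      rw [← sub_add_cancel x (Φ g), hg]
      exact dvd_add (dvd_mul_right _ _) (map_dvd Φ h2)
    · right
      rw [← sub_add_cancel y (Φ h), hh]
      exact dvd_add (dvd_mul_right _ _) (map_dvd Φ h2)

instance [FiniteDimensional ℂ E] : UniqueFactorizationMonoid (Hol p) :=
  uniqueFactorizationMonoid_aux _ p rfl

end Hol

theorem exists_ringHom_of_eval₂_minpoly_eq_zero {A B K : Type*} [CommRing A] [IsDomain A]
    [IsIntegrallyClosed A] [CommRing B] [IsDomain B] [Algebra A B] [Module.IsTorsionFree A B]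
    [Algebra.IsIntegral A B] [Field K] [IsAlgClosed K] (z : A →+* K) (b : B) {ρ : K}
    (hρ : (minpoly A b).eval₂ z ρ = 0) :
    ∃ Ψ : B →+* K, Ψ.comp (algebraMap A B) = z ∧ Ψ b = ρ := by
  have hb : IsIntegral A b := Algebra.IsIntegral.isIntegral b
  let ε := minpoly.equivAdjoin hb
  let ψ : Algebra.adjoin A {b} →+* K :=
    (AdjoinRoot.lift z ρ hρ).comp (ε.symm : Algebra.adjoin A {b} →+* AdjoinRoot (minpoly A b))
  have hε : ε (AdjoinRoot.root _) = ⟨b, Algebra.self_mem_adjoin_singleton A b⟩ := by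
    rw [show ε (AdjoinRoot.root _) = AdjoinRoot.Minpoly.toAdjoin A b (AdjoinRoot.root _) from
      congrFun (minpoly.coe_equivAdjoin hb) _]
    exact Subtype.ext (by simp)
  have : Algebra.IsIntegral (Algebra.adjoin A {b}) B := Algebra.IsIntegral.tower_top A
  have : (RingHom.ker ψ).IsPrime := RingHom.ker_isPrime ψ
  have hφ : ((Ideal.Quotient.mk (⊥ : Ideal B)).comp
      (algebraMap (Algebra.adjoin A {b}) B)).IsIntegral :=
    RingHom.IsIntegral.trans _ _ (algebraMap_isIntegral_iff.2 inferInstance)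
      (RingHom.isIntegral_of_surjective _ Ideal.Quotient.mk_surjective)
  obtain ⟨Q, hQ, hQp, hQψ⟩ := exists_prime_comap_eq_of_isIntegral hφ (RingHom.ker ψ) (by
    rw [← RingHom.ker_eq_comap_bot]
    intro x hx
    have : x = 0 := Subtype.ext hx
    rw [this]
    exact zero_mem _)
  obtain ⟨Ψ, hΨ, -⟩ := exists_ringHom_ker_eq (hφ.quotientMk_of_le hQ) ψ hQψ.symm
  refine ⟨Ψ, ?_, ?_⟩
  · rw [IsScalarTower.algebraMap_eq A (Algebra.adjoin A {b}) B, ← RingHom.comp_assoc, hΨ]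
    ext a
    simp [ψ]
  · have h1 := RingHom.congr_fun hΨ ⟨b, Algebra.self_mem_adjoin_singleton A b⟩
    have h2 : ε.symm ⟨b, Algebra.self_mem_adjoin_singleton A b⟩ = AdjoinRoot.root _ := by
      rw [AlgEquiv.symm_apply_eq, hε]
    refine h1.trans ?_
    simp only [ψ, RingHom.comp_apply]
    erw [h2]
    exact AdjoinRoot.lift_root hρ

theorem Filter.Germ.coe_monic {γ : Type*} (l : Filter γ) (D : ℕ) (a : ℕ → γ → ℂ) (b : γ → ℂ) :
    ((fun x => b x ^ D + ∑ i ∈ Finset.range D, a i x * b x ^ i : γ → ℂ) : Germ l ℂ) =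
      (b : Germ l ℂ) ^ D + ∑ i ∈ Finset.range D, (a i : Germ l ℂ) * (b : Germ l ℂ) ^ i := by
  have h : (fun x => b x ^ D + ∑ i ∈ Finset.range D, a i x * b x ^ i : γ → ℂ) =
      b ^ D + ∑ i ∈ Finset.range D, a i * b ^ i := by
    funext x
    simp
  rw [h]
  change Germ.coeRingHom l _ = _
  simp only [map_add, map_pow, map_sum, map_mul]
  rfl

namespace Hol

variable {L : Type*} [NormedAddCommGroup L] [NormedSpace ℂ L] {q : E}

theorem exists_monic_lift [FiniteDimensional ℂ E] [FiniteDimensional ℂ L] {P : Ideal (Hol q)}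
    [P.IsPrime] (π : E →L[ℂ] L) (hπ : Function.Surjective π)
    (hbot : P.comap (lpull π (rfl : π q = π q)) = ⊥)
    (hfin : ((Ideal.Quotient.mk P).comp (lpull π (rfl : π q = π q))).Finite)
    {b : E → ℂ} (hb : AnalyticAt ℂ b q) :
    ∃ (D : ℕ) (a : ℕ → L → ℂ), (∀ i, AnalyticAt ℂ (a i) (π q)) ∧
      (∃ h, mk (fun x => b x ^ D + ∑ i ∈ Finset.range D, a i (π x) * b x ^ i) h ∈ P) ∧
      ∀ {γ : Type _} (𝒰 : Ultrafilter γ) (s : γ → L) (ρ : γ → ℂ), Tendsto s 𝒰 (𝓝 (π q)) →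
        (∀ᶠ z in 𝒰, ρ z ^ D + ∑ i ∈ Finset.range D, a i (s z) * ρ z ^ i = 0) →
        ∃ (t : γ → E) (ht : Tendsto t 𝒰 (𝓝 q)), (∀ z, π (t z) = s z) ∧
          P ≤ RingHom.ker (ev (𝒰 : Filter γ) t ht) ∧ ∀ᶠ z in 𝒰, b (t z) = ρ z := by
  let φ := (Ideal.Quotient.mk P).comp (lpull π (rfl : π q = π q))
  let := φ.toAlgebra
  have hinj : Function.Injective φ := by
    rw [RingHom.injective_iff_ker_eq_bot]
    exact le_bot_iff.1 fun a ha => hbot ▸ (show lpull π rfl a ∈ P from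
      Ideal.Quotient.eq_zero_iff_mem.1 ha)
  have : Algebra.IsIntegral (Hol (π q)) (Hol q ⧸ P) := ⟨hfin.to_isIntegral⟩
  have : FaithfulSMul (Hol (π q)) (Hol q ⧸ P) := (faithfulSMul_iff_algebraMap_injective _ _).2 hinj
  have : Module.IsTorsionFree (Hol (π q)) (Hol q ⧸ P) := inferInstance
  let β : Hol q ⧸ P := Ideal.Quotient.mk P (mk b hb)
  have hβ : IsIntegral (Hol (π q)) β := Algebra.IsIntegral.isIntegral β
  let M := minpoly (Hol (π q)) β
  have hM : M.Monic := minpoly.monic hβ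
  choose a ha ha' using fun i => exists_rep (M.coeff i)
  have hsum : M = Polynomial.X ^ M.natDegree + ∑ i ∈ Finset.range M.natDegree,
      Polynomial.C (mk (a i) (ha i)) * Polynomial.X ^ i := by
    simp only [ha']
    exact hM.as_sum
  have haπ : ∀ i, AnalyticAt ℂ (fun x => a i (π x)) q := fun i =>
    AnalyticAt.comp_of_eq (ha i) (π.analyticAt q) rfl
  have hFa : AnalyticAt ℂ (fun x => b x ^ M.natDegree +
      ∑ i ∈ Finset.range M.natDegree, a i (π x) * b x ^ i) q :=
    (hb.pow _).add (Finset.analyticAt_fun_sum _ fun i _ => (haπ i).mul (hb.pow i))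
  refine ⟨M.natDegree, a, ha, ⟨hFa, ?_⟩, ?_⟩
  · have h1 : mk _ hFa = M.eval₂ (lpull π (rfl : π q = π q)) (mk b hb) := by
      apply toGerm_injective
      conv_rhs => rw [hsum]
      simp only [Polynomial.eval₂_add, Polynomial.eval₂_finsetSum, Polynomial.eval₂_mul,
        Polynomial.eval₂_pow, Polynomial.eval₂_X, Polynomial.eval₂_C, map_add, map_sum, map_mul,
        map_pow, pull_mk, toGerm_mk]
      exact Filter.Germ.coe_monic _ _ _ _
    rw [h1, ← Ideal.Quotient.eq_zero_iff_mem, Polynomial.hom_eval₂]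
    exact minpoly.aeval (Hol (π q)) β
  · intro γ 𝒰 s ρ hs hρ
    obtain ⟨Ψ, hΨ, hΨb⟩ := exists_ringHom_of_eval₂_minpoly_eq_zero
      (K := Germ (𝒰 : Filter γ) ℂ) (ev (𝒰 : Filter γ) s hs) β (ρ := (ρ : Germ (𝒰 : Filter γ) ℂ)) (by
        change M.eval₂ _ _ = 0
        rw [hsum]
        simp only [Polynomial.eval₂_add, Polynomial.eval₂_finsetSum, Polynomial.eval₂_mul,
          Polynomial.eval₂_pow, Polynomial.eval₂_X, Polynomial.eval₂_C, ev_mk]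
        exact (Filter.Germ.coe_monic _ _ _ _).symm.trans (Germ.coe_eq.2 hρ))
    obtain ⟨t, ht, hΨt, hπt⟩ := exists_ev_eq π hπ rfl hfin
      (Ψ.comp (Ideal.Quotient.mk P)) hs (fun x hx => by
        rw [RingHom.mem_ker, RingHom.comp_apply, Ideal.Quotient.eq_zero_iff_mem.2 hx, map_zero])
      (by rw [RingHom.comp_assoc]; exact hΨ)
    refine ⟨t, ht, hπt, fun x hx => ?_, ?_⟩
    · rw [← hΨt, RingHom.mem_ker, RingHom.comp_apply, Ideal.Quotient.eq_zero_iff_mem.2 hx, map_zero]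
    · have := RingHom.congr_fun hΨt (mk b hb)
      rw [ev_mk] at this
      exact Germ.coe_eq.1 (this.symm.trans hΨb)


theorem exists_monic_lift_eventually [FiniteDimensional ℂ E] [FiniteDimensional ℂ L]
    {P : Ideal (Hol q)} [P.IsPrime] (π : E →L[ℂ] L) (hπ : Function.Surjective π)
    (hbot : P.comap (lpull π (rfl : π q = π q)) = ⊥)
    (hfin : ((Ideal.Quotient.mk P).comp (lpull π (rfl : π q = π q))).Finite)
    {V : Set E} (hV : IsAnalyticNear V q) (hVP : germIdeal V q = P)
    {b : E → ℂ} (hb : AnalyticAt ℂ b q) :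
    ∃ (D : ℕ) (a : ℕ → L → ℂ), (∀ i, AnalyticAt ℂ (a i) (π q)) ∧
      (∀ᶠ x in 𝓝 q, x ∈ V → b x ^ D + ∑ i ∈ Finset.range D, a i (π x) * b x ^ i = 0) ∧
      ∀ U ∈ 𝓝 q, ∀ᶠ z in 𝓝 (π q), ∀ ρ : ℂ, ρ ^ D + ∑ i ∈ Finset.range D, a i z * ρ ^ i = 0 →
        ∃ t ∈ V ∩ U, π t = z ∧ b t = ρ := by
  obtain ⟨D, a, ha, ⟨h1, h2⟩, h3⟩ := exists_monic_lift π hπ hbot hfin hb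
  refine ⟨D, a, ha, mk_mem_germIdeal.1 (hVP ▸ h2), fun U hU => ?_⟩
  by_contra hcon
  rw [not_eventually] at hcon
  have : (𝓝 (π q) ⊓ 𝓟 {z | ¬ ∀ ρ : ℂ, ρ ^ D + ∑ i ∈ Finset.range D, a i z * ρ ^ i = 0 →
        ∃ t ∈ V ∩ U, π t = z ∧ b t = ρ}).NeBot := frequently_mem_iff_neBot.1 hcon
  let 𝒰 := Ultrafilter.of (𝓝 (π q) ⊓ 𝓟 {z | ¬ ∀ ρ : ℂ,
    ρ ^ D + ∑ i ∈ Finset.range D, a i z * ρ ^ i = 0 → ∃ t ∈ V ∩ U, π t = z ∧ b t = ρ})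
  have h𝒰 : (𝒰 : Filter L) ≤ 𝓝 (π q) := (Ultrafilter.of_le _).trans inf_le_left
  have h𝒰' : ∀ᶠ z in (𝒰 : Filter L), ∃ ρ : ℂ, ρ ^ D + ∑ i ∈ Finset.range D, a i z * ρ ^ i = 0 ∧
      ¬ ∃ t ∈ V ∩ U, π t = z ∧ b t = ρ := by
    filter_upwards [((Ultrafilter.of_le _).trans inf_le_right) (mem_principal_self _)] with z hz
    simpa using hz
  obtain ⟨ρ, hρ⟩ := h𝒰'.choice
  obtain ⟨t, ht, hπt, htP, hbt⟩ := h3 𝒰 id ρ h𝒰 (hρ.mono fun z hz => hz.1)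
  have htV : ∀ᶠ z in (𝒰 : Filter L), t z ∈ V := by
    have := hV.mem_ultrafilter (P := P) (𝒰 := 𝒰.map t) hVP.le ht fun f hf hfP =>
      (mem_ker_ev ht).1 (htP hfP)
    exact this
  obtain ⟨z, hz1, hz2, hz3, hz4⟩ := (hρ.and (htV.and (hbt.and (ht hU)))).exists
  exact hz1.2 ⟨t z, ⟨hz2, hz4⟩, hπt z, hz3⟩

/-- A monic polynomial has a root close to every point at which its value is small. -/
theorem exists_root_norm_pow_le {D : ℕ} (hD : D ≠ 0) (a : ℕ → ℂ) (w : ℂ) :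
    ∃ ρ : ℂ, ρ ^ D + ∑ i ∈ Finset.range D, a i * ρ ^ i = 0 ∧
      ‖w - ρ‖ ^ D ≤ ‖w ^ D + ∑ i ∈ Finset.range D, a i * w ^ i‖ := by
  let N : Polynomial ℂ := ∑ i ∈ Finset.range D, Polynomial.C (a i) * Polynomial.X ^ i
  let M : Polynomial ℂ := Polynomial.X ^ D + N
  have hN : N.degree < D := by
    refine (Polynomial.degree_sum_le _ _).trans_lt ((Finset.sup_lt_iff (WithBot.bot_lt_coe D)).2
      fun i hi => (Polynomial.degree_C_mul_X_pow_le i (a i)).trans_lt ?_)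
    exact WithBot.coe_lt_coe.2 (Finset.mem_range.1 hi)
  have hM : M.Monic := Polynomial.monic_X_pow_add hN
  have hMd : M.natDegree = D := by
    refine Polynomial.natDegree_eq_of_degree_eq_some ?_
    rw [Polynomial.degree_add_eq_left_of_degree_lt] <;> simp [hN]
  have heval : ∀ x, M.eval x = x ^ D + ∑ i ∈ Finset.range D, a i * x ^ i := by
    intro x
    simp [M, N, Polynomial.eval_finsetSum]
  simp only [← heval]
  have hs := IsAlgClosed.splits M
  have h1 : ‖M.eval w‖ = (M.roots.map fun ρ => ‖w - ρ‖).prod := by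
    conv_lhs => rw [hs.eq_prod_roots_of_monic hM]
    rw [Polynomial.eval_multiset_prod, Multiset.map_map]
    refine (map_multiset_prod (normHom : ℂ →*₀ ℝ) _).trans ?_
    simp
  have hcard : Multiset.card M.roots = D := by rw [← hs.natDegree_eq_card_roots, hMd]
  by_contra! hcon
  rcases (norm_nonneg (M.eval w)).eq_or_lt with h0 | h0
  · have := hcon w (norm_eq_zero.1 h0.symm)
    rw [← h0] at this
    simp [hD] at this
  have h2 : (M.roots.map fun _ => ‖M.eval w‖ ^ (D⁻¹ : ℝ)).prod <
      (M.roots.map fun ρ => ‖w - ρ‖).prod := by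
    refine Multiset.prod_map_lt_prod_map (fun h => hD ?_) _ _
      (fun _ _ => Real.rpow_pos_of_pos h0 _) fun ρ hρ => ?_
    · rw [← hcard, h, Multiset.card_zero]
    · have := hcon ρ (Polynomial.isRoot_of_mem_roots hρ)
      refine lt_of_pow_lt_pow_left₀ D (norm_nonneg _) ?_
      rwa [Real.rpow_inv_natCast_pow h0.le hD]
  rw [← h1, Multiset.map_const', Multiset.prod_replicate, hcard,
    Real.rpow_inv_natCast_pow h0.le hD] at h2
  exact h2.false

end Hol

/-- Finitely many linear forms separate every set of nonzero vectors of bounded cardinality. -/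
theorem exists_sum_mul_pow_ne_zero {N K : ℕ} (G : Finset (Fin N → ℂ)) (h0 : ∀ v ∈ G, v ≠ 0)
    (hG : G.card ≤ K) :
    ∃ c ∈ Finset.range (K * N + 1), ∀ v ∈ G, ∑ j, v j * (c : ℂ) ^ (j : ℕ) ≠ 0 := by
  classical
  let p : (Fin N → ℂ) → Polynomial ℂ := fun v => ∑ j, Polynomial.C (v j) * Polynomial.X ^ (j : ℕ)
  have hev : ∀ v x, (p v).eval x = ∑ j, v j * x ^ (j : ℕ) := fun v x => by
    simp [p, Polynomial.eval_finsetSum]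
  have hp : ∀ v ∈ G, p v ≠ 0 := by
    intro v hv hpv
    refine h0 v hv (funext fun j => ?_)
    have := congrArg (fun P => Polynomial.coeff P (j : ℕ)) hpv
    simpa [p, Polynomial.finsetSum_coeff, Polynomial.coeff_X_pow, Fin.val_inj] using this
  have hpd : ∀ v, (p v).natDegree ≤ N := fun v =>
    Polynomial.natDegree_sum_le_of_forall_le _ _ fun j _ =>
      (Polynomial.natDegree_C_mul_X_pow_le _ _).trans j.2.le
  have hd : (∏ v ∈ G, p v).natDegree ≤ K * N := by
    refine (Polynomial.natDegree_prod_le _ _).trans ((Finset.sum_le_card_nsmul _ _ N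
      fun v _ => hpd v).trans ?_)
    rw [smul_eq_mul]
    exact Nat.mul_le_mul_right _ hG
  by_contra! hcon
  refine Finset.prod_ne_zero_iff.2 hp (Polynomial.eq_zero_of_natDegree_lt_card_of_eval_eq_zero'
    (∏ v ∈ G, p v) ((Finset.range (K * N + 1)).map Nat.castEmbedding) ?_ ?_)
  · intro x hx
    obtain ⟨c, hc, rfl⟩ := Finset.mem_map.1 hx
    obtain ⟨v, hv, hvc⟩ := hcon c hc
    rw [Polynomial.eval_prod]
    exact Finset.prod_eq_zero hv ((hev v _).trans hvc)
  · rw [Finset.card_map, Finset.card_range]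
    omega

theorem IsAnalyticNear.exists_isClosed_inter_closedBall {V : Set E} {q : E}
    (hV : IsAnalyticNear V q) : ∀ᶠ r : ℝ in 𝓝[>] 0, IsClosed (V ∩ Metric.closedBall q r) := by
  obtain ⟨ε, hε, hεV⟩ := Metric.eventually_nhds_iff_ball.1 hV.eventually
  filter_upwards [Ioo_mem_nhdsGT hε] with r hr
  rw [← isOpen_compl_iff, isOpen_iff_eventually]
  intro x hx
  by_cases hxr : x ∈ Metric.closedBall q r
  · have hxV : x ∉ V := fun h => hx ⟨h, hxr⟩
    filter_upwards [(hεV x (Metric.closedBall_subset_ball hr.2 hxr)).isClosed_near hxV] with y hy h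
    exact hy h.1
  · filter_upwards [Metric.isClosed_closedBall.isOpen_compl.mem_nhds hxr] with y hy h
    exact hy h.2

theorem exists_finset_roots (D : ℕ) (a : ℕ → ℂ) : ∃ R : Finset ℂ, R.card ≤ D ∧
    ∀ w, w ^ D + ∑ i ∈ Finset.range D, a i * w ^ i = 0 → w ∈ R := by
  classical
  let N : Polynomial ℂ := ∑ i ∈ Finset.range D, Polynomial.C (a i) * Polynomial.X ^ i
  have hN : N.degree < D := by
    refine (Polynomial.degree_sum_le _ _).trans_lt ((Finset.sup_lt_iff (WithBot.bot_lt_coe D)).2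
      fun i hi => (Polynomial.degree_C_mul_X_pow_le i (a i)).trans_lt ?_)
    exact WithBot.coe_lt_coe.2 (Finset.mem_range.1 hi)
  have hM : (Polynomial.X ^ D + N).Monic := Polynomial.monic_X_pow_add hN
  have hMd : (Polynomial.X ^ D + N).natDegree = D := by
    refine Polynomial.natDegree_eq_of_degree_eq_some ?_
    rw [Polynomial.degree_add_eq_left_of_degree_lt] <;> simp [hN]
  refine ⟨(Polynomial.X ^ D + N).roots.toFinset, ?_, fun w hw => ?_⟩
  · exact (Multiset.toFinset_card_le _).trans ((Polynomial.card_roots' _).trans hMd.le)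
  · rw [Multiset.mem_toFinset, Polynomial.mem_roots hM.ne_zero, Polynomial.IsRoot]
    simpa [N, Polynomial.eval_finsetSum] using hw

namespace Hol

variable {L : Type*} [NormedAddCommGroup L] [NormedSpace ℂ L] {q : E}

theorem eventually_image_mem_nhds [FiniteDimensional ℂ E] [FiniteDimensional ℂ L]
    {P : Ideal (Hol q)} [P.IsPrime] (π : E →L[ℂ] L) (hπ : Function.Surjective π)
    (hbot : P.comap (lpull π (rfl : π q = π q)) = ⊥)
    (hfin : ((Ideal.Quotient.mk P).comp (lpull π (rfl : π q = π q))).Finite)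
    {V : Set E} (hV : IsAnalyticNear V q) (hVP : germIdeal V q = P) :
    ∀ᶠ e in 𝓝 q, e ∈ V → ∀ U ∈ 𝓝 e, π '' (V ∩ U) ∈ 𝓝 (π e) := by
  classical
  set N := Module.finrank ℂ E
  let B := Module.finBasis ℂ E
  let x : Fin N → E →L[ℂ] ℂ :=
    fun j => LinearMap.toContinuousLinearMap (B.coord j)
  let ℓ : ℕ → E →L[ℂ] ℂ := fun c => ∑ j : Fin N, (c : ℂ) ^ (j : ℕ) • x j
  choose D a ha haV hlift using fun c =>
    exists_monic_lift_eventually π hπ hbot hfin hV hVP ((ℓ c).analyticAt q)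
  choose D' a' ha' haV' hlift' using fun j =>
    exists_monic_lift_eventually π hπ hbot hfin hV hVP ((x j).analyticAt q)
  let K := ∏ j, D' j
  let C := Finset.range (K * N + 1)
  have hx' : ∀ᶠ e in 𝓝 q, e ∈ V → ∀ j,
      x j e ^ D' j + ∑ i ∈ Finset.range (D' j), a' j i (π e) * x j e ^ i = 0 := by
    filter_upwards [eventually_all.2 haV'] with e he hV j using he j hV
  obtain ⟨r, hr1, hr2, hr⟩ := (hV.exists_isClosed_inter_closedBall.and
    ((Metric.nhds_basis_closedBall.eventually_iff.1 hx').elim fun ε hε =>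
      (show ∀ᶠ r : ℝ in 𝓝[>] 0, (∀ e ∈ Metric.closedBall q r, e ∈ V → ∀ j,
        x j e ^ D' j + ∑ i ∈ Finset.range (D' j), a' j i (π e) * x j e ^ i = 0) from by
        filter_upwards [Ioo_mem_nhdsGT hε.1] with r hr e he
        exact hε.2 (Metric.closedBall_subset_closedBall hr.2.le he)) |>.and
          self_mem_nhdsWithin)).exists
  have hπc : Tendsto π (𝓝 q) (𝓝 (π q)) := π.continuous.continuousAt
  have hlift1 : ∀ᶠ e in 𝓝 q, ∀ c ∈ C, ∀ᶠ z in 𝓝 (π e), ∀ ρ : ℂ,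
      ρ ^ D c + ∑ i ∈ Finset.range (D c), a c i z * ρ ^ i = 0 →
        ∃ t ∈ V ∩ Metric.closedBall q r, π t = z ∧ ℓ c t = ρ :=
    (Finset.eventually_all C).2 fun c _ => hπc.eventually
      (hlift c _ (Metric.closedBall_mem_nhds q hr)).eventually_nhds
  have ha1 : ∀ᶠ e in 𝓝 q, ∀ c ∈ C, ∀ i ∈ Finset.range (D c), ContinuousAt (a c i) (π e) :=
    (Finset.eventually_all C).2 fun c _ => (Finset.eventually_all _).2 fun i _ =>
      hπc.eventually ((ha c i).eventually_analyticAt.mono fun z hz => hz.continuousAt)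
  have haV1 := (Finset.eventually_all C).2 fun c _ => haV c
  filter_upwards [hlift1, ha1, haV1, Metric.closedBall_mem_nhds q hr] with e hl hac hM her heV U hU
  have hD' : ∀ j, D' j ≠ 0 := by
    intro j h
    have := hr2 e her heV j
    rw [h] at this
    simp at this
  choose R hRc hR using fun j => exists_finset_roots (D' j) fun i => a' j i (π e)
  obtain ⟨c, hc, hsep⟩ := exists_sum_mul_pow_ne_zero (K := K)
    (((Fintype.piFinset R).image fun v => v - fun j => x j e).erase 0)
    (fun v hv => (Finset.mem_erase.1 hv).1) (by
      refine (Finset.card_erase_le).trans (Finset.card_image_le.trans ?_)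
      rw [Fintype.card_piFinset]
      exact Finset.prod_le_prod' fun j _ => hRc j)
  have hsep' : ∀ t ∈ V ∩ Metric.closedBall q r, π t = π e → ℓ c t = ℓ c e → t = e := by
    intro t ht htπ htc
    by_contra hte
    refine hsep (fun j => x j t - x j e) (Finset.mem_erase.2 ⟨fun h => hte ?_,
      Finset.mem_image.2 ⟨fun j => x j t, Fintype.mem_piFinset.2 fun j => hR j _ ?_, rfl⟩⟩) ?_
    · exact B.ext_elem fun j => sub_eq_zero.1 (congrFun h j)
    · rw [← htπ]
      exact hr2 t ht.2 ht.1 j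
    · rw [← sub_eq_zero.2 htc]
      simp [ℓ, mul_comm, mul_sub, Finset.sum_sub_distrib]
  have hDc : D c ≠ 0 := by
    intro h
    have := hM c hc heV
    rw [h] at this
    simp at this
  choose ρ hρ hρn using fun z => exists_root_norm_pow_le hDc (fun i => a c i z) (ℓ c e)
  obtain ⟨t, ht⟩ := ((hl c hc).mono fun z hz => hz (ρ z) (hρ z)).choice
  have hℓt : Tendsto (fun z => ℓ c (t z)) (𝓝 (π e)) (𝓝 (ℓ c e)) := by
    have h1 : Tendsto (fun z => ‖ℓ c e ^ D c + ∑ i ∈ Finset.range (D c), a c i z * ℓ c e ^ i‖)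
        (𝓝 (π e)) (𝓝 0) := by
      have : Tendsto (fun z => ‖ℓ c e ^ D c + ∑ i ∈ Finset.range (D c), a c i z * ℓ c e ^ i‖)
        (𝓝 (π e)) (𝓝 ‖ℓ c e ^ D c + ∑ i ∈ Finset.range (D c), a c i (π e) * ℓ c e ^ i‖) :=
        (tendsto_const_nhds.add (tendsto_finsetSum _ fun i hi =>
          (hac c hc i hi).tendsto.mul_const _)).norm
      rwa [hM c hc heV, norm_zero] at this
    rw [tendsto_iff_norm_sub_tendsto_zero]
    have h2 : Tendsto (fun z => ‖ℓ c (t z) - ℓ c e‖ ^ D c) (𝓝 (π e)) (𝓝 0) := by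
      refine squeeze_zero' (Eventually.of_forall fun z => by positivity) ?_ h1
      filter_upwards [ht] with z hz
      rw [hz.2.2, norm_sub_rev]
      exact hρn z
    have h3 := h2.rpow_const (p := (D c : ℝ)⁻¹) (Or.inr (by positivity))
    rw [Real.zero_rpow (by simpa using hDc)] at h3
    exact h3.congr fun z => Real.pow_rpow_inv_natCast (norm_nonneg _) hDc
  by_contra hcon
  have hne : (𝓝 (π e) ⊓ 𝓟 (π '' (V ∩ U))ᶜ).NeBot := by
    rwa [neBot_iff, Ne, inf_principal_eq_bot, compl_compl]
  let 𝒲 := Ultrafilter.of (𝓝 (π e) ⊓ 𝓟 (π '' (V ∩ U))ᶜ)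
  have h𝒲 : (𝒲 : Filter L) ≤ 𝓝 (π e) := (Ultrafilter.of_le _).trans inf_le_left
  have h𝒲' : ∀ᶠ z in (𝒲 : Filter L), z ∉ π '' (V ∩ U) :=
    ((Ultrafilter.of_le _).trans inf_le_right) (mem_principal_self _)
  have hcomp : IsCompact (V ∩ Metric.closedBall q r) := by
    have := FiniteDimensional.proper ℂ E
    exact (isCompact_closedBall q r).of_isClosed_subset hr1 Set.inter_subset_right
  obtain ⟨t0, ht0, ht0'⟩ := hcomp.ultrafilter_le_nhds (𝒲.map t) (by
    rw [le_principal_iff]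
    exact h𝒲 (ht.mono fun z hz => hz.1))
  have ht0'' : Tendsto t 𝒲 (𝓝 t0) := ht0'
  have h1 : π t0 = π e := by
    refine tendsto_nhds_unique ((π.continuous.tendsto t0).comp ht0'') (Tendsto.congr' ?_ h𝒲)
    filter_upwards [h𝒲 ht] with z hz using hz.2.1.symm
  have h2 : ℓ c t0 = ℓ c e :=
    tendsto_nhds_unique (((ℓ c).continuous.tendsto t0).comp ht0'') (hℓt.mono_left h𝒲)
  rw [hsep' t0 ht0 h1 h2] at ht0''
  obtain ⟨z, hz1, hz2, hz3⟩ := ((ht.filter_mono h𝒲).and (h𝒲'.and (ht0'' hU))).exists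
  exact hz2 ⟨t z, ⟨hz1.1.1, hz3⟩, hz1.2.1⟩

end Hol

theorem Ideal.exists_notMem_mul_mem_radical {R : Type*} [CommRing R] [IsNoetherianRing R]
    {I P : Ideal R} (hP : P ∈ I.minimalPrimes) :
    ∃ g ∉ P, (∀ f ∈ P, f * g ∈ I.radical) ∧ ∀ Q ∈ I.minimalPrimes, Q ≠ P → g ∈ Q := by
  classical
  let S := (I.finite_minimalPrimes_of_isNoetherianRing R).toFinset.erase P
  have h1 : ¬ S.inf id ≤ P := by
    rw [hP.1.1.inf_le']
    rintro ⟨Q, hQ, hQP⟩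
    obtain ⟨hne, hQm⟩ := Finset.mem_erase.1 hQ
    rw [Set.Finite.mem_toFinset] at hQm
    exact hne (le_antisymm hQP (hP.2 hQm.1 hQP))
  obtain ⟨g, hg, hgP⟩ := SetLike.not_le_iff_exists.1 h1
  have h2 : ∀ Q ∈ I.minimalPrimes, Q ≠ P → g ∈ Q := fun Q hQ hne =>
    Finset.inf_le (f := id) (Finset.mem_erase.2 ⟨hne, (Set.Finite.mem_toFinset _).2 hQ⟩) hg
  refine ⟨g, hgP, fun f hf => ?_, h2⟩
  rw [← I.sInf_minimalPrimes, Ideal.mem_sInf]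
  intro Q hQ
  by_cases hne : Q = P
  · exact hne ▸ Ideal.mul_mem_right _ _ hf
  · exact Ideal.mul_mem_left _ _ (h2 Q hQ hne)

/-- The identity theorem near a point. -/
theorem AnalyticAt.eventually_eq_zero_of_frequently {a : E → ℂ} {z : E} (ha : AnalyticAt ℂ a z)
    (h : ∃ᶠ w in 𝓝 z, ∀ᶠ x in 𝓝 w, a x = 0) : ∀ᶠ x in 𝓝 z, a x = 0 := by
  obtain ⟨ε, hε, hεa⟩ := Metric.eventually_nhds_iff_ball.1 ha.eventually_analyticAt
  obtain ⟨w, hw, hwε⟩ := (h.and_eventually (Metric.ball_mem_nhds z hε)).exists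
  filter_upwards [Metric.ball_mem_nhds z hε] with x hx
  exact AnalyticOnNhd.eqOn_zero_of_preconnected_of_eventuallyEq_zero (fun x hx => hεa x hx)
    ((convex_ball z ε).isPreconnected) hwε hw hx

namespace Hol

variable {L : Type*} [NormedAddCommGroup L] [NormedSpace ℂ L] {q : E} {V : Set E}

/-- A linear projection with isolated fibre is finite on the local ring of an analytic set. -/
theorem finite_of_isolated_fiber [FiniteDimensional ℂ E] [FiniteDimensional ℂ L]
    (hV : IsAnalyticNear V q) (π : E →L[ℂ] L)
    (h : ∀ᶠ x in 𝓝 q, x ∈ V → π x = π q → x = q) :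
    ((Ideal.Quotient.mk (germIdeal V q)).comp (lpull π (rfl : π q = π q))).Finite := by
  refine finite_of_isolated π rfl fun Q hQ hVQ hm => ?_
  obtain ⟨𝒰, h𝒰, hQ𝒰⟩ := exists_ultrafilter Q
  have h1 : ∀ᶠ x in (𝒰 : Filter E), x ∈ V :=
    hV.mem_ultrafilter hVQ h𝒰 fun f hf hfQ => (hQ𝒰 f hf).1 hfQ
  let B := Module.finBasis ℂ L
  have h2 : ∀ᶠ x in (𝒰 : Filter E), ∀ j, B.coord j (π x) - B.coord j (π q) = 0 := by
    refine eventually_all.2 fun j => ?_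
    have ha : AnalyticAt ℂ (fun y => B.coord j y - B.coord j (π q)) (π q) :=
      ((LinearMap.toContinuousLinearMap (B.coord j)).analyticAt _).sub analyticAt_const
    refine (hQ𝒰 (fun x => B.coord j (π x) - B.coord j (π q))
      (AnalyticAt.comp_of_eq ha (π.analyticAt q) rfl)).1 (hm ?_)
    refine Ideal.mem_map_of_mem (lpull π (rfl : π q = π q)) (x := mk _ ha) ?_
    rw [mem_maximalIdeal, val_mk, sub_self]
  intro a ha
  obtain ⟨f, hf, rfl⟩ := exists_rep a
  rw [mem_maximalIdeal, val_mk] at ha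
  rw [hQ𝒰 f hf]
  filter_upwards [h1, h2, h𝒰 h] with x hx1 hx2 hx3
  rw [hx3 hx1 (B.ext_elem fun j => sub_eq_zero.1 (hx2 j)), ha]

theorem eventually_isolated_fiber [FiniteDimensional ℂ E] [FiniteDimensional ℂ L]
    {P : Ideal (Hol q)} [P.IsPrime] (π : E →L[ℂ] L) (hπ : Function.Surjective π)
    (hbot : P.comap (lpull π (rfl : π q = π q)) = ⊥)
    (hfin : ((Ideal.Quotient.mk P).comp (lpull π (rfl : π q = π q))).Finite)
    (hV : IsAnalyticNear V q) (hVP : germIdeal V q = P) :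
    ∀ᶠ e in 𝓝 q, e ∈ V → ∀ᶠ x in 𝓝 e, x ∈ V → π x = π e → x = e := by
  let B := Module.finBasis ℂ E
  let x : Fin (Module.finrank ℂ E) → E →L[ℂ] ℂ :=
    fun j => LinearMap.toContinuousLinearMap (B.coord j)
  choose D a ha haV hlift using fun j =>
    exists_monic_lift_eventually π hπ hbot hfin hV hVP ((x j).analyticAt q)
  filter_upwards [(eventually_all.2 haV).eventually_nhds] with e he heV
  have hD : ∀ j, D j ≠ 0 := by
    intro j h
    have := he.self_of_nhds j heV
    rw [h] at this
    simp at this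
  choose R hRc hR using fun j => exists_finset_roots (D j) fun i => a j i (π e)
  have h1 : ∀ᶠ t in 𝓝 e, ∀ j, x j t ∈ R j → x j t = x j e := by
    refine eventually_all.2 fun j => ?_
    have : ((R j : Set ℂ) \ {x j e})ᶜ ∈ 𝓝 (x j e) :=
      ((R j).finite_toSet.subset Set.sdiff_subset).isClosed.isOpen_compl.mem_nhds (by simp)
    filter_upwards [(x j).continuous.continuousAt this] with t ht htR
    by_contra hne
    exact ht ⟨htR, hne⟩
  filter_upwards [he, h1] with t ht ht1 htV htπ
  exact B.ext_elem fun j => ht1 j (hR j _ (htπ ▸ ht j htV))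

theorem eventually_comap_minimalPrimes_eq_bot [FiniteDimensional ℂ E] [FiniteDimensional ℂ L]
    {P : Ideal (Hol q)} [P.IsPrime] (π : E →L[ℂ] L) (hπ : Function.Surjective π)
    (hbot : P.comap (lpull π (rfl : π q = π q)) = ⊥)
    (hfin : ((Ideal.Quotient.mk P).comp (lpull π (rfl : π q = π q))).Finite)
    (hV : IsAnalyticNear V q) (hVP : germIdeal V q = P) :
    ∀ᶠ e in 𝓝 q, ∀ P' ∈ (germIdeal V e).minimalPrimes,
      P'.comap (lpull π (rfl : π e = π e)) = ⊥ := by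
  filter_upwards [(eventually_image_mem_nhds π hπ hbot hfin hV hVP).eventually_nhds,
    hV.eventually] with e he hVe P' hP'
  rw [eq_bot_iff]
  intro a ha
  obtain ⟨a, haa, rfl⟩ := exists_rep a
  rw [Ideal.mem_comap, pull_mk] at ha
  obtain ⟨g, hgP, hg, -⟩ := Ideal.exists_notMem_mul_mem_radical hP'
  obtain ⟨g, hga, rfl⟩ := exists_rep g
  have := hP'.1.1
  obtain ⟨𝒰, h𝒰, hQ𝒰⟩ := exists_ultrafilter P'
  have h1 : ∀ᶠ x in (𝒰 : Filter E), x ∈ V :=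
    hVe.mem_ultrafilter hP'.1.2 h𝒰 fun f hf hfQ => (hQ𝒰 f hf).1 hfQ
  rw [hQ𝒰, ← Ultrafilter.eventually_not] at hgP
  have h2 := hg _ ha
  rw [(germIdeal_isRadical V e).radical, mk_mul, mk_mem_germIdeal] at h2
  refine (Submodule.mem_bot _).2 (mk_eq_zero.2 (haa.eventually_eq_zero_of_frequently ?_))
  have h3 : ∀ᶠ x in (𝒰 : Filter E), ∀ᶠ y in 𝓝 (π x), a y = 0 := by
    filter_upwards [h1, hgP, h𝒰 he, h𝒰 h2.eventually_nhds,
      h𝒰 hga.eventually_analyticAt] with x hxV hgx hx1 hx2 hx3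
    filter_upwards [hx1 hxV _ ((hx3.continuousAt.eventually_ne hgx).and hx2)]
    rintro _ ⟨y, ⟨hyV, hy1, hy2⟩, rfl⟩
    exact (mul_eq_zero.1 (hy2 hyV)).resolve_right hy1
  exact ((π.continuous.tendsto e).mono_left h𝒰).frequently h3.frequently

theorem eventually_notMem_minimalPrimes [FiniteDimensional ℂ E] {P : Ideal (Hol q)} [P.IsPrime]
    (hV : IsAnalyticNear V q) (hVP : germIdeal V q = P) {h : E → ℂ} (ha : AnalyticAt ℂ h q)
    (hP : mk h ha ∉ P) :
    ∀ᶠ e in 𝓝 q, ∀ P' ∈ (germIdeal V e).minimalPrimes, ∀ hae, mk h hae ∉ P' := by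
  obtain ⟨k, π, hπ, hbot, hfin⟩ := exists_noether_normalization P
  obtain ⟨a, ha0, u, hau⟩ : ∃ a : Hol (π q), a ≠ 0 ∧ ∃ u,
      lpull π (rfl : π q = π q) a - mk h ha * u ∈ P := by
    let φ := (Ideal.Quotient.mk P).comp (lpull π (rfl : π q = π q))
    let := φ.toAlgebra
    have h1 := Ideal.comap_ne_bot_of_integral_mem (R := Hol (π q)) (S := Hol q ⧸ P)
      (I := Ideal.span {Ideal.Quotient.mk P (mk h ha)}) (x := Ideal.Quotient.mk P (mk h ha))
      (by rwa [Ne, Ideal.Quotient.eq_zero_iff_mem]) (Ideal.mem_span_singleton_self _)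
      (hfin.to_isIntegral _)
    obtain ⟨a, ha1, ha0⟩ := Submodule.exists_mem_ne_zero_of_ne_bot h1
    obtain ⟨u, hu⟩ := Ideal.mem_span_singleton'.1 ha1
    obtain ⟨u, rfl⟩ := Ideal.Quotient.mk_surjective u
    refine ⟨a, ha0, u, ?_⟩
    rw [← Ideal.Quotient.eq, map_mul, mul_comm, hu]
    rfl
  obtain ⟨a, haa, rfl⟩ := exists_rep a
  obtain ⟨u, hu, rfl⟩ := exists_rep u
  have hrel : ∀ᶠ x in 𝓝 q, x ∈ V → a (π x) - h x * u x = 0 := by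
    rw [← hVP] at hau
    exact (mk_mem_germIdeal (hf := (AnalyticAt.comp_of_eq haa (π.analyticAt q) rfl).sub
      (AnalyticAt.mul ha hu))).1 hau
  have hπc : Tendsto π (𝓝 q) (𝓝 (π q)) := π.continuous.tendsto q
  have hane : ∀ᶠ e in 𝓝 q, ¬ ∀ᶠ y in 𝓝 (π e), a y = 0 := by
    refine hπc.eventually (p := fun z => ¬ ∀ᶠ y in 𝓝 z, a y = 0) ?_
    by_contra hcon
    rw [not_eventually] at hcon
    simp only [not_not] at hcon
    exact ha0 (mk_eq_zero.2 (haa.eventually_eq_zero_of_frequently hcon))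
  filter_upwards [eventually_comap_minimalPrimes_eq_bot π hπ hbot hfin hV hVP, hane,
    hrel.eventually_nhds, hu.eventually_analyticAt, hπc.eventually haa.eventually_analyticAt]
    with e he hane hrel hu haa P' hP' hae hmem
  refine hane ((mk_eq_zero (hf := haa)).1 ?_)
  rw [← Submodule.mem_bot (R := Hol (π e)), ← he P' hP', Ideal.mem_comap, pull_mk]
  have h1 : mk _ ((AnalyticAt.comp_of_eq haa (π.analyticAt e) rfl).sub (hae.mul hu)) ∈ P' :=
    hP'.1.2 (mk_mem_germIdeal.2 hrel)
  have h2 := P'.add_mem h1 (P'.mul_mem_right (mk u hu) hmem)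
  convert! h2 using 1
  rw [mk_mul, mk_add, mk_eq_mk]
  filter_upwards with x
  simp

theorem eventually_ringKrullDim_minimalPrimes [FiniteDimensional ℂ E] {P : Ideal (Hol q)}
    [P.IsPrime] (hV : IsAnalyticNear V q) (hVP : germIdeal V q = P) :
    ∀ᶠ e in 𝓝 q, e ∈ V → ∀ P' ∈ (germIdeal V e).minimalPrimes,
      ringKrullDim (Hol e ⧸ P') = ringKrullDim (Hol q ⧸ P) := by
  obtain ⟨k, π, hπ, hbot, hfin⟩ := exists_noether_normalization P
  have key : ∀ {e : E} {P' : Ideal (Hol e)}, P'.comap (lpull π (rfl : π e = π e)) = ⊥ →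
      ((Ideal.Quotient.mk P').comp (lpull π (rfl : π e = π e))).Finite →
      ringKrullDim (Hol e ⧸ P') = k := by
    intro e P' h1 h2
    rw [h2.to_isIntegral.ringKrullDim_eq, Hol.ringKrullDim_eq, Module.finrank_fin_fun]
    rw [RingHom.injective_iff_ker_eq_bot, ← RingHom.comap_ker, Ideal.mk_ker, h1]
  filter_upwards [eventually_comap_minimalPrimes_eq_bot π hπ hbot hfin hV hVP,
    eventually_isolated_fiber π hπ hbot hfin hV hVP, hV.eventually] with e he1 he2 hVe heV P' hP'
  rw [key hbot hfin, key (he1 P' hP')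
    ((finite_of_isolated_fiber hVe π (he2 heV)).quotientMk_of_le hP'.1.2)]

end Hol

open Hol

section Decomposition

variable {V W B : Set E} {q : E}

theorem germIdeal_union : germIdeal (V ∪ W) q = germIdeal V q ⊓ germIdeal W q := by
  refine le_antisymm (le_inf (germIdeal_anti (Eventually.of_forall fun x => Or.inl))
    (germIdeal_anti (Eventually.of_forall fun x => Or.inr))) fun a ha => ?_
  obtain ⟨f, hf, rfl⟩ := exists_rep a
  have h1 := mk_mem_germIdeal.1 ha.1
  have h2 := mk_mem_germIdeal.1 ha.2
  refine mk_mem_germIdeal.2 ?_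
  filter_upwards [h1, h2] with x h1 h2 hx using hx.elim h1 h2

theorem germIdeal_biUnion {ι : Type*} (s : Finset ι) (V : ι → Set E) :
    germIdeal (⋃ i ∈ s, V i) q = s.inf fun i => germIdeal (V i) q := by
  classical
  induction s using Finset.induction_on with
  | empty => simpa using germIdeal_eq_top (by simp)
  | insert a s ha ih => rw [Finset.set_biUnion_insert, germIdeal_union, ih, Finset.inf_insert]

theorem germIdeal_congr (h : ∀ᶠ x in 𝓝 q, x ∈ V ↔ x ∈ W) : germIdeal V q = germIdeal W q :=
  le_antisymm (germIdeal_anti (h.mono fun _ hx => hx.2)) (germIdeal_anti (h.mono fun _ hx => hx.1))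

theorem exists_minimalPrimes_germIdeal {e : E} (he : e ∈ V) :
    ∃ P, P ∈ (germIdeal V e).minimalPrimes := by
  obtain ⟨M, hM, hVM⟩ := Ideal.exists_le_maximal _ (germIdeal_ne_top he)
  obtain ⟨P, hP, -⟩ := Ideal.exists_minimalPrimes_le hVM
  exact ⟨P, hP⟩

variable [FiniteDimensional ℂ E]

/-- A representative near `q` of the zero locus of an ideal. -/
noncomputable def germLocus (I : Ideal (Hol q)) : Set E := (exists_isAnalyticNear I).choose

theorem isAnalyticNear_germLocus (I : Ideal (Hol q)) : IsAnalyticNear (germLocus I) q :=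
  (exists_isAnalyticNear I).choose_spec.1

theorem germIdeal_germLocus (P : Ideal (Hol q)) [hP : P.IsPrime] :
    germIdeal (germLocus P) q = P :=
  (exists_isAnalyticNear P).choose_spec.2.trans hP.isRadical.radical

theorem IsAnalyticNear.eventually_mem_iff (hV : IsAnalyticNear V q) :
    ∀ᶠ x in 𝓝 q, x ∈ V ↔ ∃ P ∈ (germIdeal V q).minimalPrimes, x ∈ germLocus P := by
  let S := ((germIdeal V q).finite_minimalPrimes_of_isNoetherianRing (Hol q)).toFinset
  have h1 : germIdeal (⋃ P ∈ S, germLocus P) q = germIdeal V q := by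
    rw [germIdeal_biUnion, ← (germIdeal_isRadical V q).radical, ← Ideal.sInf_minimalPrimes]
    refine le_antisymm (le_sInf fun P hP => ?_) (Finset.le_inf fun P hP => ?_)
    · have := hP.1.1
      exact (Finset.inf_le ((Set.Finite.mem_toFinset _).2 hP)).trans (germIdeal_germLocus P).le
    · rw [Set.Finite.mem_toFinset] at hP
      have := hP.1.1
      rw [germIdeal_germLocus P]
      exact sInf_le hP
  filter_upwards [hV.eventually_subset h1.ge,
    (IsAnalyticNear.biUnion S fun P _ => isAnalyticNear_germLocus P).eventually_subset h1.le]
    with x hx1 hx2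
  have : x ∈ ⋃ P ∈ S, germLocus P ↔ ∃ P ∈ (germIdeal V q).minimalPrimes, x ∈ germLocus P := by
    simp [S]
  exact Iff.trans ⟨hx2, hx1⟩ this

/-- An analytic germ propagates inclusions from its center to a neighbourhood of uniform size. -/
theorem IsAnalyticNear.exists_uniform_of_isPrime {P : Ideal (Hol q)} [P.IsPrime]
    (hV : IsAnalyticNear V q) (hVP : germIdeal V q = P) {Ω : Set E} (hΩ : Ω ∈ 𝓝 q) :
    ∃ U ∈ 𝓝 q, ∀ B : Set E, (∀ e ∈ Ω, IsAnalyticNear B e) → (∀ᶠ x in 𝓝 q, x ∈ V → x ∈ B) →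
      ∀ x ∈ U, x ∈ V → x ∈ B := by
  obtain ⟨k, π, hπ, hbot, hfin⟩ := exists_noether_normalization P
  have hqV : q ∈ V := by
    by_contra hqV
    exact Ideal.IsPrime.ne_top' (I := P) (hVP.symm.trans (germIdeal_eq_top (hV.isClosed_near hqV)))
  have hiso := eventually_isolated_fiber π hπ hbot hfin hV hVP
  have hgood : ∀ᶠ e in 𝓝 q, e ∈ Ω ∧ IsAnalyticNear V e ∧
      (∀ P' ∈ (germIdeal V e).minimalPrimes, P'.comap (lpull π (rfl : π e = π e)) = ⊥) ∧
      (e ∈ V → ∀ᶠ x in 𝓝 e, x ∈ V → π x = π e → x = e) ∧ (e ∈ V → π e = π q → e = q) :=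
    (show ∀ᶠ e in 𝓝 q, e ∈ Ω from hΩ).and (hV.eventually.and
      ((eventually_comap_minimalPrimes_eq_bot π hπ hbot hfin hV hVP).and
      (hiso.and (hiso.self_of_nhds hqV))))
  obtain ⟨r, hVc, hN, hr⟩ := (hV.exists_isClosed_inter_closedBall.and
    ((Metric.nhds_basis_closedBall.eventually_iff.1 hgood).elim fun ε hε =>
      (show ∀ᶠ r : ℝ in 𝓝[>] 0, (∀ e ∈ Metric.closedBall q r, e ∈ Ω ∧ IsAnalyticNear V e ∧
      (∀ P' ∈ (germIdeal V e).minimalPrimes, P'.comap (lpull π (rfl : π e = π e)) = ⊥) ∧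
      (e ∈ V → ∀ᶠ x in 𝓝 e, x ∈ V → π x = π e → x = e) ∧ (e ∈ V → π e = π q → e = q)) from by
        filter_upwards [Ioo_mem_nhdsGT hε.1] with r hr e he
        exact hε.2 (Metric.closedBall_subset_closedBall hr.2.le he)) |>.and
          self_mem_nhdsWithin)).exists
  have hprop := FiniteDimensional.proper ℂ E
  have hcomp : IsCompact (V ∩ Metric.closedBall q r) :=
    (isCompact_closedBall q r).of_isClosed_subset hVc Set.inter_subset_right
  obtain ⟨δ, hδ, hδV⟩ : ∃ δ > 0, ∀ e ∈ V ∩ Metric.closedBall q r,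
      π e ∈ Metric.ball (π q) δ → e ∈ Metric.ball q r := by
    have h1 : IsClosed (π '' ((V ∩ Metric.closedBall q r) ∩ (Metric.ball q r)ᶜ)) :=
      ((hcomp.inter_right Metric.isOpen_ball.isClosed_compl).image π.continuous).isClosed
    have h2 : (π '' ((V ∩ Metric.closedBall q r) ∩ (Metric.ball q r)ᶜ))ᶜ ∈ 𝓝 (π q) := by
      refine h1.isOpen_compl.mem_nhds ?_
      rintro ⟨e, ⟨⟨heV, heN⟩, her⟩, he⟩
      rw [(hN e heN).2.2.2.2 heV he] at her
      exact her (Metric.mem_ball_self hr)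
    obtain ⟨δ, hδ, h3⟩ := Metric.mem_nhds_iff.1 h2
    refine ⟨δ, hδ, fun e he heδ => ?_⟩
    by_contra her
    exact h3 heδ ⟨e, ⟨he, her⟩, rfl⟩
  refine ⟨Metric.ball q r ∩ π ⁻¹' Metric.ball (π q) δ, inter_mem (Metric.ball_mem_nhds q hr)
    (π.continuous.continuousAt (Metric.ball_mem_nhds _ hδ)), fun B hB hqB => ?_⟩
  let T : Set E := V ∩ Metric.closedBall q r ∩ {e | ∀ᶠ x in 𝓝 e, x ∈ V → x ∈ B}ᶜ
  have hT : IsCompact T := hcomp.inter_right (isOpen_setOfPred_eventually_nhds).isClosed_compl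
  have hqT : π q ∉ π '' T := by
    rintro ⟨e, ⟨⟨heV, heN⟩, heB⟩, he⟩
    rw [(hN e heN).2.2.2.2 heV he] at heB
    exact heB hqB
  have hTo : IsOpen (π '' T ∩ Metric.ball (π q) δ) := by
    rw [isOpen_iff_mem_nhds]
    rintro _ ⟨⟨e, ⟨⟨heV, heN⟩, heB⟩, rfl⟩, heδ⟩
    obtain ⟨heΩ, hVe, hcomap, hisoe, -⟩ := hN e heN
    have h1 : ¬ germIdeal B e ≤ germIdeal V e := fun h => heB ((hB e heΩ).eventually_subset h)
    obtain ⟨b, hbB, hbV⟩ := SetLike.not_le_iff_exists.1 h1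
    rw [← (germIdeal_isRadical V e).radical, ← Ideal.sInf_minimalPrimes, Ideal.mem_sInf] at hbV
    push Not at hbV
    obtain ⟨P', hP', hbP'⟩ := hbV
    have := hP'.1.1
    obtain ⟨b, hb, rfl⟩ := exists_rep b
    have hV' := isAnalyticNear_germLocus P'
    have hVP' := germIdeal_germLocus P'
    have hsub : ∀ᶠ x in 𝓝 e, x ∈ germLocus P' → x ∈ V :=
      hVe.eventually_subset (hP'.1.2.trans hVP'.ge)
    have hopen := eventually_image_mem_nhds π hπ (hcomap P' hP')
      ((finite_of_isolated_fiber hVe π (hisoe heV)).quotientMk_of_le hP'.1.2) hV' hVP'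
    have heV' : e ∈ germLocus P' := by
      by_contra h
      exact Ideal.IsPrime.ne_top' (I := P') (hVP'.symm.trans
        (germIdeal_eq_top (hV'.isClosed_near h)))
    have hnhds : ∀ᶠ x in 𝓝 e, x ∈ germLocus P' → x ∈ V ∧ ¬ ∀ᶠ y in 𝓝 x, y ∈ V → y ∈ B := by
      filter_upwards [hsub.eventually_nhds, (mk_mem_germIdeal.1 hbB).eventually_nhds,
        eventually_notMem_minimalPrimes hV' hVP' hb hbP', hb.eventually_analyticAt]
        with x hx1 hx2 hx3 hx4 hxV'
      refine ⟨hx1.self_of_nhds hxV', fun hxB => ?_⟩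
      obtain ⟨P'', hP''⟩ := exists_minimalPrimes_germIdeal hxV'
      refine hx3 P'' hP'' hx4 (hP''.1.2 (mk_mem_germIdeal.2 ?_))
      filter_upwards [hx1, hx2, hxB] with y hy1 hy2 hy3 hy using hy2 (hy3 (hy1 hy))
    refine inter_mem (mem_of_superset (hopen.self_of_nhds heV' _ (inter_mem hnhds
      (Metric.isOpen_ball.mem_nhds (hδV e ⟨heV, heN⟩ heδ)))) ?_)
      (Metric.isOpen_ball.mem_nhds heδ)
    rintro _ ⟨x, ⟨hxV', hx, hxr⟩, rfl⟩
    exact ⟨x, ⟨⟨(hx hxV').1, Metric.ball_subset_closedBall hxr⟩, (hx hxV').2⟩, rfl⟩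
  have hΔ : Metric.ball (π q) δ ⊆ (π '' T)ᶜ := by
    refine (convex_ball (π q) δ).isPreconnected.subset_left_of_subset_union
      (hT.image π.continuous).isClosed.isOpen_compl hTo ?_ ?_ ⟨π q, Metric.mem_ball_self hδ, hqT⟩
    · exact Set.disjoint_left.2 fun z hz hz' => hz hz'.1
    · intro z hz
      by_cases hzT : z ∈ π '' T
      exacts [Or.inr ⟨hzT, hz⟩, Or.inl hzT]
  intro x hx hxV
  have hxT : ∀ᶠ y in 𝓝 x, y ∈ V → y ∈ B := by
    by_contra h
    exact hΔ hx.2 ⟨x, ⟨⟨hxV, Metric.ball_subset_closedBall hx.1⟩, h⟩, rfl⟩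
  exact hxT.self_of_nhds hxV

theorem IsAnalyticNear.exists_uniform (hV : IsAnalyticNear V q) {Ω : Set E} (hΩ : Ω ∈ 𝓝 q) :
    ∃ U ∈ 𝓝 q, ∀ B : Set E, (∀ e ∈ Ω, IsAnalyticNear B e) → (∀ᶠ x in 𝓝 q, x ∈ V → x ∈ B) →
      ∀ x ∈ U, x ∈ V → x ∈ B := by
  have h1 : ∀ P : Ideal (Hol q), ∃ U ∈ 𝓝 q, P.IsPrime → ∀ B : Set E,
      (∀ e ∈ Ω, IsAnalyticNear B e) → (∀ᶠ x in 𝓝 q, x ∈ germLocus P → x ∈ B) →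
      ∀ x ∈ U, x ∈ germLocus P → x ∈ B := by
    intro P
    by_cases hP : P.IsPrime
    · obtain ⟨U, hU, h⟩ := (isAnalyticNear_germLocus P).exists_uniform_of_isPrime
        (germIdeal_germLocus P) hΩ
      exact ⟨U, hU, fun _ => h⟩
    · exact ⟨Set.univ, univ_mem, fun h => (hP h).elim⟩
  choose U hU hUB using h1
  refine ⟨(⋂ P ∈ (germIdeal V q).minimalPrimes, U P) ∩ {x | x ∈ V ↔
    ∃ P ∈ (germIdeal V q).minimalPrimes, x ∈ germLocus P}, inter_mem ((biInter_mem
      ((germIdeal V q).finite_minimalPrimes_of_isNoetherianRing (Hol q))).2 fun P _ => hU P)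
      hV.eventually_mem_iff, fun B hB hVB x hx hxV => ?_⟩
  obtain ⟨P, hP, hxP⟩ := hx.2.1 hxV
  refine hUB P hP.1.1 B hB ?_ x (Set.mem_iInter₂.1 hx.1 P hP) hxP
  filter_upwards [hV.eventually_mem_iff, hVB] with y hy1 hy2 hy
  exact hy2 (hy1.2 ⟨P, hP, hy⟩)

theorem isAnalyticNear_sInter {Ω : Set E} {𝒜 : Set (Set E)}
    (h𝒜 : ∀ A ∈ 𝒜, ∀ x ∈ Ω, IsAnalyticNear A x) (hΩ : Ω ∈ 𝓝 q) : IsAnalyticNear (⋂₀ 𝒜) q := by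
  classical
  have hqΩ : q ∈ Ω := mem_of_mem_nhds hΩ
  let 𝓘 : Set (Ideal (Hol q)) := {I | ∃ F : Finset (Set E), ↑F ⊆ 𝒜 ∧ germIdeal (⋂ A ∈ F, A) q = I}
  obtain ⟨I, ⟨F, hF, rfl⟩, hmax⟩ := set_has_maximal_iff_noetherian.2
    (inferInstanceAs (IsNoetherian (Hol q) (Hol q))) 𝓘 ⟨_, ∅, by simp, rfl⟩
  have hV : IsAnalyticNear (⋂ A ∈ F, A) q :=
    IsAnalyticNear.biInter F fun A hA => h𝒜 A (hF hA) q hqΩ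
  obtain ⟨U, hU, hUB⟩ := hV.exists_uniform hΩ
  refine hV.congr ?_
  filter_upwards [hU] with x hx
  refine ⟨fun hxF A hA => hUB A (h𝒜 A hA) ?_ x hx hxF, fun h => ?_⟩
  · have h1 := hmax _ ⟨insert A F, by
      rw [Finset.coe_insert]
      exact Set.insert_subset hA hF, rfl⟩
    rw [Finset.set_biInter_insert] at h1
    have h2 : germIdeal (⋂ A ∈ F, A) q ≤ germIdeal (A ∩ ⋂ A ∈ F, A) q :=
      germIdeal_anti (Eventually.of_forall fun x hx => hx.2)
    have h3 := (eq_of_le_of_not_lt h2 h1).ge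
    filter_upwards [((h𝒜 A hA q hqΩ).inter hV).eventually_subset h3] with y hy hyF using (hy hyF).1
  · exact Set.mem_iInter₂.2 fun A hA => h A (hF hA)

end Decomposition

theorem ringKrullDim_quotient_le_of_minimalPrimes {R : Type*} [CommRing R] {I : Ideal R}
    {d : WithBot ℕ∞} (h : ∀ P ∈ I.minimalPrimes, ringKrullDim (R ⧸ P) ≤ d) :
    ringKrullDim (R ⧸ I) ≤ d := by
  rw [ringKrullDim_quotient]
  refine iSup_le fun l => ?_
  have := l.head.1.isPrime
  obtain ⟨P, hP, hPl⟩ := Ideal.exists_minimalPrimes_le (I := I) (J := l.head.1.asIdeal) l.head.2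
  refine le_trans ?_ (h P hP)
  rw [ringKrullDim_quotient]
  let l' : LTSeries (PrimeSpectrum.zeroLocus (P : Set R)) :=
    { length := l.length
      toFun := fun i => ⟨(l i).1, hPl.trans (l.monotone (Fin.zero_le i))⟩
      step := fun i => l.step i }
  exact le_iSup
    (fun l : LTSeries (PrimeSpectrum.zeroLocus (P : Set R)) => (l.length : WithBot ℕ∞)) l'

theorem ringKrullDim_quotient_eq_of_minimalPrimes {R : Type*} [CommRing R] {I : Ideal R}
    (hI : I ≠ ⊤) {d : WithBot ℕ∞} (h : ∀ P ∈ I.minimalPrimes, ringKrullDim (R ⧸ P) = d) :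
    ringKrullDim (R ⧸ I) = d := by
  refine le_antisymm (ringKrullDim_quotient_le_of_minimalPrimes fun P hP => (h P hP).le) ?_
  obtain ⟨M, hM, hIM⟩ := Ideal.exists_le_maximal I hI
  obtain ⟨P, hP, -⟩ := Ideal.exists_minimalPrimes_le hIM
  rw [← h P hP]
  exact ringKrullDim_le_of_surjective _ (Ideal.Quotient.factor_surjective hP.1.2)

section LocalDim

variable [FiniteDimensional ℂ E] {L : Type*} [NormedAddCommGroup L] [NormedSpace ℂ L]
  [FiniteDimensional ℂ L] {V : Set E} {q : E}

theorem IsAnalyticNear.ringKrullDim_le_finrank (hV : IsAnalyticNear V q) (π : E →L[ℂ] L)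
    (h : ∀ᶠ x in 𝓝 q, x ∈ V → π x = π q → x = q) :
    ringKrullDim (Hol q ⧸ germIdeal V q) ≤ Module.finrank ℂ L := by
  rw [← Hol.ringKrullDim_eq (π q)]
  exact (finite_of_isolated_fiber hV π h).to_isIntegral.ringKrullDim_le

theorem finrank_le_ringKrullDim_add_card {S : Finset (E → ℂ)} (hS : ∀ g ∈ S, AnalyticAt ℂ g q)
    (hV : ∀ᶠ x in 𝓝 q, x ∈ V ↔ ∀ g ∈ S, g x = 0) (hq : q ∈ V) :
    (Module.finrank ℂ E : WithBot ℕ∞) ≤ ringKrullDim (Hol q ⧸ germIdeal V q) + S.card := by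
  classical
  let T : Finset (Hol q) := S.attach.image fun g => mk g.1 (hS g.1 g.2)
  have hT : ∀ a ∈ T, ∃ g, ∃ hg : g ∈ S, mk g (hS g hg) = a := by
    intro a ha
    obtain ⟨g, -, rfl⟩ := Finset.mem_image.1 ha
    exact ⟨g.1, g.2, rfl⟩
  have h1 : germIdeal V q = (Ideal.span (T : Set (Hol q))).radical := by
    refine germIdeal_eq_radical (S := S) (fun g hg => ⟨hS g hg, Ideal.subset_span
      (Finset.mem_image.2 ⟨⟨g, hg⟩, Finset.mem_attach _ _, rfl⟩)⟩)
      (hV.mono fun x hx => hx.2) (Ideal.span_le.2 fun a ha => ?_)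
    obtain ⟨g, hg, rfl⟩ := hT a ha
    exact mk_mem_germIdeal.2 (hV.mono fun x hx hxV => hx.1 hxV g hg)
  have h2 : ringKrullDim (Hol q ⧸ germIdeal V q) =
      ringKrullDim (Hol q ⧸ Ideal.span (T : Set (Hol q))) := by
    rw [h1, ringKrullDim_quotient, ringKrullDim_quotient, PrimeSpectrum.zeroLocus_radical]
  rw [h2, ← Hol.ringKrullDim_eq q]
  refine (ringKrullDim_le_ringKrullDim_quotient_add_card T ?_).trans ?_
  · rw [IsLocalRing.ringJacobson_eq_maximalIdeal]
    intro a ha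
    obtain ⟨g, hg, rfl⟩ := hT a ha
    refine mem_maximalIdeal.2 ?_
    rw [val_mk]
    exact hV.self_of_nhds.1 hq g hg
  · gcongr
    exact Finset.card_image_le.trans_eq (Finset.card_attach)

end LocalDim

section MinimalPrimes

variable {V : Set E} {q : E} {P : Ideal (Hol q)}

theorem mem_of_germIdeal_le [P.IsPrime] (hV : IsAnalyticNear V q) (h : germIdeal V q ≤ P) :
    q ∈ V := by
  by_contra hq
  exact Ideal.IsPrime.ne_top' (I := P)
    (top_le_iff.1 ((germIdeal_eq_top (hV.isClosed_near hq)).ge.trans h))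

theorem exists_mem_minimalPrimes_of_biUnion {ι : Type*} {s : Finset ι} {W : ι → Set E}
    (hP : P ∈ (germIdeal (⋃ i ∈ s, W i) q).minimalPrimes) :
    ∃ i ∈ s, P ∈ (germIdeal (W i) q).minimalPrimes := by
  have h1 := hP.1.2
  rw [germIdeal_biUnion, hP.1.1.inf_le'] at h1
  obtain ⟨i, hi, hiP⟩ := h1
  refine ⟨i, hi, ⟨hP.1.1, hiP⟩, fun Q hQ hQP => hP.2 ⟨hQ.1, ?_⟩ hQP⟩
  rw [germIdeal_biUnion]
  exact (Finset.inf_le hi).trans hQ.2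

variable [FiniteDimensional ℂ E]

theorem germLocus_eventually_subset [P.IsPrime] (hV : IsAnalyticNear V q)
    (h : germIdeal V q ≤ P) : ∀ᶠ x in 𝓝 q, x ∈ germLocus P → x ∈ V :=
  hV.eventually_subset (h.trans (germIdeal_germLocus P).ge)

theorem exists_generic_equation (hP : P ∈ (germIdeal V q).minimalPrimes) :
    ∃ (g : E → ℂ) (hg : AnalyticAt ℂ g q), mk g hg ∉ P ∧
      ∀ᶠ x in 𝓝 q, x ∈ V → g x ≠ 0 → x ∈ germLocus P := by
  have := hP.1.1
  obtain ⟨g, hgP, hg, -⟩ := Ideal.exists_notMem_mul_mem_radical hP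
  obtain ⟨g, hga, rfl⟩ := exists_rep g
  refine ⟨g, hga, hgP, ?_⟩
  obtain ⟨S, hS, hSP⟩ := isAnalyticNear_germLocus P
  have h1 : ∀ᶠ x in 𝓝 q, ∀ f ∈ S, x ∈ V → f x * g x = 0 := by
    refine (Finset.eventually_all S).2 fun f hf => ?_
    have h2 : mk f (hS f hf) ∈ P := by
      rw [← germIdeal_germLocus P]
      exact mk_mem_germIdeal.2 (hSP.mono fun x hx hxP => hx.1 hxP f hf)
    have h3 := hg _ h2
    rw [(germIdeal_isRadical V q).radical, mk_mul] at h3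
    exact mk_mem_germIdeal.1 h3
  filter_upwards [h1, hSP] with x hx1 hx2 hxV hgx
  exact hx2.2 fun f hf => (mul_eq_zero.1 (hx1 f hf hxV)).resolve_right hgx

/-- Every irreducible component of an analytic germ has points, arbitrarily close to the center,
around which the other components are absent. -/
theorem frequently_eventually_mem_iff (hV : IsAnalyticNear V q)
    (hP : P ∈ (germIdeal V q).minimalPrimes) :
    ∃ᶠ e in 𝓝 q, e ∈ germLocus P ∧ ∀ᶠ x in 𝓝 e, x ∈ V ↔ x ∈ germLocus P := by
  have := hP.1.1
  obtain ⟨g, hg, hgP, hgV⟩ := exists_generic_equation hP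
  have h1 : ∃ᶠ e in 𝓝 q, e ∈ germLocus P ∧ g e ≠ 0 := by
    intro h
    refine hgP ?_
    rw [← germIdeal_germLocus P]
    exact mk_mem_germIdeal.2 (h.mono fun x hx hxP => by_contra fun hgx => hx ⟨hxP, hgx⟩)
  refine (h1.and_eventually (hgV.eventually_nhds.and
    ((germLocus_eventually_subset hV hP.1.2).eventually_nhds.and hg.eventually_analyticAt))).mono ?_
  rintro e ⟨⟨heP, hge⟩, he1, he2, he3⟩
  refine ⟨heP, ?_⟩
  filter_upwards [he1, he2, he3.continuousAt.eventually_ne hge] with x hx1 hx2 hx3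
  exact ⟨fun h => hx1 h hx3, hx2⟩

theorem eventually_minimalPrimes_germLocus_subset (hV : IsAnalyticNear V q)
    (hP : P ∈ (germIdeal V q).minimalPrimes) : ∀ᶠ e in 𝓝 q,
      (germIdeal (germLocus P) e).minimalPrimes ⊆ (germIdeal V e).minimalPrimes := by
  have := hP.1.1
  obtain ⟨g, hg, hgP, hgV⟩ := exists_generic_equation hP
  filter_upwards [hgV.eventually_nhds, hg.eventually_analyticAt,
    (germLocus_eventually_subset hV hP.1.2).eventually_nhds,
    eventually_notMem_minimalPrimes (isAnalyticNear_germLocus P) (germIdeal_germLocus P) hg hgP]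
    with e he1 he2 he3 he4 P' hP'
  refine ⟨⟨hP'.1.1, (germIdeal_anti he3).trans hP'.1.2⟩, fun Q hQ hQP' => ?_⟩
  refine hP'.2 ⟨hQ.1, fun a ha => ?_⟩ hQP'
  obtain ⟨a, haa, rfl⟩ := exists_rep a
  have := hQ.1
  refine (Ideal.IsPrime.mem_or_mem this (y := mk g he2) ?_).resolve_right
    fun h => he4 P' hP' he2 (hQP' h)
  rw [mk_mul]
  refine hQ.2 (mk_mem_germIdeal.2 ?_)
  filter_upwards [mk_mem_germIdeal.1 ha, he1] with x hx1 hx2 hxV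
  by_cases hgx : g x = 0
  · simp [hgx]
  · simp [hx1 (hx2 hxV hgx)]

theorem eventually_exists_mem_minimalPrimes_germLocus (hV : IsAnalyticNear V q) :
    ∀ᶠ e in 𝓝 q, ∀ P' ∈ (germIdeal V e).minimalPrimes,
      ∃ P ∈ (germIdeal V q).minimalPrimes, P' ∈ (germIdeal (germLocus P) e).minimalPrimes := by
  let S := ((germIdeal V q).finite_minimalPrimes_of_isNoetherianRing (Hol q)).toFinset
  have hS : ∀ P, P ∈ S ↔ P ∈ (germIdeal V q).minimalPrimes := fun P => Set.Finite.mem_toFinset _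
  filter_upwards [hV.eventually_mem_iff.eventually_nhds] with e he P' hP'
  have h1 : germIdeal V e = germIdeal (⋃ P ∈ S, germLocus P) e := by
    refine germIdeal_congr (he.mono fun x hx => hx.trans ?_)
    rw [Set.mem_iUnion₂]
    exact ⟨fun ⟨P, hP, hx⟩ => ⟨P, (hS P).2 hP, hx⟩,
      fun ⟨P, hP, hx⟩ => ⟨P, (hS P).1 hP, hx⟩⟩
  rw [h1] at hP'
  obtain ⟨P, hP, hP'⟩ := exists_mem_minimalPrimes_of_biUnion hP'
  exact ⟨P, (hS P).1 hP, hP'⟩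

/-- If `V` is defined by `n` equations around `q`, its components at `q` have codimension
at most `n`. -/
theorem finrank_le_ringKrullDim_add {n : ℕ} (hV : IsAnalyticNear V q)
    (h : ∀ᶠ e in 𝓝 q, ∃ S : Finset (E → ℂ), S.card ≤ n ∧ (∀ g ∈ S, AnalyticAt ℂ g e) ∧
      ∀ᶠ x in 𝓝 e, x ∈ V ↔ ∀ g ∈ S, g x = 0) (hP : P ∈ (germIdeal V q).minimalPrimes) :
    (Module.finrank ℂ E : WithBot ℕ∞) ≤ ringKrullDim (Hol q ⧸ P) + n := by
  have := hP.1.1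
  obtain ⟨e, ⟨heP, he⟩, ⟨S, hSn, hS, hSV⟩, hdim⟩ :=
    ((frequently_eventually_mem_iff hV hP).and_eventually (h.and
      (eventually_ringKrullDim_minimalPrimes (isAnalyticNear_germLocus P)
      (germIdeal_germLocus P)))).exists
  refine (finrank_le_ringKrullDim_add_card hS hSV (he.self_of_nhds.2 heP)).trans ?_
  rw [germIdeal_congr he]
  gcongr
  exact ringKrullDim_quotient_le_of_minimalPrimes fun P' hP' => (hdim heP P' hP').le

end MinimalPrimes

section Irreducible

variable [FiniteDimensional ℂ E] {Ω C A : Set E}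

/-- The points of `C` at which some component of the germ of `C` satisfies `p`. -/
def componentLocus (p : ∀ q : E, Ideal (Hol q) → Prop) (C : Set E) : Set E :=
  {q | ∃ P ∈ (germIdeal C q).minimalPrimes, p q P}

/-- A property of prime germs is locally constant if it passes from an irreducible germ to all
components of that germ at nearby points, and so does its negation. -/
def LocallyConstantGermProperty (Ω : Set E) (p : ∀ q : E, Ideal (Hol q) → Prop) : Prop :=
  ∀ q ∈ Ω, ∀ (P : Ideal (Hol q)) [P.IsPrime], ∀ᶠ e in 𝓝 q, e ∈ germLocus P →
    ∀ P' ∈ (germIdeal (germLocus P) e).minimalPrimes, p e P' ↔ p q P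

variable {p : ∀ q : E, Ideal (Hol q) → Prop}

theorem LocallyConstantGermProperty.not (hp : LocallyConstantGermProperty Ω p) :
    LocallyConstantGermProperty Ω fun q P => ¬ p q P :=
  fun q hq P _ => (hp q hq P).mono fun _ he heP P' hP' => not_congr (he heP P' hP')

theorem IsAnalyticIn.componentLocus (hΩ : IsOpen Ω) (hC : IsAnalyticIn Ω C)
    (hp : LocallyConstantGermProperty Ω p) : IsAnalyticIn Ω (C ∩ componentLocus p C) := by
  classical
  refine IsAnalyticIn.of_isAnalyticNear hΩ (Set.inter_subset_left.trans hC.1) fun q hq => ?_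
  have hCq := hC.isAnalyticNear hq
  have hfin := (germIdeal C q).finite_minimalPrimes_of_isNoetherianRing (Hol q)
  let S := hfin.toFinset.filter fun P => p q P
  have hS : ∀ P, P ∈ S ↔ P ∈ (germIdeal C q).minimalPrimes ∧ p q P := fun P => by
    rw [Finset.mem_filter, Set.Finite.mem_toFinset]
  have h1 : ∀ᶠ e in 𝓝 q, ∀ P ∈ (germIdeal C q).minimalPrimes,
      (e ∈ germLocus P → ∀ P' ∈ (germIdeal (germLocus P) e).minimalPrimes, p e P' ↔ p q P) ∧
      (germIdeal (germLocus P) e).minimalPrimes ⊆ (germIdeal C e).minimalPrimes ∧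
      IsAnalyticNear (germLocus P) e := by
    refine hfin.eventually_all.2 fun P hP => ?_
    have := hP.1.1
    exact (hp q hq P).and ((eventually_minimalPrimes_germLocus_subset hCq hP).and
      (isAnalyticNear_germLocus P).eventually)
  refine (IsAnalyticNear.biUnion S fun P _ => isAnalyticNear_germLocus P).congr ?_
  filter_upwards [h1, eventually_exists_mem_minimalPrimes_germLocus hCq, hCq.eventually]
    with e he1 he2 he3
  rw [Set.mem_iUnion₂]
  constructor
  · rintro ⟨P, hP, heP⟩
    rw [hS] at hP
    obtain ⟨P', hP'⟩ := exists_minimalPrimes_germIdeal heP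
    obtain ⟨h2, h3, -⟩ := he1 P hP.1
    have := hP'.1.1
    exact ⟨mem_of_germIdeal_le he3 (h3 hP').1.2, P', h3 hP', (h2 heP P' hP').2 hP.2⟩
  · rintro ⟨-, P', hP', hp'⟩
    obtain ⟨P, hP, hPP'⟩ := he2 P' hP'
    obtain ⟨h2, -, h4⟩ := he1 P hP
    have := hP'.1.1
    have heP := mem_of_germIdeal_le h4 hPP'.1.2
    exact ⟨P, (hS P).2 ⟨hP, (h2 heP P' hPP').1 hp'⟩, heP⟩

theorem LocallyConstantGermProperty.forall_of_subset (hp : LocallyConstantGermProperty Ω p)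
    (hC : IsAnalyticIn Ω C) (h : C ⊆ componentLocus p C) {q : E} (hq : q ∈ C) {P : Ideal (Hol q)}
    (hP : P ∈ (germIdeal C q).minimalPrimes) : p q P := by
  have := hP.1.1
  have hqΩ := hC.1 hq
  obtain ⟨e, ⟨heP, he⟩, hpe⟩ := ((frequently_eventually_mem_iff (hC.isAnalyticNear hqΩ)
    hP).and_eventually (hp q hqΩ P)).exists
  obtain ⟨P', hP', hpP'⟩ := h (he.self_of_nhds.2 heP)
  rw [germIdeal_congr he] at hP'
  exact (hpe heP P' hP').1 hpP'

/-- A locally constant property of germs of an irreducible analytic set holds everywhere as soon as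
it holds somewhere. -/
theorem IsIrreducibleAnalyticIn.forall_minimalPrimes (hΩ : IsOpen Ω)
    (hC : IsIrreducibleAnalyticIn Ω C) (hp : LocallyConstantGermProperty Ω p) {a : E} (ha : a ∈ C)
    {Q : Ideal (Hol a)} (hQ : Q ∈ (germIdeal C a).minimalPrimes) (hpQ : p a Q) {q : E} (hq : q ∈ C)
    {P : Ideal (Hol q)} (hP : P ∈ (germIdeal C q).minimalPrimes) : p q P := by
  rcases hC.2.2 _ _ (hC.1.componentLocus hΩ hp) (hC.1.componentLocus hΩ hp.not) (fun e he => by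
    obtain ⟨P, hP⟩ := exists_minimalPrimes_germIdeal he
    by_cases hpP : p e P
    exacts [Or.inl ⟨he, P, hP, hpP⟩, Or.inr ⟨he, P, hP, hpP⟩]) with h | h
  · exact hp.forall_of_subset hC.1 (fun e he => (h he).2) hq hP
  · exact (hp.not.forall_of_subset hC.1 (fun e he => (h he).2) ha hQ hpQ).elim

theorem locallyConstantGermProperty_ringKrullDim (d : WithBot ℕ∞) :
    LocallyConstantGermProperty Ω fun q P => ringKrullDim (Hol q ⧸ P) = d := by
  intro q hq P _
  filter_upwards [eventually_ringKrullDim_minimalPrimes (isAnalyticNear_germLocus P)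
    (germIdeal_germLocus P)] with e he heP P' hP'
  rw [he heP P' hP']

theorem IsAnalyticIn.locallyConstantGermProperty (hA : IsAnalyticIn Ω A) :
    LocallyConstantGermProperty Ω fun q P => germIdeal A q ≤ P := by
  intro q hq P _
  by_cases h : germIdeal A q ≤ P
  · filter_upwards [(germLocus_eventually_subset (hA.isAnalyticNear hq) h).eventually_nhds]
      with e he _ P' hP'
    exact iff_of_true ((germIdeal_anti he).trans hP'.1.2) h
  · obtain ⟨a, ha, haP⟩ := SetLike.not_le_iff_exists.1 h
    obtain ⟨a, haa, rfl⟩ := exists_rep a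
    filter_upwards [(mk_mem_germIdeal.1 ha).eventually_nhds, haa.eventually_analyticAt,
      eventually_notMem_minimalPrimes (isAnalyticNear_germLocus P) (germIdeal_germLocus P) haa haP]
      with e he1 he2 he3 _ P' hP'
    exact iff_of_false (fun h' => he3 P' hP' he2 (h' (mk_mem_germIdeal.2 he1))) h

/-- The identity theorem for irreducible analytic sets. -/
theorem IsIrreducibleAnalyticIn.subset_of_germIdeal_le (hΩ : IsOpen Ω)
    (hC : IsIrreducibleAnalyticIn Ω C) (hA : IsAnalyticIn Ω A) {a : E} (ha : a ∈ C)
    {Q : Ideal (Hol a)} (hQ : Q ∈ (germIdeal C a).minimalPrimes) (h : germIdeal A a ≤ Q) :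
    C ⊆ A := by
  intro q hq
  have hqΩ := hC.1.1 hq
  obtain ⟨P, hP⟩ := exists_minimalPrimes_germIdeal hq
  have := hP.1.1
  exact mem_of_germIdeal_le (hA.isAnalyticNear hqΩ)
    (hC.forall_minimalPrimes hΩ hA.locallyConstantGermProperty ha hQ h hq hP)

/-- The smallest analytic subset of `Ω` containing the irreducible germ defined by `P`. -/
def analyticHull (Ω : Set E) {a : E} (P : Ideal (Hol a)) : Set E :=
  ⋂₀ {A | IsAnalyticIn Ω A ∧ germIdeal A a ≤ P}

section Hull

variable {a : E} {P : Ideal (Hol a)}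

theorem isAnalyticIn_analyticHull (hΩ : IsOpen Ω) (hA : IsAnalyticIn Ω A)
    (h : germIdeal A a ≤ P) : IsAnalyticIn Ω (analyticHull Ω P) :=
  IsAnalyticIn.of_isAnalyticNear hΩ ((Set.sInter_subset_of_mem
    (show A ∈ {A | IsAnalyticIn Ω A ∧ germIdeal A a ≤ P} from ⟨hA, h⟩)).trans hA.1) fun _ hq =>
    isAnalyticNear_sInter (fun _ hB _ hx => hB.1.isAnalyticNear hx) (hΩ.mem_nhds hq)

theorem germIdeal_analyticHull_le [P.IsPrime] (hΩ : Ω ∈ 𝓝 a) :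
    germIdeal (analyticHull Ω P) a ≤ P := by
  obtain ⟨U, hU, h⟩ := (isAnalyticNear_germLocus P).exists_uniform hΩ
  refine (germIdeal_anti ?_).trans (germIdeal_germLocus P).le
  filter_upwards [hU] with x hx hxP B hB
  exact h B (fun e he => hB.1.isAnalyticNear he)
    (germLocus_eventually_subset (hB.1.isAnalyticNear (mem_of_mem_nhds hΩ)) hB.2) x hx hxP

theorem isIrreducibleAnalyticIn_analyticHull [P.IsPrime] (hΩ : IsOpen Ω) (ha : a ∈ Ω)
    (hA : IsAnalyticIn Ω A) (h : germIdeal A a ≤ P) :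
    IsIrreducibleAnalyticIn Ω (analyticHull Ω P) := by
  refine ⟨isAnalyticIn_analyticHull hΩ hA h, ⟨a, fun B hB =>
    mem_of_germIdeal_le (hB.1.isAnalyticNear ha) hB.2⟩, fun C₁ C₂ h₁ h₂ hsub => ?_⟩
  have h3 : germIdeal (C₁ ∪ C₂) a ≤ P := (germIdeal_anti (Eventually.of_forall hsub)).trans
    (germIdeal_analyticHull_le (hΩ.mem_nhds ha))
  rw [germIdeal_union] at h3
  rcases (Ideal.IsPrime.inf_le (inferInstance : P.IsPrime)).1 h3 with h4 | h4
  exacts [Or.inl (Set.sInter_subset_of_mem ⟨h₁, h4⟩), Or.inr (Set.sInter_subset_of_mem ⟨h₂, h4⟩)]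

end Hull

/-- The irreducible components of `A` passing through `a` arise from the components of the germ
of `A` at `a`. -/
theorem IsIrreducibleComponentOfAnalytic.exists_eq_analyticHull (hΩ : IsOpen Ω)
    (hA : IsAnalyticIn Ω A) (hC : IsIrreducibleComponentOfAnalytic Ω A C) {a : E} (ha : a ∈ C) :
    ∃ P ∈ (germIdeal A a).minimalPrimes, C = analyticHull Ω P ∧
      P ∈ (germIdeal C a).minimalPrimes := by
  have haΩ := hC.1.1.1 ha
  obtain ⟨Q, hQ⟩ := exists_minimalPrimes_germIdeal ha
  have := hQ.1.1
  obtain ⟨P, hP, hPQ⟩ := Ideal.exists_minimalPrimes_le (I := germIdeal A a) (J := Q)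
    ((germIdeal_anti (Eventually.of_forall hC.2.1)).trans hQ.1.2)
  have := hP.1.1
  have h1 := germIdeal_analyticHull_le (P := P) (hΩ.mem_nhds haΩ)
  have h2 := isIrreducibleAnalyticIn_analyticHull hΩ haΩ hA hP.1.2
  have h3 := hC.2.2 _ h2 (hC.1.subset_of_germIdeal_le hΩ h2.1 ha hQ (h1.trans hPQ))
    (Set.sInter_subset_of_mem ⟨hA, hP.1.2⟩)
  rw [h3] at h1
  obtain rfl : P = Q := le_antisymm hPQ (hQ.2 ⟨hP.1.1, h1⟩ hPQ)
  exact ⟨P, hP, h3.symm, hQ⟩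

/-- If all components of the germ of `A` at `a` have dimension `d`, the union of the irreducible
components of `A` through `a` has pure dimension `d`. -/
theorem ringKrullDim_sUnion_irreducibleComponents (hΩ : IsOpen Ω) (hA : IsAnalyticIn Ω A) {a : E}
    {d : WithBot ℕ∞}
    (hd : ∀ P ∈ (germIdeal A a).minimalPrimes, ringKrullDim (Hol a ⧸ P) = d) {q : E}
    (hq : q ∈ ⋃₀ {C | IsIrreducibleComponentOfAnalytic Ω A C ∧ a ∈ C}) :
    ringKrullDim (Hol q ⧸ germIdeal
      (⋃₀ {C | IsIrreducibleComponentOfAnalytic Ω A C ∧ a ∈ C}) q) = d := by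
  have hfin : {C | IsIrreducibleComponentOfAnalytic Ω A C ∧ a ∈ C}.Finite := by
    refine (((germIdeal A a).finite_minimalPrimes_of_isNoetherianRing (Hol a)).image
      fun P => analyticHull Ω P).subset ?_
    rintro C ⟨hC, haC⟩
    obtain ⟨P, hP, h, -⟩ := hC.exists_eq_analyticHull hΩ hA haC
    exact ⟨P, hP, h.symm⟩
  have hU : ⋃₀ {C | IsIrreducibleComponentOfAnalytic Ω A C ∧ a ∈ C} =
      ⋃ C ∈ hfin.toFinset, C := by
    rw [Set.sUnion_eq_biUnion]
    simp
  have hqΩ : q ∈ Ω := by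
    obtain ⟨C, hC, hqC⟩ := hq
    exact hC.1.1.1.1 hqC
  refine ringKrullDim_quotient_eq_of_minimalPrimes (germIdeal_ne_top hq) fun P hP => ?_
  rw [hU] at hP
  obtain ⟨C, hC, hPC⟩ := exists_mem_minimalPrimes_of_biUnion hP
  obtain ⟨hC, haC⟩ := hfin.mem_toFinset.1 hC
  obtain ⟨P₀, hP₀, -, hP₀C⟩ := hC.exists_eq_analyticHull hΩ hA haC
  have := hP.1.1
  exact hC.1.forall_minimalPrimes hΩ (locallyConstantGermProperty_ringKrullDim d) haC hP₀C
    (hd P₀ hP₀) (mem_of_germIdeal_le (hC.1.1.isAnalyticNear hqΩ) hPC.1.2) hPC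

end Irreducible

/-- Let `X` be a connected `n`-dimensional complex manifold (modeled as a connected
open subset of `ℂ^n`), `Y` a connected `m`-dimensional complex manifold (a connected
open subset of `ℂ^m`), `f = (f_1, …, f_n)` a system of `n` holomorphic functions on
`X × Y`, and let `X'` denote the common zero set of the `f_k` in `X × Y`.
If `x*` is an isolated solution of `f(x, y*) = 0` for some `y* ∈ Y`, then the local
dimension of `X'` at `(x*, y*)` equals `m`; consequently the union `X''` of the
irreducible components of `X'` passing through `(x*, y*)` has pure dimension `m`. -/
theorem local_dimension_eq_of_isolated_solution (n m : ℕ)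
    (X : Set (Fin n → ℂ)) (Y : Set (Fin m → ℂ))
    (hXopen : IsOpen X) (hXconn : IsConnected X)
    (hYopen : IsOpen Y) (hYconn : IsConnected Y)
    (f : (Fin n → ℂ) × (Fin m → ℂ) → Fin n → ℂ)
    (hf : ∀ p ∈ X ×ˢ Y, AnalyticAt ℂ f p)
    (X' : Set ((Fin n → ℂ) × (Fin m → ℂ)))
    (hX' : X' = {p ∈ X ×ˢ Y | f p = 0})
    (xs : Fin n → ℂ) (ys : Fin m → ℂ) (hxs : xs ∈ X) (hys : ys ∈ Y)
    (hsol : f (xs, ys) = 0)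
    (hiso : ∃ O : Set (Fin n → ℂ), IsOpen O ∧ xs ∈ O ∧ O ⊆ X ∧
      {x ∈ O | f (x, ys) = 0} = {xs}) :
    localDim X' (xs, ys) = (m : WithBot (WithTop ℕ)) ∧
    ∀ q ∈ ⋃₀ {C | IsIrreducibleComponentOfAnalytic (X ×ˢ Y) X' C ∧ (xs, ys) ∈ C},
      localDim (⋃₀ {C | IsIrreducibleComponentOfAnalytic (X ×ˢ Y) X' C ∧ (xs, ys) ∈ C}) q
        = (m : WithBot (WithTop ℕ)) := by
  have hΩ : IsOpen (X ×ˢ Y) := hXopen.prod hYopen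
  have hp : (xs, ys) ∈ X ×ˢ Y := ⟨hxs, hys⟩
  classical
  let S : Finset ((Fin n → ℂ) × (Fin m → ℂ) → ℂ) := Finset.univ.image fun k x => f x k
  have hSn : S.card ≤ n := Finset.card_image_le.trans_eq (Finset.card_fin n)
  have hS : ∀ e ∈ X ×ˢ Y, ∀ g ∈ S, AnalyticAt ℂ g e := by
    intro e he g hg
    obtain ⟨k, -, rfl⟩ := Finset.mem_image.1 hg
    exact (ContinuousLinearMap.proj (R := ℂ) (φ := fun _ : Fin n => ℂ) k).analyticAt _ |>.comp
      (hf e he)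
  have hSX : ∀ e ∈ X ×ˢ Y, ∀ᶠ x in 𝓝 e, x ∈ X' ↔ ∀ g ∈ S, g x = 0 := by
    intro e he
    filter_upwards [hΩ.mem_nhds he] with x hx
    simp only [S, Finset.forall_mem_image, hX', Set.mem_ofPred_eq, hx, true_and, funext_iff,
      Finset.mem_univ, forall_const, Pi.zero_apply]
  have hX'an : IsAnalyticIn (X ×ˢ Y) X' := IsAnalyticIn.of_isAnalyticNear hΩ
    (by rw [hX']; exact fun x hx => hx.1) fun e he => ⟨S, hS e he, hSX e he⟩
  have hpX' : (xs, ys) ∈ X' := by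
    rw [hX']
    exact ⟨hp, hsol⟩
  have hupper : ringKrullDim (Hol (xs, ys) ⧸ germIdeal X' (xs, ys)) ≤ m := by
    have h1 := (hX'an.isAnalyticNear hp).ringKrullDim_le_finrank
      (ContinuousLinearMap.snd ℂ (Fin n → ℂ) (Fin m → ℂ)) (by
        obtain ⟨O, hO, hxO, -, hOf⟩ := hiso
        filter_upwards [(hO.preimage continuous_fst).mem_nhds hxO] with x hx hxX' hxs
        have h2 : x.2 = ys := hxs
        have h3 : x.1 ∈ {x ∈ O | f (x, ys) = 0} := by
          refine ⟨hx, ?_⟩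
          rw [hX'] at hxX'
          rw [← h2]
          exact hxX'.2
        rw [hOf] at h3
        exact Prod.ext h3 h2)
    rwa [Module.finrank_fin_fun] at h1
  have hdim : ∀ P ∈ (germIdeal X' (xs, ys)).minimalPrimes,
      ringKrullDim (Hol (xs, ys) ⧸ P) = m := by
    intro P hP
    refine le_antisymm ((ringKrullDim_le_of_surjective _
      (Ideal.Quotient.factor_surjective hP.1.2)).trans hupper) ?_
    have h1 := finrank_le_ringKrullDim_add (n := n) (hX'an.isAnalyticNear hp) (by
      filter_upwards [hΩ.mem_nhds hp] with e he using ⟨S, hSn, hS e he, hSX e he⟩) hP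
    rw [Module.finrank_prod, Module.finrank_fin_fun, Module.finrank_fin_fun] at h1
    revert h1
    generalize ringKrullDim (Hol (xs, ys) ⧸ P) = d
    intro h1
    induction d using WithBot.recBotCoe with
    | bot => simp at h1
    | coe d =>
      rw [Nat.add_comm] at h1
      have h2 : ((m : ℕ∞) + n) ≤ d + n := by exact_mod_cast h1
      exact_mod_cast (ENat.add_le_add_iff_right (ENat.natCast_ne_top n)).1 h2
  exact ⟨ringKrullDim_quotient_eq_of_minimalPrimes (germIdeal_ne_top hpX') hdim, fun q hq =>
    ringKrullDim_sUnion_irreducibleComponents hΩ hX'an hdim hq⟩
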